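/- For every ε > 0 there exist L2 ≥ L0 and a function ρ2 : (L2,∞) → (0,ρ0) such that for every L > L2 and every ρ ∈ (0,ρ2(L)) there exists a function h ∈ X_{L,ρ}, continuous on all of ℝ, solving equation (E), and satisfying: (i) (1/4)·e^{−ψ_ρ[h](x)} ≤ h(x) ≤ 2·e^{−ψ_ρ[h](x)} for all x < Lρ; (ii) (1/4)·e^{−(x−Lρ)} ≤ h(x) ≤ 2·e^{−(x−Lρ)} for all x ≥ Lρ; and (iii) there exists a constant k > 0 with |k − 1| < ε such that lim_{x→∞} e^x·h(x) = k. -/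

import Mathlib

open Set MeasureTheory Filter

/-- The weight exponent ω. -/
noncomputable def omegaFn (m L ρ x : ℝ) : ℝ :=
  if x ≤ -(L*ρ) then m/ρ*(x+L*ρ) else if x < L*ρ then 0 else -(1/2)*(x - L*ρ)

/-- The norm on the space X_{L,ρ}. -/
noncomputable def normX (m L ρ : ℝ) (h : ℝ → ℝ) : ℝ :=
  ⨆ x : ℝ, |h x| * Real.exp (-(omegaFn m L ρ x))

/-- Membership in the space X_{L,ρ}. -/
def memX (a m L ρ : ℝ) (h : ℝ → ℝ) : Prop :=
  ContinuousOn h {x : ℝ | x ≠ L*ρ} ∧ (∫ x : ℝ, h x) = 1 ∧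
  (1/ρ) * (∫ x : ℝ, Real.exp (-(a/ρ)*x) * h x) = 1/(1+ρ) ∧
  ∀ x : ℝ, |h x| ≤ 2 * Real.exp (omegaFn m L ρ x)

/-- The hypotheses on the coagulation kernel K. -/
def KernelHyp (K : ℝ → ℝ → ℝ) (γ a K0 δ : ℝ) : Prop :=
  γ < 1 ∧ a = 1 - γ ∧
  ContinuousOn (fun p : ℝ × ℝ => K p.1 p.2) (Ioi 0 ×ˢ Ioi 0) ∧
  (∀ x y : ℝ, 0 < x → 0 < y → 0 ≤ K x y) ∧
  (∀ x y : ℝ, 0 < x → 0 < y → K x y = K y x) ∧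
  (∀ x y α : ℝ, 0 < x → 0 < y → 0 < α → K (α*x) (α*y) = α ^ γ * K x y) ∧
  0 < K0 ∧ δ ∈ Ioo 0 (min 1 a) ∧
  ∀ x ∈ Ioo (0:ℝ) 2, |x ^ a * K x 1 - 1| ≤ K0 * x ^ δ

/-- The hypotheses on the fixed parameters m, L0, ρ0. -/
def ParamHyp (a m L0 ρ0 : ℝ) : Prop :=
  max (a+1) (3*a) < m ∧ (1/a) * Real.log (4*m) < L0 ∧ ρ0 ∈ Ioo (0:ℝ) 1

/-- The function Q[h]. -/
noncomputable def Qfun (K : ℝ → ℝ → ℝ) (a ρ : ℝ) (h : ℝ → ℝ) (y : ℝ) : ℝ :=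
  ∫ z : ℝ, Real.exp (a/ρ*(y-z)) * K (Real.exp ((y-z)/ρ)) 1 * h z

/-- The function ψ_ρ[h]. -/
noncomputable def psiFn (K : ℝ → ℝ → ℝ) (a L ρ : ℝ) (h : ℝ → ℝ) (x : ℝ) : ℝ :=
  (1/ρ) * ∫ y in Ioo x (L*ρ), Real.exp (-(a/ρ)*y) * Qfun K a ρ h y

/-- The remainder R[h]. -/
noncomputable def Rfun (K : ℝ → ℝ → ℝ) (a L ρ : ℝ) (h : ℝ → ℝ) (x : ℝ) : ℝ :=
  if x < L*ρ then
    -(1/ρ) * ∫ y in Iio x, ∫ z in Iio (x + ρ * Real.log (1 - Real.exp ((y-x)/ρ))),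
      Real.exp (-(a/ρ)*z) * K (Real.exp ((y-z)/ρ)) 1 * h y * h z
  else
    -(1/ρ) * (∫ y in Ioi x, Real.exp (-(a/ρ)*y) * h y) * (∫ z in Ioi x, h z)
    + (1/ρ) * (∫ y in Iio x, ∫ z in Ioi x,
        (Real.exp (-(a/ρ)*z) * K (Real.exp ((y-z)/ρ)) 1 - Real.exp (-(a/ρ)*y)) * h y * h z)
    + (1/ρ) * (∫ y in Iio x, ∫ z in Ioo (x + ρ * Real.log (1 - Real.exp ((y-x)/ρ))) x,
        Real.exp (-(a/ρ)*z) * K (Real.exp ((y-z)/ρ)) 1 * h y * h z)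

/-- The remainder R̃[h]. -/
noncomputable def Rtil (K : ℝ → ℝ → ℝ) (a L ρ : ℝ) (h : ℝ → ℝ) (x : ℝ) : ℝ :=
  if x < L*ρ then
    Rfun K a L ρ h x - (1/ρ) * ∫ y in Ioo x (L*ρ),
      Real.exp (-(psiFn K a L ρ h x - psiFn K a L ρ h y)) * Real.exp (-(a/ρ)*y) *
        Qfun K a ρ h y * Rfun K a L ρ h y
  else
    Rfun K a L ρ h x - (1/(1+ρ)) * ∫ y in Ioo (L*ρ) x,
      Real.exp ((y-x)/(1+ρ)) * Rfun K a L ρ h y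

/-- Equation (E) in exponential variables. -/
def solvesE (K : ℝ → ℝ → ℝ) (a ρ : ℝ) (h : ℝ → ℝ) : Prop :=
  ∀ x : ℝ, h x = (1/ρ) * ∫ y in Iio x,
    ∫ z in Ioi (x + ρ * Real.log (1 - Real.exp ((y-x)/ρ))),
      Real.exp (-(a/ρ)*z) * K (Real.exp ((y-z)/ρ)) 1 * h y * h z

/-- The decay exponent λ. -/
noncomputable def lamFn (K : ℝ → ℝ → ℝ) (a L ρ : ℝ) (h : ℝ → ℝ) (x : ℝ) : ℝ :=
  if x < L*ρ then -psiFn K a L ρ h x else -(1/2)*(x - L*ρ)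

/-- The remainder H. -/
noncomputable def Hfun (K : ℝ → ℝ → ℝ) (a ρ : ℝ) (h : ℝ → ℝ) (x : ℝ) : ℝ :=
  (1/ρ) * (∫ y in Iio x, ∫ z in Ioi (x + ρ * Real.log (1 - Real.exp ((y-x)/ρ))),
      Real.exp (-(a/ρ)*z) * K (Real.exp ((y-z)/ρ)) 1 * h y * h z)
    - (ρ/(1+ρ)) * h x - (1/(1+ρ)) * ∫ z in Ioi x, h z

structure Ker (a K0 δ : ℝ) (κ : ℝ → ℝ) : Prop where
  ha : 0 < a
  hK0 : 0 < K0
  hδ : 0 < δ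
  hδ1 : δ < 1
  hδa : δ < a
  cont : Continuous κ
  nn : ∀ t, 0 ≤ κ t
  sym : ∀ t, κ t = Real.exp ((1+a)*t) * κ (-t)
  near : ∀ t, t < Real.log 2 → |κ t - 1| ≤ K0 * Real.exp (δ*t)

noncomputable def kU (a s : ℝ) : ℝ := Real.exp (-a*s)/a

noncomputable def kW (a ρ L s : ℝ) : ℝ := Real.exp (-(3/4)*kU a s - ρ*max (s-L) 0)

def Cls (a ρ L c : ℝ) (f : ℝ → ℝ) : Prop := Measurable f ∧ ∀ s, |f s| ≤ c * kW a ρ L s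

theorem kU_pos {a : ℝ} (ha : 0 < a) (s : ℝ) : 0 < kU a s := by unfold kU; positivity

theorem kU_anti {a : ℝ} (ha : 0 < a) {s t : ℝ} (h : s ≤ t) : kU a t ≤ kU a s := by
  unfold kU
  have : -a*t ≤ -a*s := by nlinarith
  gcongr

theorem kU_cont (a : ℝ) : Continuous (kU a) := by unfold kU; fun_prop

theorem kW_cont (a ρ L : ℝ) : Continuous (kW a ρ L) := by
  have := kU_cont a
  unfold kW; fun_prop

theorem kW_pos (a ρ L s : ℝ) : 0 < kW a ρ L s := Real.exp_pos _

theorem kW_le_U {a ρ L : ℝ} (hρ : 0 < ρ) (s : ℝ) : kW a ρ L s ≤ Real.exp (-(3/4)*kU a s) := by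
  unfold kW
  apply Real.exp_le_exp.2
  have := mul_nonneg hρ.le (le_max_right (s-L) 0)
  linarith

theorem kW_le_E {a ρ L : ℝ} (ha : 0 < a) (hρ : 0 < ρ) (s : ℝ) :
    kW a ρ L s ≤ Real.exp (-ρ*(s-L)) := by
  unfold kW
  apply Real.exp_le_exp.2
  have := mul_le_mul_of_nonneg_left (le_max_left (s-L) 0) hρ.le
  have := kU_pos ha s
  linarith

theorem kW_le_one {a ρ L : ℝ} (ha : 0 < a) (hρ : 0 < ρ) (s : ℝ) :
    kW a ρ L s ≤ 1 := by
  unfold kW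
  apply Real.exp_le_one_iff.2
  have := mul_nonneg hρ.le (le_max_right (s-L) 0)
  have := kU_pos ha s
  linarith

theorem kW_left {a ρ L s : ℝ} (hs : s ≤ L) : kW a ρ L s = Real.exp (-(3/4)*kU a s) := by
  unfold kW
  rw [max_eq_right (by linarith)]; simp

theorem kW_right {a ρ L s : ℝ} (hs : L ≤ s) :
    kW a ρ L s = Real.exp (-(3/4)*kU a s) * Real.exp (-ρ*(s-L)) := by
  unfold kW
  rw [max_eq_left (by linarith), ← Real.exp_add]; congr 1; ring

theorem expU_le {a c : ℝ} (ha : 0 < a) (hc : 0 < c) (n : ℕ) (s : ℝ) :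
    Real.exp (-c*kU a s) ≤ n.factorial * (a/c)^n * Real.exp (a*n*s) := by
  have hX : 0 < c * kU a s := mul_pos hc (kU_pos ha s)
  have h := Real.pow_div_factorial_le_exp (c*kU a s) hX.le n
  have hn : (0:ℝ) < n.factorial := by positivity
  have e : Real.exp (a*n*s) = (Real.exp (-a*s))⁻¹^n := by
    rw [← Real.exp_neg, ← Real.exp_nat_mul]; congr 1; ring
  have e2 : n.factorial * (a/c)^n * Real.exp (a*n*s) = ((c*kU a s)^n / n.factorial)⁻¹ := by
    rw [e]; unfold kU
    have := Real.exp_pos (-a*s)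
    simp only [mul_pow, div_pow, inv_pow]
    field_simp
  rw [e2, show -c*kU a s = -(c*kU a s) by ring, Real.exp_neg]
  apply inv_anti₀ _ h
  positivity

theorem int_left {a c : ℝ} (ha : 0 < a) (hc : 0 < c) (p S : ℝ) :
    IntegrableOn (fun s => Real.exp (p*s) * Real.exp (-c*kU a s)) (Iio S) := by
  obtain ⟨n, hn⟩ := exists_nat_gt ((1 - p)/a)
  have hn' : 0 < p + a*n := by
    rw [div_lt_iff₀ ha] at hn; nlinarith
  have h1 : IntegrableOn (fun s => (n.factorial * (a/c)^n) * Real.exp ((p+a*n)*s)) (Iio S) :=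
    ((integrableOn_exp_mul_Iic hn' S).mono_set Iio_subset_Iic_self).const_mul _
  refine h1.mono' ?_ ?_
  · have := kU_cont a
    exact (by fun_prop : Continuous _).aestronglyMeasurable
  · refine Eventually.of_forall fun s => ?_
    rw [Real.norm_of_nonneg (by positivity)]
    calc _ ≤ Real.exp (p*s) * (n.factorial * (a/c)^n * Real.exp (a*n*s)) := by
          gcongr; exact expU_le ha hc n s
      _ = _ := by rw [show (p+a*n)*s = p*s + a*n*s by ring, Real.exp_add]; ring

theorem int_full {a c : ℝ} (ha : 0 < a) (hc : 0 < c) {p : ℝ} (hp : p < 0) :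
    Integrable (fun s => Real.exp (p*s) * Real.exp (-c*kU a s)) := by
  have h1 := int_left ha hc p 0
  have h2 : IntegrableOn (fun s => Real.exp (p*s) * Real.exp (-c*kU a s)) (Ici 0) := by
    refine (((integrableOn_Ici_iff_integrableOn_Ioi).2 (integrableOn_exp_mul_Ioi hp 0))).mono' ?_ ?_
    · have := kU_cont a
      exact (by fun_prop : Continuous _).aestronglyMeasurable
    · refine Eventually.of_forall fun s => ?_
      rw [Real.norm_of_nonneg (by positivity)]
      have : Real.exp (-c*kU a s) ≤ 1 := by
        apply Real.exp_le_one_iff.2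
        have := mul_pos hc (kU_pos ha s)
        linarith
      nlinarith [Real.exp_pos (p*s)]
  have := h1.union h2
  rwa [Iio_union_Ici, integrableOn_univ] at this

theorem int_W {a ρ L : ℝ} (ha : 0 < a) (hρ : 0 < ρ) : Integrable (kW a ρ L) := by
  have h1 := int_left ha (show (0:ℝ) < 3/4 by norm_num) 0 L
  have h2 : IntegrableOn (fun s => Real.exp (ρ*L) * Real.exp ((-ρ)*s)) (Ici L) :=
    (((integrableOn_Ici_iff_integrableOn_Ioi).2 (integrableOn_exp_mul_Ioi (neg_lt_zero.2 hρ) L))).const_mul _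
  have h1' : IntegrableOn (kW a ρ L) (Iio L) := by
    refine h1.mono' (kW_cont a ρ L).aestronglyMeasurable (Eventually.of_forall fun s => ?_)
    rw [Real.norm_of_nonneg (kW_pos _ _ _ _).le]
    simpa using kW_le_U hρ s
  have h2' : IntegrableOn (kW a ρ L) (Ici L) := by
    refine h2.mono' (kW_cont a ρ L).aestronglyMeasurable (Eventually.of_forall fun s => ?_)
    rw [Real.norm_of_nonneg (kW_pos _ _ _ _).le, ← Real.exp_add]
    refine (kW_le_E ha hρ s).trans (le_of_eq ?_)
    congr 1; ring
  have := h1'.union h2'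
  rwa [Iio_union_Ici, integrableOn_univ] at this

/-- rho times the integral of W is close to at most one. -/
theorem int_W_le {a : ℝ} (ha : 0 < a) (L : ℝ) :
    ∃ C, 0 < C ∧ ∀ ρ, 0 < ρ → ρ * ∫ s, kW a ρ L s ≤ 1 + ρ*C := by
  have h1 := int_left ha (show (0:ℝ) < 3/4 by norm_num) 0 L
  refine ⟨1 + ∫ s in Iio L, Real.exp (0*s) * Real.exp (-(3/4)*kU a s), ?_, ?_⟩
  · have : 0 ≤ ∫ s in Iio L, Real.exp (0*s) * Real.exp (-(3/4)*kU a s) :=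
      integral_nonneg fun s => by positivity
    linarith
  intro ρ hρ
  have hW := int_W (L := L) ha hρ
  rw [← integral_add_compl (measurableSet_Iio (a := L)) hW, mul_add]
  have i1 : ∫ s in Iio L, kW a ρ L s ≤ ∫ s in Iio L, Real.exp (0*s) * Real.exp (-(3/4)*kU a s) := by
    refine setIntegral_mono_on hW.integrableOn h1 measurableSet_Iio fun s _ => ?_
    simpa using kW_le_U hρ s
  have i2 : ∫ s in (Iio L)ᶜ, kW a ρ L s ≤ ρ⁻¹ := by
    rw [compl_Iio, integral_Ici_eq_integral_Ioi]
    have h2 : IntegrableOn (fun s => Real.exp (ρ*L) * Real.exp ((-ρ)*s)) (Ioi L) :=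
      ((integrableOn_exp_mul_Ioi (neg_lt_zero.2 hρ) L)).const_mul _
    calc _ ≤ ∫ s in Ioi L, Real.exp (ρ*L) * Real.exp ((-ρ)*s) := by
          refine setIntegral_mono_on hW.integrableOn h2 measurableSet_Ioi fun s _ => ?_
          rw [← Real.exp_add]
          refine (kW_le_E ha hρ s).trans (le_of_eq ?_)
          congr 1; ring
      _ = ρ⁻¹ := by
          rw [integral_const_mul, integral_exp_mul_Ioi (neg_lt_zero.2 hρ)]
          rw [neg_div_neg_eq, mul_div_assoc', ← Real.exp_add]
          simp
  have e : ρ * ρ⁻¹ = 1 := mul_inv_cancel₀ hρ.ne'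
  nlinarith

theorem Ker.le_of_lt {a K0 δ : ℝ} {κ : ℝ → ℝ} (hk : Ker a K0 δ κ) {t : ℝ} (ht : t < Real.log 2) :
    κ t ≤ 1 + 2*K0 := by
  have h := (abs_le.1 (hk.near t ht)).2
  have h3 : Real.exp (δ*t) ≤ 2 := by
    rw [← Real.exp_log (show (0:ℝ) < 2 by norm_num)]
    apply Real.exp_le_exp.2
    have := Real.log_pos (show (1:ℝ) < 2 by norm_num)
    rcases le_total t 0 with h0 | h0
    · have := hk.hδ; nlinarith
    · have := hk.hδ1; nlinarith
  nlinarith [hk.hK0]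

theorem Ker.le {a K0 δ : ℝ} {κ : ℝ → ℝ} (hk : Ker a K0 δ κ) (t : ℝ) :
    κ t ≤ (1 + 2*K0) * (1 + Real.exp ((1+a)*t)) := by
  have hl := Real.log_pos (show (1:ℝ) < 2 by norm_num)
  have := hk.hK0
  have he := Real.exp_pos ((1+a)*t)
  rcases le_total t 0 with h | h
  · have := hk.le_of_lt (t := t) (by linarith)
    nlinarith
  · rw [hk.sym t]
    have := hk.le_of_lt (t := -t) (by linarith)
    nlinarith

noncomputable def kk (a : ℝ) (κ : ℝ → ℝ) (p : ℝ × ℝ) : ℝ := Real.exp (-a*p.1) * κ (p.1 - p.2)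

noncomputable def bil (a : ℝ) (κ : ℝ → ℝ) (A : Set (ℝ × ℝ)) (f g : ℝ → ℝ) : ℝ :=
  ∫ p in A, kk a κ p * f p.1 * g p.2

def AF (s : ℝ) : Set (ℝ × ℝ) := {p | p.1 < s ∧ Real.exp s < Real.exp p.1 + Real.exp p.2}
def AP (s : ℝ) : Set (ℝ × ℝ) := {p | p.1 < s ∧ Real.exp p.1 + Real.exp p.2 ≤ Real.exp s}
def AT (s : ℝ) : Set (ℝ × ℝ) := {p | p.1 < s}

theorem AF_meas (s : ℝ) : MeasurableSet (AF s) := by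
  have h1 : MeasurableSet {p : ℝ × ℝ | p.1 < s} := measurableSet_lt (by fun_prop) (by fun_prop)
  have h2 : MeasurableSet {p : ℝ × ℝ | Real.exp s < Real.exp p.1 + Real.exp p.2} :=
    measurableSet_lt (by fun_prop) (by fun_prop)
  exact h1.inter h2
theorem AP_meas (s : ℝ) : MeasurableSet (AP s) := by
  have h1 : MeasurableSet {p : ℝ × ℝ | p.1 < s} := measurableSet_lt (by fun_prop) (by fun_prop)
  have h2 : MeasurableSet {p : ℝ × ℝ | Real.exp p.1 + Real.exp p.2 ≤ Real.exp s} :=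
    measurableSet_le (by fun_prop) (by fun_prop)
  exact h1.inter h2
theorem AT_meas (s : ℝ) : MeasurableSet (AT s) := measurableSet_lt (by fun_prop) (by fun_prop)
theorem AF_sub (s : ℝ) : AF s ⊆ AT s := fun _ h => h.1
theorem AP_sub (s : ℝ) : AP s ⊆ AT s := fun _ h => h.1
theorem AT_eq (s : ℝ) : AT s = Iio s ×ˢ univ := by ext p; simp [AT]

theorem set_iter {B : Set (ℝ × ℝ)} (hB : MeasurableSet B) {φ : ℝ × ℝ → ℝ} (h : IntegrableOn φ B) :
    ∫ p in B, φ p = ∫ y, ∫ z in {z | (y, z) ∈ B}, φ (y, z) := by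
  rw [← integral_indicator hB, Measure.volume_eq_prod, integral_prod]
  · congr 1; ext y
    rw [← integral_indicator]
    · rfl
    · exact measurable_prodMk_left hB
  · rw [← Measure.volume_eq_prod]; exact h.integrable_indicator hB

section
variable {a K0 δ : ℝ} {κ : ℝ → ℝ}

theorem Ker.kk_nn (hk : Ker a K0 δ κ) (p : ℝ × ℝ) : 0 ≤ kk a κ p :=
  mul_nonneg (Real.exp_pos _).le (hk.nn _)

theorem Ker.kk_cont (hk : Ker a K0 δ κ) : Continuous (kk a κ) := by
  have := hk.cont
  unfold kk; fun_prop

theorem Ker.kk_le (hk : Ker a K0 δ κ) (p : ℝ × ℝ) :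
    kk a κ p ≤ (1+2*K0) * (Real.exp (-a*p.1) + Real.exp p.1 * Real.exp (-(1+a)*p.2)) := by
  unfold kk
  calc _ ≤ Real.exp (-a*p.1) * ((1 + 2*K0) * (1 + Real.exp ((1+a)*(p.1-p.2)))) := by
        gcongr; exact hk.le _
    _ = _ := by
        have : Real.exp (-a*p.1) * Real.exp ((1+a)*(p.1-p.2)) = Real.exp p.1 * Real.exp (-(1+a)*p.2) := by
          rw [← Real.exp_add, ← Real.exp_add]; congr 1; ring
        linear_combination (1+2*K0) * this

theorem Ker.gen_int (hk : Ker a K0 δ κ) {φ ψ : ℝ → ℝ} {S T : Set ℝ}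
    (mφ : Measurable φ) (mψ : Measurable ψ)
    (h1 : IntegrableOn (fun y => Real.exp (-a*y) * φ y) S)
    (h2 : IntegrableOn (fun y => Real.exp (1*y) * φ y) S)
    (h3 : IntegrableOn ψ T)
    (h4 : IntegrableOn (fun z => Real.exp (-(1+a)*z) * ψ z) T) :
    IntegrableOn (fun p : ℝ × ℝ => kk a κ p * φ p.1 * ψ p.2) (S ×ˢ T) := by
  have j1 := (h1.mul_prod h3).norm
  have j2 := (h2.mul_prod h4).norm
  rw [Measure.prod_restrict, ← Measure.volume_eq_prod] at j1 j2
  have j := (j1.add j2).const_mul (1+2*K0)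
  refine Integrable.mono' j ?_ (Eventually.of_forall fun p => ?_)
  · have := hk.kk_cont.measurable
    exact (by fun_prop : Measurable _).aestronglyMeasurable
  · have h := hk.kk_le p
    have h0 := hk.kk_nn p
    simp only [Pi.add_apply, norm_mul, Real.norm_eq_abs, Real.abs_exp, one_mul]
    rw [abs_of_nonneg h0]
    calc _ ≤ ((1+2*K0) * (Real.exp (-a*p.1) + Real.exp p.1 * Real.exp (-(1+a)*p.2))) * |φ p.1| * |ψ p.2| := by
          gcongr
      _ = _ := by ring

theorem Cls.nn {ρ L c : ℝ} {f : ℝ → ℝ} (h : Cls a ρ L c f) : 0 ≤ c := by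
  have := (abs_nonneg _).trans (h.2 0)
  exact nonneg_of_mul_nonneg_left this (kW_pos _ _ _ _)

theorem Cls.le_U {ρ L c : ℝ} {f : ℝ → ℝ} (h : Cls a ρ L c f) (hρ : 0 < ρ) (s : ℝ) :
    |f s| ≤ c * Real.exp (-(3/4)*kU a s) :=
  (h.2 s).trans (mul_le_mul_of_nonneg_left (kW_le_U hρ s) h.nn)

theorem Cls.le_E {ρ L c : ℝ} {f : ℝ → ℝ} (h : Cls a ρ L c f) (ha : 0 < a) (hρ : 0 < ρ) (s : ℝ) :
    |f s| ≤ c * Real.exp (-ρ*(s-L)) :=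
  (h.2 s).trans (mul_le_mul_of_nonneg_left (kW_le_E ha hρ s) h.nn)

theorem Cls.int {ρ L c : ℝ} {f : ℝ → ℝ} (h : Cls a ρ L c f) (ha : 0 < a) (hρ : 0 < ρ) :
    Integrable f :=
  ((int_W (L := L) ha hρ).const_mul c).mono' h.1.aestronglyMeasurable (Eventually.of_forall h.2)

theorem Cls.int_left {ρ L c : ℝ} {f : ℝ → ℝ} (h : Cls a ρ L c f) (ha : 0 < a) (hρ : 0 < ρ) (p S : ℝ) :
    IntegrableOn (fun y => Real.exp (p*y) * f y) (Iio S) := by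
  have := h.1
  refine ((_root_.int_left ha (show (0:ℝ) < 3/4 by norm_num) p S).const_mul c).mono'
    (by fun_prop : Measurable _).aestronglyMeasurable (Eventually.of_forall fun s => ?_)
  rw [norm_mul, Real.norm_eq_abs, Real.abs_exp, Real.norm_eq_abs]
  have := h.le_U hρ s
  have := Real.exp_pos (p*s)
  nlinarith

theorem Cls.int_full {ρ L c : ℝ} {f : ℝ → ℝ} (h : Cls a ρ L c f) (ha : 0 < a) (hρ : 0 < ρ) {p : ℝ}
    (hp : p < 0) :
    Integrable (fun y => Real.exp (p*y) * f y) := by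
  have := h.1
  refine ((_root_.int_full ha (show (0:ℝ) < 3/4 by norm_num) hp).const_mul c).mono'
    (by fun_prop : Measurable _).aestronglyMeasurable (Eventually.of_forall fun s => ?_)
  rw [norm_mul, Real.norm_eq_abs, Real.abs_exp, Real.norm_eq_abs]
  have := h.le_U hρ s
  have := Real.exp_pos (p*s)
  nlinarith

variable {ρ L cf cg : ℝ} {f g : ℝ → ℝ}

theorem Ker.bil_int (hk : Ker a K0 δ κ) (hρ : 0 < ρ) (hf : Cls a ρ L cf f) (hg : Cls a ρ L cg g) (s : ℝ) :
    IntegrableOn (fun p : ℝ × ℝ => kk a κ p * f p.1 * g p.2) (AT s) := by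
  have ha := hk.ha
  rw [AT_eq]
  refine hk.gen_int hf.1 hg.1 (hf.int_left ha hρ _ _) (hf.int_left ha hρ _ _)
    (hg.int ha hρ).integrableOn (hg.int_full ha hρ (by linarith)).integrableOn

theorem Cls.sub {c1 c2 : ℝ} (hf : Cls a ρ L c1 f) (hg : Cls a ρ L c2 g) :
    Cls a ρ L (c1+c2) (fun s => f s - g s) := by
  refine ⟨hf.1.sub hg.1, fun s => ?_⟩
  have := hf.2 s
  have := hg.2 s
  have := abs_sub (f s) (g s)
  linarith

theorem bil_sub_left (hk : Ker a K0 δ κ) (hρ : 0 < ρ) {c1 c2 : ℝ} {f1 f2 : ℝ → ℝ} (h1 : Cls a ρ L c1 f1)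
    (h2 : Cls a ρ L c2 f2) (hg : Cls a ρ L cg g) {s : ℝ} {A : Set (ℝ × ℝ)} (hA : A ⊆ AT s) :
    bil a κ A (fun s => f1 s - f2 s) g = bil a κ A f1 g - bil a κ A f2 g := by
  unfold bil
  rw [← integral_sub ((hk.bil_int hρ h1 hg s).mono_set hA) ((hk.bil_int hρ h2 hg s).mono_set hA)]
  congr 1; ext p; ring

theorem bil_sub_right (hk : Ker a K0 δ κ) (hρ : 0 < ρ) {c1 c2 : ℝ} {f1 f2 : ℝ → ℝ} (h1 : Cls a ρ L c1 f1)
    (h2 : Cls a ρ L c2 f2) (hg : Cls a ρ L cg g) {s : ℝ} {A : Set (ℝ × ℝ)} (hA : A ⊆ AT s) :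
    bil a κ A g (fun s => f1 s - f2 s) = bil a κ A g f1 - bil a κ A g f2 := by
  unfold bil
  rw [← integral_sub ((hk.bil_int hρ hg h1 s).mono_set hA) ((hk.bil_int hρ hg h2 s).mono_set hA)]
  congr 1; ext p; ring

theorem bil_total (hk : Ker a K0 δ κ) (hρ : 0 < ρ) (hf : Cls a ρ L cf f) (hg : Cls a ρ L cg g) (s : ℝ) :
    bil a κ (AT s) f g = bil a κ (AF s) f g + bil a κ (AP s) f g := by
  unfold bil
  rw [← setIntegral_union _ (AP_meas s) ((hk.bil_int hρ hf hg s).mono_set (AF_sub s))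
    ((hk.bil_int hρ hf hg s).mono_set (AP_sub s))]
  · congr 2; ext p; simp only [AT, AF, AP, mem_ofPred_eq, mem_union]
    constructor
    · intro h
      rcases lt_or_ge (Real.exp s) (Real.exp p.1 + Real.exp p.2) with h' | h'
      · exact Or.inl ⟨h, h'⟩
      · exact Or.inr ⟨h, h'⟩
    · rintro (h | h) <;> exact h.1
  · rw [Set.disjoint_left]
    intro p h1 h2
    exact absurd h1.2 (not_lt.2 h2.2)

/-- iterated form -/
theorem bil_total_iter (hk : Ker a K0 δ κ) (hρ : 0 < ρ) (hf : Cls a ρ L cf f) (hg : Cls a ρ L cg g) (s : ℝ) :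
    bil a κ (AT s) f g = ∫ y in Iio s, Real.exp (-a*y) * (∫ z, κ (y-z) * g z) * f y := by
  have h := hk.bil_int hρ hf hg s
  unfold bil
  rw [AT_eq, Measure.volume_eq_prod] at *
  rw [setIntegral_prod _ h]
  congr 1; ext y
  rw [setIntegral_univ, mul_assoc, mul_comm (∫ z, κ (y-z) * g z), ← mul_assoc, ← integral_const_mul]
  congr 1; ext z
  simp only [kk]; ring

theorem bil_F_iter (hk : Ker a K0 δ κ) (hρ : 0 < ρ) (hf : Cls a ρ L cf f) (hg : Cls a ρ L cg g) (s : ℝ) :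
    bil a κ (AF s) f g = ∫ y in Iio s, ∫ z in Ioi (s + Real.log (1 - Real.exp (y-s))),
      kk a κ (y, z) * f y * g z := by
  unfold bil
  rw [set_iter (AF_meas s) ((hk.bil_int hρ hf hg s).mono_set (AF_sub s)),
    ← integral_indicator measurableSet_Iio]
  congr 1; ext y
  by_cases hy : y < s
  · rw [indicator_of_mem (show y ∈ Iio s from hy)]
    congr 2
    ext z
    have := Real.exp_lt_exp.2 hy
    have h1 : 0 < 1 - Real.exp (y-s) := by
      rw [sub_pos, ← Real.exp_zero]; apply Real.exp_lt_exp.2; linarith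
    simp only [AF, mem_ofPred_eq, mem_Ioi, hy, true_and]
    rw [← Real.exp_lt_exp (x := s + _), Real.exp_add, Real.exp_log h1, mul_sub, ← Real.exp_add]
    simp only [mul_one, add_sub_cancel]
    constructor <;> intro h <;> linarith
  · rw [indicator_of_notMem (show y ∉ Iio s from hy)]
    have : {z | (y, z) ∈ AF s} = ∅ := by
      ext z; simp [AF, hy]
    rw [this]; simp

end

section
variable {a K0 δ : ℝ} {κ : ℝ → ℝ} {ρ L cf cg : ℝ} {f g : ℝ → ℝ}

theorem ae_ne_fst (s : ℝ) : ∀ᵐ p : ℝ × ℝ, p.1 ≠ s := by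
  have hm : MeasurableSet {p : ℝ × ℝ | ¬ p.1 ≠ s} := by
    have : MeasurableSet {p : ℝ × ℝ | p.1 = s} := measurableSet_eq_fun (by fun_prop) (by fun_prop)
    simpa using this
  rw [ae_iff, Measure.volume_eq_prod, Measure.measure_prod_null hm]
  have h : ∀ᵐ y : ℝ, y ≠ s := by simp [ae_iff]
  filter_upwards [h] with y hy
  have : Prod.mk y ⁻¹' {p : ℝ × ℝ | ¬ p.1 ≠ s} = ∅ := by ext z; simp [hy]
  rw [this]; simp

theorem ae_ne_sum (s : ℝ) : ∀ᵐ p : ℝ × ℝ, Real.exp p.1 + Real.exp p.2 ≠ Real.exp s := by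
  have hm : MeasurableSet {p : ℝ × ℝ | ¬ Real.exp p.1 + Real.exp p.2 ≠ Real.exp s} := by
    have : MeasurableSet {p : ℝ × ℝ | Real.exp p.1 + Real.exp p.2 = Real.exp s} :=
      measurableSet_eq_fun (by fun_prop) (by fun_prop)
    simpa using this
  rw [ae_iff, Measure.volume_eq_prod, Measure.measure_prod_null hm]
  refine Eventually.of_forall fun y => ?_
  apply Set.Subsingleton.measure_zero
  intro z hz w hw
  simp only [mem_preimage, mem_ofPred_eq, ne_eq, not_not] at hz hw
  apply Real.exp_injective
  linarith

theorem bil_cont (hk : Ker a K0 δ κ) (hρ : 0 < ρ) (hf : Cls a ρ L cf f) (hg : Cls a ρ L cg g)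
    {A : ℝ → Set (ℝ × ℝ)} (hm : ∀ s, MeasurableSet (A s)) (hs : ∀ s, A s ⊆ AT s)
    (hA : ∀ s0, ∀ᵐ p : ℝ × ℝ, ∀ᶠ s in nhds s0, (p ∈ A s ↔ p ∈ A s0)) :
    Continuous (fun s => bil a κ (A s) f g) := by
  rw [continuous_iff_continuousAt]
  intro s0
  have h := hk.bil_int hρ hf hg (s0+1)
  have e : (fun s => bil a κ (A s) f g) =ᶠ[nhds s0] fun s => ∫ p in AT (s0+1),
      (A s).indicator (fun p : ℝ × ℝ => kk a κ p * f p.1 * g p.2) p := by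
    filter_upwards [Iio_mem_nhds (show s0 < s0+1 by linarith)] with s hs'
    unfold bil
    rw [setIntegral_indicator (hm s)]
    congr 2
    rw [inter_eq_right.2]
    intro p hp
    have h1 : p.1 < s := hs s hp
    have h2 : s < s0 + 1 := hs'
    exact h1.trans h2
  refine ContinuousAt.congr ?_ e.symm
  have hkm := hk.kk_cont.measurable
  have hf1 := hf.1
  have hg1 := hg.1
  have hφ : Measurable (fun p : ℝ × ℝ => kk a κ p * f p.1 * g p.2) := by fun_prop
  refine tendsto_integral_filter_of_dominated_convergence
    (fun p => ‖kk a κ p * f p.1 * g p.2‖) ?_ ?_ h.norm ?_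
  · exact Eventually.of_forall fun s => (hφ.indicator (hm s)).aestronglyMeasurable
  · exact Eventually.of_forall fun s => Eventually.of_forall fun p => norm_indicator_le_norm_self _ _
  · refine ae_restrict_of_ae ?_
    filter_upwards [hA s0] with p hp
    refine tendsto_const_nhds.congr' ?_
    filter_upwards [hp] with s hs'
    by_cases h0 : p ∈ A s0
    · rw [indicator_of_mem h0, indicator_of_mem (hs'.2 h0)]
    · rw [indicator_of_notMem h0, indicator_of_notMem (fun h => h0 (hs'.1 h))]

theorem ev_lt (x s0 : ℝ) (h : x ≠ s0) : ∀ᶠ s in nhds s0, (x < s ↔ x < s0) := by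
  rcases lt_or_gt_of_ne h with h | h
  · filter_upwards [Ioi_mem_nhds h] with s hs
    exact ⟨fun _ => h, fun _ => hs⟩
  · filter_upwards [Iio_mem_nhds h] with s hs
    exact ⟨fun h' => absurd (h'.trans hs) (lt_irrefl _), fun h' => absurd (h'.trans h) (lt_irrefl _)⟩

theorem bilT_cont (hk : Ker a K0 δ κ) (hρ : 0 < ρ) (hf : Cls a ρ L cf f) (hg : Cls a ρ L cg g) :
    Continuous (fun s => bil a κ (AT s) f g) := by
  refine bil_cont hk hρ hf hg AT_meas (fun s => Subset.rfl) fun s0 => ?_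
  filter_upwards [ae_ne_fst s0] with p hp
  exact ev_lt _ _ hp

theorem bilF_cont (hk : Ker a K0 δ κ) (hρ : 0 < ρ) (hf : Cls a ρ L cf f) (hg : Cls a ρ L cg g) :
    Continuous (fun s => bil a κ (AF s) f g) := by
  refine bil_cont hk hρ hf hg AF_meas AF_sub fun s0 => ?_
  filter_upwards [ae_ne_fst s0, ae_ne_sum s0] with p hp hp2
  have h2 := ev_lt _ _ hp2
  have h3 := (Real.continuous_exp.tendsto s0).eventually h2
  filter_upwards [ev_lt _ _ hp, (Real.continuous_exp.tendsto s0).eventually (ev_lt _ _ hp2),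
    (Real.continuous_exp.tendsto s0).eventually ((tendsto_id.eventually_ne hp2.symm))] with s h1 h2 h3
  simp only [AF, mem_ofPred_eq, h1]
  have h3' : s ≠ s0 ∨ s = s0 := (em _).symm
  refine and_congr_right fun _ => ?_
  have h4 : Real.exp s ≠ Real.exp p.1 + Real.exp p.2 := h3
  constructor
  · intro h
    by_contra hc
    exact absurd (h2.2 (lt_of_le_of_ne (not_lt.1 hc) hp2)) (not_lt.2 h.le)
  · intro h
    by_contra hc
    exact absurd (h2.1 (lt_of_le_of_ne (not_lt.1 hc) (Ne.symm h4))) (not_lt.2 h.le)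

theorem bilP_cont (hk : Ker a K0 δ κ) (hρ : 0 < ρ) (hf : Cls a ρ L cf f) (hg : Cls a ρ L cg g) :
    Continuous (fun s => bil a κ (AP s) f g) := by
  have : (fun s => bil a κ (AP s) f g) = fun s => bil a κ (AT s) f g - bil a κ (AF s) f g := by
    ext s; rw [bil_total hk hρ hf hg]; ring
  rw [this]
  exact (bilT_cont hk hρ hf hg).sub (bilF_cont hk hρ hf hg)

end

noncomputable def Qf (κ : ℝ → ℝ) (ρ : ℝ) (g : ℝ → ℝ) (y : ℝ) : ℝ := ρ * ∫ z, κ (y-z) * g z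

noncomputable def rL (a : ℝ) (κ : ℝ → ℝ) (ρ L : ℝ) (f g : ℝ → ℝ) (y : ℝ) : ℝ :=
  if y < L then Real.exp (kU a y - a*y) * ((Qf κ ρ g y - ρ * ∫ z, g z) * f y - ρ * bil a κ (AP y) f g)
  else 0

noncomputable def NL (a : ℝ) (κ : ℝ → ℝ) (ρ L : ℝ) (f g : ℝ → ℝ) (s : ℝ) : ℝ :=
  -(ρ * bil a κ (AP s) f g) - Real.exp (-kU a s) * ∫ y in s..L, rL a κ ρ L f g y

section
variable {a K0 δ : ℝ} {κ : ℝ → ℝ} {ρ L cf cg : ℝ} {f g : ℝ → ℝ}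

theorem kU_deriv {a : ℝ} (ha : 0 < a) (s : ℝ) : HasDerivAt (kU a) (-Real.exp (-a*s)) s := by
  have h : HasDerivAt (fun s : ℝ => -a*s) (-a) s := by
    simpa using (hasDerivAt_id s).const_mul (-a)
  have := h.exp.div_const a
  unfold kU
  have e : -Real.exp (-a*s) = Real.exp (-a*s) * -a / a := by
    rw [mul_neg, neg_div, mul_div_assoc, div_self ha.ne', mul_one]
  rw [e]
  exact this

theorem Qint (hk : Ker a K0 δ κ) (hρ : 0 < ρ) (hg : Cls a ρ L cg g) (y : ℝ) :
    Integrable (fun z => κ (y-z) * g z) := by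
  have ha := hk.ha
  have h1 := (hg.int ha hρ).norm
  have h2 := ((hg.int_full ha hρ (show -(1+a) < 0 by linarith)).norm.const_mul (Real.exp ((1+a)*y)))
  have hm := hg.1
  have hκ := hk.cont.measurable
  refine ((h1.add h2).const_mul (1+2*K0)).mono' (by fun_prop : Measurable _).aestronglyMeasurable
    (Eventually.of_forall fun z => ?_)
  simp only [Pi.add_apply, norm_mul, Real.norm_eq_abs, Real.abs_exp]
  rw [abs_of_nonneg (hk.nn _)]
  have := hk.le (y-z)
  calc _ ≤ ((1 + 2*K0) * (1 + Real.exp ((1+a)*(y-z)))) * |g z| := by gcongr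
    _ = _ := by
      rw [show (1+a)*(y-z) = (1+a)*y + -(1+a)*z by ring, Real.exp_add]; ring

theorem Q_bound (hk : Ker a K0 δ κ) (L : ℝ) : ∃ C, 0 < C ∧ ∀ ρ, 0 < ρ → ∀ (c : ℝ) (g : ℝ → ℝ),
    Cls a ρ L c g → ∀ y ≤ L, |Qf κ ρ g y - ρ * ∫ z, g z| ≤ ρ * C * c := by
  have ha := hk.ha
  have hδ := hk.hδ
  have hK := hk.hK0
  have hB := int_full ha (show (0:ℝ) < 3/4 by norm_num) (show -(1+a) < 0 by linarith)
  set J := ∫ z, Real.exp (-(1+a)*z) * Real.exp (-(3/4)*kU a z) with hJ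
  have hJ0 : 0 ≤ J := integral_nonneg fun z => by positivity
  refine ⟨K0/δ + 4*(1+K0)*Real.exp ((1+a)*L) * J, by positivity, ?_⟩
  intro ρ hρ c g hg y hy
  have hc := hg.nn
  have e : Qf κ ρ g y - ρ * ∫ z, g z = ρ * ∫ z, (κ (y-z) - 1) * g z := by
    unfold Qf
    rw [← mul_sub, ← integral_sub (Qint hk hρ hg y) (hg.int ha hρ)]
    congr 2; ext z; ring
  rw [e, abs_mul, abs_of_pos hρ, mul_assoc]
  refine mul_le_mul_of_nonneg_left ?_ hρ.le
  have i1 : Integrable ((Ici y).indicator fun z => Real.exp (δ*y) * Real.exp (-δ*z)) :=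
    by
    have : IntegrableOn (fun z => Real.exp (δ*y) * Real.exp (-δ*z)) (Ici y) :=
      ((integrableOn_Ici_iff_integrableOn_Ioi).2
        (integrableOn_exp_mul_Ioi (neg_lt_zero.2 hδ) y)).const_mul _
    exact this.integrable_indicator measurableSet_Ici
  have i2 : ∫ z, (Ici y).indicator (fun z => Real.exp (δ*y) * Real.exp (-δ*z)) z = 1/δ := by
    rw [integral_indicator measurableSet_Ici, integral_Ici_eq_integral_Ioi, integral_const_mul,
      integral_exp_mul_Ioi (neg_lt_zero.2 hδ), neg_div_neg_eq, mul_div_assoc', ← Real.exp_add]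
    simp
  have key : ∀ z, ‖(κ (y-z) - 1) * g z‖ ≤ c * (K0 * (Ici y).indicator (fun z => Real.exp (δ*y) * Real.exp (-δ*z)) z
      + 4*(1+K0)*Real.exp ((1+a)*L) * (Real.exp (-(1+a)*z) * Real.exp (-(3/4)*kU a z))) := by
    intro z
    rw [norm_mul, Real.norm_eq_abs, Real.norm_eq_abs]
    rcases le_or_gt y z with h | h
    · rw [indicator_of_mem (show z ∈ Ici y from h)]
      have h1 := hk.near (y-z) (by have := Real.log_pos (show (1:ℝ) < 2 by norm_num); linarith)
      have h2 : |g z| ≤ c := by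
        refine (hg.2 z).trans ?_
        have := kW_le_one (L := L) ha hρ z
        nlinarith
      have h3 : Real.exp (δ*y) * Real.exp (-δ*z) = Real.exp (δ*(y-z)) := by
        rw [← Real.exp_add]; congr 1; ring
      rw [h3]
      calc _ ≤ (K0 * Real.exp (δ*(y-z))) * c := by gcongr
        _ ≤ _ := by
          have : 0 ≤ c * (4*(1+K0)*Real.exp ((1+a)*L) * (Real.exp (-(1+a)*z) * Real.exp (-(3/4)*kU a z))) := by
            positivity
          linarith
    · rw [indicator_of_notMem (show z ∉ Ici y from not_le.2 h)]
      have h1 : |κ (y-z) - 1| ≤ 4*(1+K0) * Real.exp ((1+a)*(L-z)) := by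
        have n0 := hk.nn (y-z)
        have n1 := hk.le (y-z)
        have n2 : 1 ≤ Real.exp ((1+a)*(y-z)) := by
          apply Real.one_le_exp; apply mul_nonneg <;> linarith
        have n3 : Real.exp ((1+a)*(y-z)) ≤ Real.exp ((1+a)*(L-z)) := by
          apply Real.exp_le_exp.2; apply mul_le_mul_of_nonneg_left <;> linarith
        rw [abs_le]; constructor <;> nlinarith
      have h2 := hg.le_U hρ z
      have h3 : Real.exp ((1+a)*(L-z)) = Real.exp ((1+a)*L) * Real.exp (-(1+a)*z) := by
        rw [← Real.exp_add]; congr 1; ring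
      calc _ ≤ (4*(1+K0) * Real.exp ((1+a)*(L-z))) * (c * Real.exp (-(3/4)*kU a z)) := by gcongr
        _ = _ := by rw [h3]; ring
  refine (norm_integral_le_of_norm_le (((i1.const_mul K0).add (hB.const_mul _)).const_mul c)
    (Eventually.of_forall key)).trans (le_of_eq ?_)
  simp only [Pi.add_apply]
  rw [integral_const_mul, integral_add (i1.const_mul K0) (hB.const_mul _), integral_const_mul,
    integral_const_mul, i2]
  ring

theorem P_bound (hk : Ker a K0 δ κ) (L : ℝ) : ∃ C, 0 < C ∧ ∀ ρ, 0 < ρ → ∀ (cf cg : ℝ) (f g : ℝ → ℝ),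
    Cls a ρ L cf f → Cls a ρ L cg g → ∀ s ≤ L,
    |bil a κ (AP s) f g| ≤ C * cf * cg * Real.exp (-(5/4)*kU a s) := by
  have ha := hk.ha
  have h8 : (0:ℝ) < 1/8 := by norm_num
  have hI := hk.gen_int (φ := fun y => Real.exp (-(1/8)*kU a y)) (ψ := fun y => Real.exp (-(1/8)*kU a y))
    (S := Iio L) (T := Iio L) (by have := (kU_cont a).measurable; fun_prop)
    (by have := (kU_cont a).measurable; fun_prop) (int_left ha h8 _ _) (int_left ha h8 _ _)
    (by simpa using int_left ha h8 0 L) (int_left ha h8 _ _)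
  set J := ∫ p in Iio L ×ˢ Iio L, kk a κ p * Real.exp (-(1/8)*kU a p.1) * Real.exp (-(1/8)*kU a p.2)
  have hpos : ∀ p : ℝ × ℝ, 0 ≤ kk a κ p * Real.exp (-(1/8)*kU a p.1) * Real.exp (-(1/8)*kU a p.2) :=
    fun p => by have := hk.kk_nn p; positivity
  have hJ0 : 0 ≤ J := integral_nonneg hpos
  refine ⟨J + 1, by linarith, ?_⟩
  intro ρ hρ cf cg f g hf hg s hs
  have hcf := hf.nn
  have hcg := hg.nn
  have sub2 : ∀ p ∈ AP s, p.1 < s ∧ p.2 < s := fun p hp => ⟨hp.1, by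
    have := hp.2
    have := Real.exp_pos p.1
    apply Real.exp_lt_exp.1; linarith⟩
  have sub : AP s ⊆ Iio L ×ˢ Iio L := fun p hp =>
    ⟨(sub2 p hp).1.trans_le hs, (sub2 p hp).2.trans_le hs⟩
  unfold bil
  have hI2 := (hI.mono_set sub).const_mul (cf*cg*Real.exp (-(5/4)*kU a s))
  rw [← Real.norm_eq_abs]
  refine (norm_integral_le_of_norm_le hI2 ?_).trans ?_
  · refine (ae_restrict_iff' (AP_meas s)).2 (Eventually.of_forall fun p hp => ?_)
    obtain ⟨h1, h2⟩ := sub2 p hp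
    rw [norm_mul, norm_mul, Real.norm_eq_abs, Real.norm_eq_abs, Real.norm_eq_abs, abs_of_nonneg (hk.kk_nn p)]
    have u1 := kU_anti ha h1.le
    have u2 := kU_anti ha h2.le
    have n := hk.kk_nn p
    calc _ ≤ kk a κ p * (cf * Real.exp (-(3/4)*kU a p.1)) * (cg * Real.exp (-(3/4)*kU a p.2)) := by
          gcongr
          · exact hf.le_U hρ _
          · exact hg.le_U hρ _
      _ = cf*cg*kk a κ p * Real.exp (-(3/4)*kU a p.1 + -(3/4)*kU a p.2) := by rw [Real.exp_add]; ring
      _ ≤ cf*cg*kk a κ p * Real.exp (-(5/4)*kU a s + -(1/8)*kU a p.1 + -(1/8)*kU a p.2) := by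
          exact mul_le_mul_of_nonneg_left (Real.exp_le_exp.2 (by linarith)) (by positivity)
      _ = _ := by rw [Real.exp_add, Real.exp_add]; ring
  · rw [integral_const_mul]
    have : ∫ p in AP s, kk a κ p * Real.exp (-(1/8)*kU a p.1) * Real.exp (-(1/8)*kU a p.2) ≤ J :=
      setIntegral_mono_set hI (Eventually.of_forall hpos) (LE.le.eventuallyLE sub)
    calc _ ≤ (cf*cg*Real.exp (-(5/4)*kU a s)) * (J+1) := by gcongr; linarith
      _ = _ := by ring

theorem Q_meas (hk : Ker a K0 δ κ) (hg : Measurable g) : Measurable (Qf κ ρ g) := by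
  have hκ := hk.cont.measurable
  have : StronglyMeasurable (fun p : ℝ × ℝ => κ (p.1-p.2) * g p.2) :=
    (by fun_prop : Measurable _).stronglyMeasurable
  exact this.integral_prod_right'.measurable.const_mul ρ

theorem rL_meas (hk : Ker a K0 δ κ) (hρ : 0 < ρ) (hf : Cls a ρ L cf f) (hg : Cls a ρ L cg g) :
    Measurable (rL a κ ρ L f g) := by
  have h1 := Q_meas (ρ := ρ) hk hg.1
  have h2 := (bilP_cont hk hρ hf hg).measurable
  have h3 := (kU_cont a).measurable
  have h4 := hf.1
  unfold rL
  refine Measurable.ite measurableSet_Iio ?_ measurable_const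
  fun_prop

theorem rL_bound (hk : Ker a K0 δ κ) (L : ℝ) : ∃ C, 0 < C ∧ ∀ ρ, 0 < ρ → ∀ (cf cg : ℝ) (f g : ℝ → ℝ),
    Cls a ρ L cf f → Cls a ρ L cg g → ∀ y,
    |rL a κ ρ L f g y| ≤ ρ * C * cf * cg * (Real.exp ((1/4)*kU a y) * Real.exp (-a*y)) := by
  obtain ⟨C1, h1, H1⟩ := Q_bound hk L
  obtain ⟨C2, h2, H2⟩ := P_bound hk L
  refine ⟨C1 + C2, by linarith, ?_⟩
  intro ρ hρ cf cg f g hf hg y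
  have hcf := hf.nn
  have hcg := hg.nn
  unfold rL
  split_ifs with hy
  · rw [abs_mul, Real.abs_exp]
    have b1 := H1 ρ hρ cg g hg y hy.le
    have b2 := H2 ρ hρ cf cg f g hf hg y hy.le
    have b3 := hf.le_U hρ y
    have u0 := kU_pos hk.ha y
    have b4 : Real.exp (-(5/4)*kU a y) ≤ Real.exp (-(3/4)*kU a y) := by
      apply Real.exp_le_exp.2; linarith
    have b5 : |(Qf κ ρ g y - ρ * ∫ z, g z) * f y - ρ * bil a κ (AP y) f g| ≤
        ρ * (C1+C2) * cf * cg * Real.exp (-(3/4)*kU a y) := by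
      refine (abs_sub _ _).trans ?_
      rw [abs_mul, abs_mul, abs_of_pos hρ]
      calc _ ≤ (ρ * C1 * cg) * (cf * Real.exp (-(3/4)*kU a y)) +
            ρ * (C2 * cf * cg * Real.exp (-(3/4)*kU a y)) := by
            gcongr
            exact b2.trans (by gcongr)
        _ = _ := by ring
    calc _ ≤ Real.exp (kU a y - a*y) * (ρ * (C1+C2) * cf * cg * Real.exp (-(3/4)*kU a y)) := by gcongr
      _ = ρ * (C1+C2) * cf * cg * (Real.exp (kU a y - a*y) * Real.exp (-(3/4)*kU a y)) := by ring
      _ = _ := by rw [← Real.exp_add, ← Real.exp_add]; congr 2; ring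
  · simp only [abs_zero]; positivity

theorem rL_ii (hk : Ker a K0 δ κ) (hρ : 0 < ρ) (hf : Cls a ρ L cf f) (hg : Cls a ρ L cg g) (b c : ℝ) :
    IntervalIntegrable (rL a κ ρ L f g) volume b c := by
  obtain ⟨C, _, H⟩ := rL_bound hk L
  have h3 := kU_cont a
  refine IntervalIntegrable.mono_fun' (g := fun y => ρ * C * cf * cg * (Real.exp ((1/4)*kU a y) * Real.exp (-a*y)))
    ?_ (rL_meas hk hρ hf hg).aestronglyMeasurable (Eventually.of_forall fun y => H ρ hρ cf cg f g hf hg y)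
  exact (by fun_prop : Continuous _).intervalIntegrable _ _

theorem expU_int (ha : 0 < a) {c : ℝ} (hc : 0 < c) (s t : ℝ) :
    ∫ y in s..t, (Real.exp (c*kU a y) * Real.exp (-a*y)) =
      (Real.exp (c*kU a s) - Real.exp (c*kU a t))/c := by
  have hd : ∀ y, HasDerivAt (fun y => -(Real.exp (c*kU a y))/c) (Real.exp (c*kU a y) * Real.exp (-a*y)) y := by
    intro y
    have := (((kU_deriv ha y).const_mul c).exp.neg).div_const c
    have e : Real.exp (c*kU a y) * Real.exp (-a*y) =
        -(Real.exp (c*kU a y) * (c * -Real.exp (-a*y))) / c := by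
      rw [eq_div_iff hc.ne']; ring
    rw [e]
    exact this
  rw [intervalIntegral.integral_eq_sub_of_hasDerivAt (fun y _ => hd y)]
  · ring
  · have h3 := kU_cont a
    exact (by fun_prop : Continuous _).intervalIntegrable _ _

theorem NL_bound (hk : Ker a K0 δ κ) (L : ℝ) : ∃ C, 0 < C ∧ ∀ ρ, 0 < ρ → ∀ (cf cg : ℝ) (f g : ℝ → ℝ),
    Cls a ρ L cf f → Cls a ρ L cg g → ∀ s < L,
    |NL a κ ρ L f g s| ≤ ρ * C * cf * cg * Real.exp (-(3/4)*kU a s) := by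
  obtain ⟨C1, h1, H1⟩ := rL_bound hk L
  obtain ⟨C2, h2, H2⟩ := P_bound hk L
  refine ⟨4*C1 + C2, by linarith, ?_⟩
  intro ρ hρ cf cg f g hf hg s hs
  have hcf := hf.nn
  have hcg := hg.nn
  unfold NL
  have h3 := kU_cont a
  have u0 := kU_pos hk.ha s
  have b1 : |∫ y in s..L, rL a κ ρ L f g y| ≤ ρ * C1 * cf * cg * (4 * Real.exp ((1/4)*kU a s)) := by
    rw [← Real.norm_eq_abs]
    refine (intervalIntegral.norm_integral_le_of_norm_le hs.le
      (g := fun y => ρ * C1 * cf * cg * (Real.exp ((1/4)*kU a y) * Real.exp (-a*y)))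
      (Eventually.of_forall fun y _ => H1 ρ hρ cf cg f g hf hg y)
      ((by fun_prop : Continuous _).intervalIntegrable _ _)).trans ?_
    rw [intervalIntegral.integral_const_mul, expU_int hk.ha (by norm_num)]
    have := Real.exp_pos ((1/4)*kU a L)
    gcongr
    linarith
  have b2 := H2 ρ hρ cf cg f g hf hg s hs.le
  have b4 : Real.exp (-(5/4)*kU a s) ≤ Real.exp (-(3/4)*kU a s) := by
    apply Real.exp_le_exp.2; linarith
  refine (abs_sub _ _).trans ?_
  rw [abs_neg, abs_mul, abs_mul, Real.abs_exp, abs_of_pos hρ]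
  calc _ ≤ ρ * (C2 * cf * cg * Real.exp (-(3/4)*kU a s)) +
        Real.exp (-kU a s) * (ρ * C1 * cf * cg * (4 * Real.exp ((1/4)*kU a s))) := by
        gcongr
        exact b2.trans (by gcongr)
    _ = ρ * (C2 * cf * cg * Real.exp (-(3/4)*kU a s)) +
        ρ * C1 * cf * cg * 4 * (Real.exp (-kU a s) * Real.exp ((1/4)*kU a s)) := by ring
    _ = _ := by
      rw [← Real.exp_add, show -kU a s + (1/4)*kU a s = -(3/4)*kU a s by ring]; ring

end

noncomputable def EE (ρ L s : ℝ) : ℝ := Real.exp (ρ*(s-L))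

theorem EE_pos (ρ L s : ℝ) : 0 < EE ρ L s := Real.exp_pos _
theorem EE_cont (ρ L : ℝ) : Continuous (EE ρ L) := by unfold EE; fun_prop
theorem EE_mono {ρ L s t : ℝ} (hρ : 0 < ρ) (h : s ≤ t) : EE ρ L s ≤ EE ρ L t := by
  unfold EE; gcongr
theorem EE_shift {ρ L s t x : ℝ} (hρ : 0 < ρ) (hρ1 : ρ ≤ 1) (h : t ≤ s + x) (hx : 0 ≤ x) :
    EE ρ L t ≤ Real.exp x * EE ρ L s := by
  unfold EE
  rw [← Real.exp_add]
  apply Real.exp_le_exp.2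
  nlinarith
theorem EE_inv (ρ L s : ℝ) : Real.exp (-ρ*(s-L)) * EE ρ L s = 1 := by
  unfold EE
  rw [← Real.exp_add]
  simp
theorem kW_EE {a ρ L : ℝ} (ha : 0 < a) (hρ : 0 < ρ) (s : ℝ) : kW a ρ L s * EE ρ L s ≤ 1 := by
  rw [← EE_inv ρ L s]
  exact mul_le_mul_of_nonneg_right (kW_le_E ha hρ s) (EE_pos _ _ _).le

/-- mass of a set in the window -/
noncomputable def mE (ρ L S1 S2 : ℝ) (A : Set ℝ) : ℝ := ∫ s in A ∩ Ioc S1 S2, EE ρ L s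

section
variable {ρ L S1 S2 : ℝ}

theorem mE_nn (A : Set ℝ) : 0 ≤ mE ρ L S1 S2 A := integral_nonneg fun _ => (EE_pos _ _ _).le

theorem mE_le (hρ : 0 < ρ) {A : Set ℝ} {α β : ℝ} (hab : α ≤ β) (h : ∀ s ∈ A, s ∈ Ioc S1 S2 → α ≤ s ∧ s ≤ β) :
    mE ρ L S1 S2 A ≤ (β-α) * EE ρ L β := by
  have hs : A ∩ Ioc S1 S2 ⊆ Icc α β := fun s hs => h s hs.1 hs.2
  have hfin : volume (A ∩ Ioc S1 S2) < ⊤ :=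
    (measure_mono hs).trans_lt (by simp)
  have h1 := norm_setIntegral_le_of_norm_le_const (μ := volume) (f := EE ρ L) (C := EE ρ L β) hfin
    (fun s h => by
      rw [Real.norm_eq_abs, abs_of_pos (EE_pos _ _ _)]
      exact EE_mono hρ (hs h).2)
  have h2 : volume.real (A ∩ Ioc S1 S2) ≤ β - α := by
    have := measureReal_mono (μ := volume) hs (by simp)
    rwa [Real.volume_real_Icc_of_le hab] at this
  have h3 := EE_pos ρ L β
  have h4 := (le_abs_self _).trans h1
  unfold mE
  nlinarith

theorem mE_zero {A : Set ℝ} (h : ∀ s ∈ A, s ∉ Ioc S1 S2) : mE ρ L S1 S2 A = 0 := by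
  unfold mE
  have : A ∩ Ioc S1 S2 = ∅ := by
    ext s; simp only [mem_inter_iff, mem_empty_iff_false, iff_false, not_and]; exact h s
  rw [this]; simp

theorem mE_int (A : Set ℝ) : IntegrableOn (EE ρ L) (A ∩ Ioc S1 S2) :=
  ((EE_cont ρ L).integrableOn_Icc.mono_set (t := Icc S1 S2) (fun _ h => Ioc_subset_Icc_self h.2))

theorem mE_union {A B : Set ℝ} (hB : MeasurableSet B) (h : Disjoint A B) :
    mE ρ L S1 S2 (A ∪ B) = mE ρ L S1 S2 A + mE ρ L S1 S2 B := by
  unfold mE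
  rw [union_inter_distrib_right]
  exact setIntegral_union (h.mono inter_subset_left inter_subset_left) (hB.inter measurableSet_Ioc)
    (mE_int _) (mE_int _)

/-- lower bound -/
theorem mE_ge (hρ : 0 < ρ) {α β : ℝ} (hab : α ≤ β) (h1 : S1 ≤ α) (h2 : β ≤ S2) :
    (β-α) * EE ρ L α ≤ mE ρ L S1 S2 (Ioo α β) := by
  unfold mE
  have e : Ioo α β ∩ Ioc S1 S2 = Ioo α β := inter_eq_left.2 fun s hs =>
    ⟨h1.trans_lt hs.1, hs.2.le.trans h2⟩
  rw [e]
  have : ∫ s in Ioo α β, EE ρ L α = (β-α) * EE ρ L α := by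
    rw [setIntegral_const, Real.volume_real_Ioo_of_le hab, smul_eq_mul]
  rw [← this]
  refine setIntegral_mono_on (by simp) ?_ measurableSet_Ioo fun s hs => EE_mono hρ hs.1.le
  exact (EE_cont ρ L).integrableOn_Icc.mono_set Ioo_subset_Icc_self

end

noncomputable def lam (y z : ℝ) : ℝ := Real.log (Real.exp y + Real.exp z)

theorem lt_lam {s y z : ℝ} : s < lam y z ↔ Real.exp s < Real.exp y + Real.exp z := by
  unfold lam
  rw [Real.lt_log_iff_exp_lt (by positivity)]

theorem lam_comm (y z : ℝ) : lam y z = lam z y := by unfold lam; rw [add_comm]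

theorem lam_eq (y z : ℝ) : lam y z = y + Real.log (1 + Real.exp (z-y)) := by
  unfold lam
  rw [show Real.exp y + Real.exp z = Real.exp y * (1 + Real.exp (z-y)) by
    rw [mul_add, ← Real.exp_add]; simp, Real.log_mul (by positivity) (by positivity), Real.log_exp]

theorem lam_gt (y z : ℝ) : y < lam y z := by
  rw [lt_lam]; have := Real.exp_pos z; linarith
theorem lam_le (y z : ℝ) : lam y z ≤ y + Real.exp (z-y) := by
  rw [lam_eq]
  have := Real.log_le_sub_one_of_pos (show 0 < 1 + Real.exp (z-y) by positivity)
  linarith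
theorem lam_ge (y z : ℝ) : y + Real.exp (z-y) * (1 - Real.exp (z-y)) ≤ lam y z := by
  rw [lam_eq]
  have h := Real.one_sub_inv_le_log_of_pos (show 0 < 1 + Real.exp (z-y) by positivity)
  have h2 : 1 - (1 + Real.exp (z-y))⁻¹ ≥ Real.exp (z-y) * (1 - Real.exp (z-y)) := by
    set t := Real.exp (z-y)
    have ht : 0 < t := Real.exp_pos _
    have : 1 - (1+t)⁻¹ = t/(1+t) := by field_simp; ring
    rw [this, ge_iff_le, le_div_iff₀ (by positivity)]
    nlinarith [mul_pos ht ht, mul_pos (mul_pos ht ht) ht]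
  linarith
theorem lam_le_one {y z : ℝ} (h : z ≤ y) : lam y z ≤ y + 1 := by
  have := lam_le y z
  have : Real.exp (z-y) ≤ 1 := Real.exp_le_one_iff.2 (by linarith)
  linarith
theorem lam_le_log {y z : ℝ} (h : z ≤ y) : lam y z ≤ y + Real.log 2 := by
  rw [lam_eq]
  have : Real.exp (z-y) ≤ 1 := Real.exp_le_one_iff.2 (by linarith)
  have := Real.log_le_log (show 0 < 1 + Real.exp (z-y) by positivity) (show 1 + Real.exp (z-y) ≤ 2 by linarith)
  linarith

/-- boundary layer -/
def bd (S : ℝ) : Set (ℝ × ℝ) := {p | p.2 ≤ S ∧ S - 2*Real.exp (p.2-S) < p.1 ∧ p.1 ≤ S}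

theorem bd_meas (S : ℝ) : MeasurableSet (bd S) := by
  have h1 : MeasurableSet {p : ℝ × ℝ | p.2 ≤ S} := measurableSet_le (by fun_prop) (by fun_prop)
  have h2 : MeasurableSet {p : ℝ × ℝ | S - 2*Real.exp (p.2-S) < p.1} :=
    measurableSet_lt (by fun_prop) (by fun_prop)
  have h3 : MeasurableSet {p : ℝ × ℝ | p.1 ≤ S} := measurableSet_le (by fun_prop) (by fun_prop)
  exact h1.inter (h2.inter h3)

theorem mem_bd {S y z : ℝ} (hzy : z ≤ y) (hy : y ≤ S) (h : S < lam y z) : (y, z) ∈ bd S := by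
  refine ⟨hzy.trans hy, ?_, hy⟩
  have h1 := lam_le y z
  have h2 := lam_le_log hzy
  have h3 : Real.exp (z-y) ≤ 2 * Real.exp (z-S) := by
    rw [← Real.exp_log (show (0:ℝ) < 2 by norm_num), ← Real.exp_add]
    apply Real.exp_le_exp.2; linarith
  show S - 2*Real.exp (z-S) < y
  linarith

theorem lin_le_exp {σ x : ℝ} (hσ : 0 < σ) : x ≤ 1/σ * Real.exp (σ*x) := by
  have := Real.add_one_le_exp (σ*x)
  rw [one_div, ← div_eq_inv_mul, le_div_iff₀ hσ]
  nlinarith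

theorem exp_one_le : Real.exp 1 ≤ 3 := by have := Real.exp_one_lt_d9; linarith

noncomputable def iP (σ ρ L S y : ℝ) : ℝ := (Ioi S).indicator (fun y => Real.exp (-σ*y) * EE ρ L y) y
noncomputable def i1 (S z : ℝ) : ℝ := (Ioi S).indicator (fun _ => (1:ℝ)) z
noncomputable def iB (S : ℝ) (p : ℝ × ℝ) : ℝ := (bd S).indicator (fun _ => (1:ℝ)) p

theorem iP_nn (σ ρ L S y : ℝ) : 0 ≤ iP σ ρ L S y :=
  indicator_nonneg (fun y _ => by have := EE_pos ρ L y; positivity) _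
theorem i1_nn (S y : ℝ) : 0 ≤ i1 S y := indicator_nonneg (fun _ _ => zero_le_one) _
theorem iB_nn (S : ℝ) (p : ℝ × ℝ) : 0 ≤ iB S p := indicator_nonneg (fun _ _ => zero_le_one) _
theorem iP_eq {σ ρ L S y : ℝ} (h : S < y) : iP σ ρ L S y = Real.exp (-σ*y) * EE ρ L y :=
  indicator_of_mem (show y ∈ Ioi S from h) _
theorem i1_eq {S y : ℝ} (h : S < y) : i1 S y = 1 := indicator_of_mem (show y ∈ Ioi S from h) _
theorem iB_eq {S : ℝ} {p : ℝ × ℝ} (h : p ∈ bd S) : iB S p = 1 := indicator_of_mem h _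

noncomputable def Psi (a : ℝ) (κ : ℝ → ℝ) (ρ L S1 S2 y z : ℝ) : ℝ :=
  kk a κ (y,z) * mE ρ L S1 S2 (Ioo y (lam y z)) - Real.exp (-a*y) * mE ρ L S1 S2 (Iio z)
    - Real.exp (-a*z) * (Ioc S1 S2).indicator (EE ρ L) y

section
variable {a K0 δ : ℝ} {κ : ℝ → ℝ} {ρ L S1 S2 : ℝ}

theorem kk_near1 (hk : Ker a K0 δ κ) {y z : ℝ} (h : y ≤ z) :
    |kk a κ (y,z) - Real.exp (-a*y)| ≤ K0 * (Real.exp (-(a-δ)*y) * Real.exp (-δ*z)) := by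
  have h1 := hk.near (y-z) (by have := Real.log_pos (show (1:ℝ) < 2 by norm_num); linarith)
  unfold kk
  rw [show Real.exp (-a*y) * κ (y-z) - Real.exp (-a*y) = Real.exp (-a*y) * (κ (y-z) - 1) by ring,
    abs_mul, Real.abs_exp]
  calc _ ≤ Real.exp (-a*y) * (K0 * Real.exp (δ*(y-z))) := by gcongr
    _ = K0 * (Real.exp (-a*y) * Real.exp (δ*(y-z))) := by ring
    _ = _ := by rw [← Real.exp_add, ← Real.exp_add]; congr 2; ring

theorem kk_sym (hk : Ker a K0 δ κ) (y z : ℝ) : kk a κ (y,z) = Real.exp (y-z) * kk a κ (z,y) := by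
  unfold kk
  rw [hk.sym (y-z), neg_sub, ← mul_assoc, ← mul_assoc, ← Real.exp_add, ← Real.exp_add]
  congr 2; ring

set_option maxHeartbeats 1000000 in
theorem Psi1 (hk : Ker a K0 δ κ) (hρ : 0 < ρ) (hρ1 : ρ ≤ 1) (hS : 0 ≤ S1) {y z : ℝ} (h : y < z) :
    |Psi a κ ρ L S1 S2 y z| ≤ 10*(1+K0)*(1/(δ/2)) *
      (Real.exp (-(a-δ)*y) * iP (δ/2) ρ L (S1-1) z + Real.exp (-(a-δ)*z) * iP (δ/2) ρ L (S1-1) y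
        + iP (δ/2) ρ L S1 y * i1 S1 z) := by
  obtain ⟨ha, hK, hδ, hδ1, hδa, -⟩ := id hk
  set σ := δ/2 with hσ
  have hσ0 : 0 < σ := by linarith
  have e2 : δ = 2*σ := by linarith
  set σ' := 1/σ with hσ'
  have hs1 : 1 ≤ σ' := by rw [hσ', le_div_iff₀ hσ0]; linarith
  set A1 := Real.exp (-(a-δ)*y) * iP σ ρ L (S1-1) z with hA1
  set A2 := Real.exp (-(a-δ)*z) * iP σ ρ L (S1-1) y with hA2
  set A3 := iP σ ρ L S1 y * i1 S1 z with hA3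
  have nA1 : 0 ≤ A1 := mul_nonneg (Real.exp_pos _).le (iP_nn _ _ _ _ _)
  have nA2 : 0 ≤ A2 := mul_nonneg (Real.exp_pos _).le (iP_nn _ _ _ _ _)
  have nA3 : 0 ≤ A3 := mul_nonneg (iP_nn _ _ _ _ _) (i1_nn _ _)
  have l1 : lam y z ≤ z + 1 := by rw [lam_comm]; exact lam_le_one h.le
  have l2 : z < lam y z := by rw [lam_comm]; exact lam_gt z y
  have E3 := exp_one_le
  have Esh : ∀ t, t ≤ z + 1 → EE ρ L t ≤ 3 * EE ρ L z := fun t ht =>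
    (EE_shift hρ hρ1 ht zero_le_one).trans (mul_le_mul_of_nonneg_right E3 (EE_pos _ _ _).le)
  have Ez := EE_pos ρ L z
  have Ey := EE_pos ρ L y
  -- t1
  have t1 : |kk a κ (y,z) - Real.exp (-a*y)| * mE ρ L S1 S2 (Ioo y (lam y z)) ≤ 9*K0*σ'*A1 := by
    rcases le_or_gt (lam y z) S1 with hl | hl
    · rw [mE_zero]
      · rw [mul_zero]; positivity
      · intro s hs hs2
        exact absurd (hs.2.trans_le hl) (not_lt.2 hs2.1.le)
    · have hz : S1 - 1 < z := by linarith
      have hm : mE ρ L S1 S2 (Ioo y (lam y z)) ≤ (z+1-S1) * EE ρ L (z+1) :=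
        mE_le hρ (by linarith) fun s hs hs2 => ⟨hs2.1.le, (hs.2.le.trans l1)⟩
      have h1 := Esh (z+1) le_rfl
      have hx : (z+1-S1) * Real.exp (-δ*z) ≤ 3*σ' * Real.exp (-σ*z) := by
        have q1 : z+1-S1 ≤ σ' * Real.exp (σ*(z+1-S1)) := lin_le_exp hσ0
        have q2 : Real.exp (σ*(z+1-S1)) ≤ Real.exp (σ*z + 1) := by
          apply Real.exp_le_exp.2; nlinarith
        rw [Real.exp_add] at q2
        have q3 : Real.exp (σ*z) * Real.exp (-δ*z) = Real.exp (-σ*z) := by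
          rw [← Real.exp_add]; congr 1; rw [e2]; ring
        calc _ ≤ (σ' * (Real.exp (σ*z) * 3)) * Real.exp (-δ*z) := by
              gcongr
              exact q1.trans (by gcongr; exact q2.trans (by gcongr))
          _ = 3*σ' * (Real.exp (σ*z) * Real.exp (-δ*z)) := by ring
          _ = _ := by rw [q3]
      have q0 : 0 ≤ z+1-S1 := by linarith
      rw [hA1, iP_eq hz]
      calc _ ≤ (K0 * (Real.exp (-(a-δ)*y) * Real.exp (-δ*z))) * ((z+1-S1) * (3 * EE ρ L z)) :=
            mul_le_mul (kk_near1 hk h.le) (hm.trans (by gcongr)) (mE_nn _) (by positivity)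
        _ = 3*K0*Real.exp (-(a-δ)*y) * ((z+1-S1) * Real.exp (-δ*z)) * EE ρ L z := by ring
        _ ≤ 3*K0*Real.exp (-(a-δ)*y) * (3*σ' * Real.exp (-σ*z)) * EE ρ L z := by gcongr
        _ = _ := by ring
  have t2 : Real.exp (-a*y) * mE ρ L S1 S2 (Ico z (lam y z)) ≤ 9*σ'*A1 := by
    rcases le_or_gt (lam y z) S1 with hl | hl
    · rw [mE_zero]
      · rw [mul_zero]; positivity
      · intro s hs hs2
        exact absurd (hs.2.trans_le hl) (not_lt.2 hs2.1.le)
    · have hz : S1 - 1 < z := by linarith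
      have hm : mE ρ L S1 S2 (Ico z (lam y z)) ≤ (lam y z - z) * EE ρ L (lam y z) :=
        mE_le hρ l2.le fun s hs hs2 => ⟨hs.1, hs.2.le⟩
      have h1 := Esh _ l1
      have h2 := lam_le z y
      rw [lam_comm] at h2
      have h3 : Real.exp (-a*y) * Real.exp (y-z) ≤ Real.exp (-(a-δ)*y) * (3 * Real.exp (-σ*z)) := by
        have : Real.exp (-a*y) * Real.exp (y-z) ≤ Real.exp (-(a-δ)*y) * (Real.exp 1 * Real.exp (-σ*z)) := by
          rw [← Real.exp_add, ← Real.exp_add, ← Real.exp_add]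
          apply Real.exp_le_exp.2
          rw [e2]; rw [e2] at hδ1
          nlinarith
        exact this.trans (by gcongr)
      rw [hA1, iP_eq hz]
      have q0 : 0 ≤ lam y z - z := by linarith
      calc _ ≤ Real.exp (-a*y) * (Real.exp (y-z) * (3 * EE ρ L z)) := by
            refine mul_le_mul_of_nonneg_left (hm.trans ?_) (Real.exp_pos _).le
            have := EE_pos ρ L (lam y z)
            gcongr; linarith
        _ = (Real.exp (-a*y) * Real.exp (y-z)) * (3 * EE ρ L z) := by ring
        _ ≤ (Real.exp (-(a-δ)*y) * (3 * Real.exp (-σ*z))) * (3 * EE ρ L z) := by gcongr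
        _ = 9*1*(Real.exp (-(a-δ)*y) * (Real.exp (-σ*z) * EE ρ L z)) := by ring
        _ ≤ _ := by gcongr
  have t3 : Real.exp (-a*y) * mE ρ L S1 S2 (Iic y) ≤ σ'*A3 := by
    rcases le_or_gt y S1 with hl | hl
    · rw [mE_zero]
      · rw [mul_zero]; positivity
      · intro s hs hs2
        have : s ≤ y := hs
        have := hs2.1
        linarith
    · have hm : mE ρ L S1 S2 (Iic y) ≤ (y-S1) * EE ρ L y :=
        mE_le hρ hl.le fun s hs hs2 => ⟨hs2.1.le, hs⟩
      rw [hA3, iP_eq hl, i1_eq (hl.trans h)]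
      have q1 : y-S1 ≤ σ' * Real.exp (σ*(y-S1)) := lin_le_exp hσ0
      have q2 : Real.exp (-a*y) * Real.exp (σ*(y-S1)) ≤ Real.exp (-σ*y) := by
        rw [← Real.exp_add]; apply Real.exp_le_exp.2; nlinarith
      calc _ ≤ Real.exp (-a*y) * ((σ' * Real.exp (σ*(y-S1))) * EE ρ L y) := by
            refine mul_le_mul_of_nonneg_left (hm.trans ?_) (Real.exp_pos _).le
            gcongr
        _ = σ' * (Real.exp (-a*y) * Real.exp (σ*(y-S1))) * EE ρ L y := by ring
        _ ≤ σ' * Real.exp (-σ*y) * EE ρ L y := by gcongr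
        _ = _ := by ring
  have t4 : Real.exp (-a*z) * (Ioc S1 S2).indicator (EE ρ L) y ≤ σ'*A2 := by
    by_cases hy : y ∈ Ioc S1 S2
    · rw [indicator_of_mem hy, hA2, iP_eq (by linarith [hy.1])]
      have q2 : Real.exp (-a*z) ≤ Real.exp (-(a-δ)*z) * Real.exp (-σ*y) := by
        rw [← Real.exp_add]; apply Real.exp_le_exp.2; rw [e2]; nlinarith [hy.1]
      calc _ ≤ (Real.exp (-(a-δ)*z) * Real.exp (-σ*y)) * EE ρ L y := by gcongr
        _ = 1 * (Real.exp (-(a-δ)*z) * (Real.exp (-σ*y) * EE ρ L y)) := by ring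
        _ ≤ _ := by gcongr
    · rw [indicator_of_notMem hy, mul_zero]; positivity
  have t4' : 0 ≤ Real.exp (-a*z) * (Ioc S1 S2).indicator (EE ρ L) y :=
    mul_nonneg (Real.exp_pos _).le (indicator_nonneg (fun y _ => (EE_pos _ _ y).le) _)
  have d1 : mE ρ L S1 S2 (Ioo y (lam y z)) = mE ρ L S1 S2 (Ioo y z) + mE ρ L S1 S2 (Ico z (lam y z)) := by
    rw [← mE_union measurableSet_Ico, Ioo_union_Ico_eq_Ioo h l2.le]
    exact Set.disjoint_left.2 fun s h1 h2 => absurd h1.2 (not_lt.2 h2.1)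
  have d2 : mE ρ L S1 S2 (Iio z) = mE ρ L S1 S2 (Iic y) + mE ρ L S1 S2 (Ioo y z) := by
    rw [← mE_union measurableSet_Ioo, Iic_union_Ioo_eq_Iio h]
    exact Set.disjoint_left.2 fun s h1 h2 => absurd h2.1 (not_lt.2 h1)
  have dec : Psi a κ ρ L S1 S2 y z = (kk a κ (y,z) - Real.exp (-a*y)) * mE ρ L S1 S2 (Ioo y (lam y z))
      + Real.exp (-a*y) * mE ρ L S1 S2 (Ico z (lam y z)) - Real.exp (-a*y) * mE ρ L S1 S2 (Iic y)
      - Real.exp (-a*z) * (Ioc S1 S2).indicator (EE ρ L) y := by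
    unfold Psi
    linear_combination Real.exp (-a*y) * d1 - Real.exp (-a*y) * d2
  have n1 := mul_nonneg (Real.exp_pos (-a*y)).le (mE_nn (ρ := ρ) (L := L) (S1 := S1) (S2 := S2) (Ico z (lam y z)))
  have n2 := mul_nonneg (Real.exp_pos (-a*y)).le (mE_nn (ρ := ρ) (L := L) (S1 := S1) (S2 := S2) (Iic y))
  rw [← abs_of_nonneg (mE_nn (ρ := ρ) (L := L) (S1 := S1) (S2 := S2) (Ioo y (lam y z))), ← abs_mul] at t1
  have hσp : 0 < σ' := by linarith
  have m1 := mul_nonneg hσp.le nA1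
  have m2 := mul_nonneg hσp.le nA2
  have m3 := mul_nonneg hσp.le nA3
  have m4 := mul_nonneg hK.le m1
  have m5 := mul_nonneg hK.le m2
  have m6 := mul_nonneg hK.le m3
  have fin : 10*(1+K0)*σ'*(A1+A2+A3) = 10*(σ'*A1) + 10*(σ'*A2) + 10*(σ'*A3) + 10*(K0*(σ'*A1))
    + 10*(K0*(σ'*A2)) + 10*(K0*(σ'*A3)) := by ring
  rw [fin, dec]
  have t1' := abs_le.1 t1
  rw [abs_le]
  constructor <;> linarith [t1'.1, t1'.2]

set_option maxHeartbeats 1000000 in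
theorem Psi2 (hk : Ker a K0 δ κ) (hρ : 0 < ρ) (hρ1 : ρ ≤ 1) (hS : 0 ≤ S1) {y z : ℝ} (h : z ≤ y) :
    |Psi a κ ρ L S1 S2 y z| ≤ 10*(1+K0)*(1/(δ/2)) *
      (Real.exp (-(a-δ)*y) * iP (δ/2) ρ L (S1-1) z + Real.exp (-(a-δ)*z) * iP (δ/2) ρ L (S1-1) y
        + Real.exp (-a*z) * EE ρ L y * (iB S1 (y,z) + iB S2 (y,z))) := by
  obtain ⟨ha, hK, hδ, hδ1, hδa, -⟩ := id hk
  set σ := δ/2 with hσ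
  have hσ0 : 0 < σ := by linarith
  have e2 : δ = 2*σ := by linarith
  set σ' := 1/σ with hσ'
  have hs1 : 1 ≤ σ' := by rw [hσ', le_div_iff₀ hσ0]; linarith
  have Ez := EE_pos ρ L z
  have Ey := EE_pos ρ L y
  set A1 := Real.exp (-(a-δ)*y) * iP σ ρ L (S1-1) z with hA1
  set A2 := Real.exp (-(a-δ)*z) * iP σ ρ L (S1-1) y with hA2
  set A3 := Real.exp (-a*z) * EE ρ L y * (iB S1 (y,z) + iB S2 (y,z)) with hA3
  have nA1 : 0 ≤ A1 := mul_nonneg (Real.exp_pos _).le (iP_nn _ _ _ _ _)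
  have nA2 : 0 ≤ A2 := mul_nonneg (Real.exp_pos _).le (iP_nn _ _ _ _ _)
  have nb1 := iB_nn S1 (y,z)
  have nb2 := iB_nn S2 (y,z)
  have nA3 : 0 ≤ A3 := by positivity
  have l1 : lam y z ≤ y + 1 := lam_le_one h
  have l2 : y < lam y z := lam_gt y z
  have l3 := lam_le y z
  have E3 := exp_one_le
  have Esh : EE ρ L (lam y z) ≤ 3 * EE ρ L y :=
    (EE_shift hρ hρ1 l1 zero_le_one).trans (mul_le_mul_of_nonneg_right E3 (EE_pos _ _ _).le)
  have El := EE_pos ρ L (lam y z)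
  have u1 : Real.exp (-a*y) * mE ρ L S1 S2 (Iio z) ≤ σ'*A1 := by
    rcases le_or_gt z S1 with hl | hl
    · rw [mE_zero]
      · rw [mul_zero]; positivity
      · intro s hs hs2
        have : s < z := hs
        have := hs2.1
        linarith
    · have hm : mE ρ L S1 S2 (Iio z) ≤ (z-S1) * EE ρ L z :=
        mE_le hρ hl.le fun s hs hs2 => ⟨hs2.1.le, le_of_lt hs⟩
      rw [hA1, iP_eq (by linarith)]
      have q1 : z-S1 ≤ σ' * Real.exp (σ*(z-S1)) := lin_le_exp hσ0
      have q2 : Real.exp (-a*y) * Real.exp (σ*(z-S1)) ≤ Real.exp (-(a-δ)*y) * Real.exp (-σ*z) := by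
        rw [← Real.exp_add, ← Real.exp_add]; apply Real.exp_le_exp.2; rw [e2]; nlinarith
      calc _ ≤ Real.exp (-a*y) * ((σ' * Real.exp (σ*(z-S1))) * EE ρ L z) := by
            refine mul_le_mul_of_nonneg_left (hm.trans ?_) (Real.exp_pos _).le
            gcongr
        _ = σ' * (Real.exp (-a*y) * Real.exp (σ*(z-S1))) * EE ρ L z := by ring
        _ ≤ σ' * (Real.exp (-(a-δ)*y) * Real.exp (-σ*z)) * EE ρ L z := by gcongr
        _ = _ := by ring
  set X := Real.exp (y-z) * mE ρ L S1 S2 (Ioo y (lam y z)) with hX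
  have X0 : 0 ≤ X := mul_nonneg (Real.exp_pos _).le (mE_nn _)
  have hexp : Real.exp (y-z) * Real.exp (z-y) = 1 := by rw [← Real.exp_add]; simp
  have Xle : X ≤ EE ρ L (lam y z) := by
    have hm : mE ρ L S1 S2 (Ioo y (lam y z)) ≤ (lam y z - y) * EE ρ L (lam y z) :=
        mE_le hρ l2.le fun s hs hs2 => ⟨hs.1.le, hs.2.le⟩
    calc X ≤ Real.exp (y-z) * (Real.exp (z-y) * EE ρ L (lam y z)) := by
          refine mul_le_mul_of_nonneg_left (hm.trans ?_) (Real.exp_pos _).le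
          gcongr; linarith
      _ = (Real.exp (y-z) * Real.exp (z-y)) * EE ρ L (lam y z) := by ring
      _ = _ := by rw [hexp, one_mul]
  have Xz : lam y z ≤ S1 → X = 0 := fun hl => by
    rw [hX, mE_zero, mul_zero]
    intro s hs hs2
    exact absurd (hs.2.trans_le hl) (not_lt.2 hs2.1.le)
  have u2 : |kk a κ (z,y) - Real.exp (-a*z)| * X ≤ 9*K0*σ'*A2 := by
    rcases le_or_gt (lam y z) S1 with hl | hl
    · rw [Xz hl, mul_zero]; positivity
    · have hy : S1 - 1 < y := by linarith
      rw [hA2, iP_eq hy]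
      have q : Real.exp (-δ*y) ≤ 3 * Real.exp (-σ*y) := by
        have : Real.exp (-δ*y) ≤ Real.exp 1 * Real.exp (-σ*y) := by
          rw [← Real.exp_add]; apply Real.exp_le_exp.2; rw [e2]; nlinarith
        exact this.trans (by gcongr)
      calc _ ≤ (K0 * (Real.exp (-(a-δ)*z) * Real.exp (-δ*y))) * (3 * EE ρ L y) :=
            mul_le_mul (kk_near1 hk h) (Xle.trans Esh) X0 (by positivity)
        _ ≤ (K0 * (Real.exp (-(a-δ)*z) * (3 * Real.exp (-σ*y)))) * (3 * EE ρ L y) := by gcongr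
        _ = 9*K0*1*(Real.exp (-(a-δ)*z) * (Real.exp (-σ*y) * EE ρ L y)) := by ring
        _ ≤ _ := by gcongr
  have u3 : Real.exp (-a*z) * |X - (Ioc S1 S2).indicator (EE ρ L) y| ≤ σ'*A2 + 3*σ'*A3 := by
    have big : (1 ≤ iB S1 (y,z) + iB S2 (y,z)) → |X - (Ioc S1 S2).indicator (EE ρ L) y| ≤ 3*EE ρ L y →
        Real.exp (-a*z) * |X - (Ioc S1 S2).indicator (EE ρ L) y| ≤ σ'*A2 + 3*σ'*A3 := by
      intro hb hx
      have : Real.exp (-a*z) * |X - (Ioc S1 S2).indicator (EE ρ L) y| ≤ 3*σ'*A3 := by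
        rw [hA3]
        calc _ ≤ Real.exp (-a*z) * (3*EE ρ L y) := by gcongr
          _ = 3*1*(Real.exp (-a*z) * EE ρ L y * 1) := by ring
          _ ≤ _ := by gcongr
      have : 0 ≤ σ'*A2 := by positivity
      linarith
    rcases le_or_gt y S1 with hy | hy
    · have hn : y ∉ Ioc S1 S2 := fun h => absurd h.1 (not_lt.2 hy)
      rcases le_or_gt (lam y z) S1 with hl | hl
      · rw [indicator_of_notMem hn, Xz hl, sub_zero, abs_zero, mul_zero]; positivity
      · refine big ?_ ?_
        · rw [iB_eq (mem_bd h hy hl)]; linarith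
        · rw [indicator_of_notMem hn, sub_zero, abs_of_nonneg X0]; linarith
    · rcases le_or_gt y S2 with hy2 | hy2
      · have hmem : y ∈ Ioc S1 S2 := ⟨hy, hy2⟩
        rcases le_or_gt (lam y z) S2 with hl | hl
        · rw [indicator_of_mem hmem]
          have lo : EE ρ L y - Real.exp (z-y) * EE ρ L y ≤ X := by
            have g1 := mE_ge (L := L) hρ l2.le hy.le hl
            have g2 := lam_ge y z
            calc _ = (Real.exp (y-z) * Real.exp (z-y)) * ((1 - Real.exp (z-y)) * EE ρ L y) := by
                  rw [hexp]; ring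
              _ = Real.exp (y-z) * ((Real.exp (z-y) * (1 - Real.exp (z-y))) * EE ρ L y) := by ring
              _ ≤ Real.exp (y-z) * ((lam y z - y) * EE ρ L y) := by gcongr; linarith
              _ ≤ X := by rw [hX]; gcongr
          have hi : X ≤ EE ρ L y + Real.exp (z-y) * EE ρ L y := by
            refine Xle.trans ?_
            have w : EE ρ L (lam y z) ≤ (1 + Real.exp (z-y)) * EE ρ L y := by
              have w1 := EE_shift (L := L) (s := y) (x := lam y z - y) hρ hρ1 (t := lam y z) (by linarith) (by linarith)
              have w2 : Real.exp (lam y z - y) = 1 + Real.exp (z-y) := by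
                rw [lam_eq, add_sub_cancel_left, Real.exp_log (by positivity)]
              rwa [w2] at w1
            linarith
          have hx : |X - EE ρ L y| ≤ Real.exp (z-y) * EE ρ L y := by
            rw [abs_le]; constructor <;> linarith
          have q : Real.exp (-a*z) * Real.exp (z-y) ≤ Real.exp (-(a-δ)*z) * Real.exp (-σ*y) := by
            rw [← Real.exp_add, ← Real.exp_add]; apply Real.exp_le_exp.2
            rw [e2]; rw [e2] at hδ1; nlinarith
          have : Real.exp (-a*z) * |X - EE ρ L y| ≤ σ'*A2 := by
            rw [hA2, iP_eq (by linarith)]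
            calc _ ≤ Real.exp (-a*z) * (Real.exp (z-y) * EE ρ L y) := by gcongr
              _ = (Real.exp (-a*z) * Real.exp (z-y)) * EE ρ L y := by ring
              _ ≤ (Real.exp (-(a-δ)*z) * Real.exp (-σ*y)) * EE ρ L y := by gcongr
              _ = 1 * (Real.exp (-(a-δ)*z) * (Real.exp (-σ*y) * EE ρ L y)) := by ring
              _ ≤ _ := by gcongr
          have : 0 ≤ 3*σ'*A3 := by positivity
          linarith
        · refine big ?_ ?_
          · rw [iB_eq (mem_bd h hy2 hl)]; linarith
          · rw [indicator_of_mem hmem, abs_le]; constructor <;> linarith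
      · have hn : y ∉ Ioc S1 S2 := fun h => absurd h.2 (not_le.2 hy2)
        have : X = 0 := by
          rw [hX, mE_zero, mul_zero]
          intro s hs hs2
          have := hs.1
          have := hs2.2
          linarith
        rw [indicator_of_notMem hn, this, sub_zero, abs_zero, mul_zero]; positivity
  have dec : Psi a κ ρ L S1 S2 y z = (kk a κ (z,y) - Real.exp (-a*z)) * X
      + Real.exp (-a*z) * (X - (Ioc S1 S2).indicator (EE ρ L) y) - Real.exp (-a*y) * mE ρ L S1 S2 (Iio z) := by
    unfold Psi
    rw [kk_sym hk y z, hX]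
    ring
  have n2 := mul_nonneg (Real.exp_pos (-a*y)).le (mE_nn (ρ := ρ) (L := L) (S1 := S1) (S2 := S2) (Iio z))
  rw [← abs_of_nonneg X0, ← abs_mul] at u2
  rw [← Real.abs_exp (-a*z), ← abs_mul] at u3
  have hσp : 0 < σ' := by linarith
  have m1 := mul_nonneg hσp.le nA1
  have m2 := mul_nonneg hσp.le nA2
  have m3 := mul_nonneg hσp.le nA3
  have m4 := mul_nonneg hK.le m1
  have m5 := mul_nonneg hK.le m2
  have m6 := mul_nonneg hK.le m3
  have fin : 10*(1+K0)*σ'*(A1+A2+A3) = 10*(σ'*A1) + 10*(σ'*A2) + 10*(σ'*A3) + 10*(K0*(σ'*A1))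
    + 10*(K0*(σ'*A2)) + 10*(K0*(σ'*A3)) := by ring
  rw [fin, dec]
  have t1' := abs_le.1 u2
  have t2' := abs_le.1 u3
  rw [abs_le]
  constructor <;> linarith [t1'.1, t1'.2, t2'.1, t2'.2]

end

noncomputable def l2 (a : ℝ) (f : ℝ → ℝ) : ℝ := ∫ s, Real.exp (-a*s) * f s
noncomputable def Gf (ρ : ℝ) (g : ℝ → ℝ) (s : ℝ) : ℝ := ρ * ∫ z in Ioi s, g z
noncomputable def HH (a : ℝ) (κ : ℝ → ℝ) (ρ : ℝ) (f g : ℝ → ℝ) (s : ℝ) : ℝ :=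
  ρ * bil a κ (AF s) f g - l2 a f * Gf ρ g s - ρ * l2 a g * f s

section
variable {a K0 δ : ℝ} {κ : ℝ → ℝ} {ρ L S1 S2 cf cg : ℝ} {f g : ℝ → ℝ}

theorem swapE (hρ : 0 < ρ) {φ : ℝ × ℝ → ℝ} {B : Set (ℝ × (ℝ × ℝ))} {T : Set (ℝ × ℝ)} (hB : MeasurableSet B)
    (hφm : Measurable φ) (hT : MeasurableSet T) (hφ : IntegrableOn φ T)
    (hBT : ∀ s ∈ Ioc S1 S2, ∀ p, (s,p) ∈ B → p ∈ T) :
    (∫ s in Ioc S1 S2, EE ρ L s * ∫ p in {p | (s,p) ∈ B}, φ p) =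
      ∫ p, φ p * mE ρ L S1 S2 {s | (s,p) ∈ B} ∧
    Integrable (fun p => φ p * mE ρ L S1 S2 {s | (s,p) ∈ B}) ∧
    IntegrableOn (fun s => EE ρ L s * ∫ p in {p | (s,p) ∈ B}, φ p) (Ioc S1 S2) := by
  set Φ : ℝ × (ℝ × ℝ) → ℝ := B.indicator fun q => EE ρ L q.1 * φ q.2 with hΦ
  have hEm := (EE_cont ρ L).measurable
  have hm : Measurable Φ := (by fun_prop : Measurable fun q : ℝ × (ℝ × ℝ) => EE ρ L q.1 * φ q.2).indicator hB
  have hI : Integrable Φ ((volume.restrict (Ioc S1 S2)).prod (volume : Measure (ℝ × ℝ))) := by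
    have h0 : Integrable (fun _ : ℝ => EE ρ L S2) (volume.restrict (Ioc S1 S2)) := by simp
    have h1 := h0.mul_prod (hφ.integrable_indicator hT).norm
    refine h1.mono' hm.aestronglyMeasurable ?_
    have : ∀ᵐ q ∂((volume.restrict (Ioc S1 S2)).prod (volume : Measure (ℝ × ℝ))), q.1 ∈ Ioc S1 S2 := by
      have h2 := (Measure.quasiMeasurePreserving_fst (μ := volume.restrict (Ioc S1 S2))
        (ν := (volume : Measure (ℝ × ℝ)))).ae (ae_restrict_mem measurableSet_Ioc)
      exact h2
    filter_upwards [this] with q hq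
    by_cases hqB : q ∈ B
    · rw [hΦ, indicator_of_mem hqB, indicator_of_mem (hBT q.1 hq q.2 hqB), norm_mul]
      gcongr
      rw [Real.norm_eq_abs, abs_of_pos (EE_pos _ _ _)]
      exact EE_mono hρ hq.2
    · rw [hΦ, indicator_of_notMem hqB, norm_zero]
      exact mul_nonneg (EE_pos _ _ _).le (norm_nonneg _)
  have e1 : ∀ s, (∫ p, Φ (s,p)) = EE ρ L s * ∫ p in {p | (s,p) ∈ B}, φ p := by
    intro s
    have hs : MeasurableSet {p | (s,p) ∈ B} := measurable_prodMk_left hB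
    rw [← integral_const_mul, ← integral_indicator hs]
    rfl
  have e2 : ∀ p, (∫ s in Ioc S1 S2, Φ (s,p)) = φ p * mE ρ L S1 S2 {s | (s,p) ∈ B} := by
    intro p
    have hs : MeasurableSet {s | (s,p) ∈ B} := measurable_prodMk_right hB
    unfold mE
    rw [← integral_const_mul, ← Measure.restrict_restrict hs,
      ← integral_indicator hs]
    congr 1; ext s
    by_cases h : (s,p) ∈ B
    · rw [hΦ, indicator_of_mem h, indicator_of_mem (show s ∈ {s | (s,p) ∈ B} from h), mul_comm]
    · rw [hΦ, indicator_of_notMem h, indicator_of_notMem (show s ∉ {s | (s,p) ∈ B} from h)]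
  refine ⟨?_, ?_, ?_⟩
  · simp_rw [← e1, ← e2]
    exact integral_integral_swap hI
  · simp_rw [← e2]
    exact hI.integral_prod_right
  · unfold IntegrableOn
    simp_rw [← e1]
    exact hI.integral_prod_left

theorem HH_fubini (hk : Ker a K0 δ κ) (hρ : 0 < ρ) (hf : Cls a ρ L cf f) (hg : Cls a ρ L cg g) :
    (∫ s in Ioc S1 S2, EE ρ L s * HH a κ ρ f g s) =
      ρ * ∫ p : ℝ × ℝ, Psi a κ ρ L S1 S2 p.1 p.2 * (f p.1 * g p.2) := by
  have ha := hk.ha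
  have hkm := hk.kk_cont.measurable
  have hf1 := hf.1
  have hg1 := hg.1
  have na : -a < 0 := by linarith
  obtain ⟨E1, I1, J1⟩ := swapE (L := L) (S1 := S1) (S2 := S2) hρ (φ := fun p : ℝ × ℝ => kk a κ p * f p.1 * g p.2)
    (B := {q | q.2.1 < q.1 ∧ Real.exp q.1 < Real.exp q.2.1 + Real.exp q.2.2}) (T := AT S2)
    (by
      have h1 : MeasurableSet {q : ℝ × (ℝ × ℝ) | q.2.1 < q.1} := measurableSet_lt (by fun_prop) (by fun_prop)
      have h2 : MeasurableSet {q : ℝ × (ℝ × ℝ) | Real.exp q.1 < Real.exp q.2.1 + Real.exp q.2.2} :=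
        measurableSet_lt (by fun_prop) (by fun_prop)
      exact h1.inter h2)
    (by fun_prop) (AT_meas _) (hk.bil_int hρ hf hg S2) (fun s hs p hp => lt_of_lt_of_le hp.1 hs.2)
  have hI2 : Integrable (fun p : ℝ × ℝ => (Real.exp (-a*p.1) * f p.1) * g p.2) :=
    (hf.int_full ha hρ na).mul_prod (hg.int ha hρ)
  obtain ⟨E2, I2, J2⟩ := swapE (L := L) (S1 := S1) (S2 := S2) hρ
    (φ := fun p : ℝ × ℝ => (Real.exp (-a*p.1) * f p.1) * g p.2)
    (B := {q | q.1 < q.2.2}) (T := univ) (measurableSet_lt (by fun_prop) (by fun_prop))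
    (by fun_prop) MeasurableSet.univ hI2.integrableOn (fun s hs p hp => mem_univ _)
  have hEf : IntegrableOn (fun s => EE ρ L s * f s) (Ioc S1 S2) := by
    have h0 : Integrable (fun s => EE ρ L S2 * |f s|) (volume.restrict (Ioc S1 S2)) :=
      ((hf.int ha hρ).abs.const_mul _).integrableOn
    have hEm := (EE_cont ρ L).measurable
    refine h0.mono' (by fun_prop : Measurable _).aestronglyMeasurable ?_
    refine (ae_restrict_iff' measurableSet_Ioc).2 (Eventually.of_forall fun s hs => ?_)
    rw [norm_mul, Real.norm_eq_abs, Real.norm_eq_abs, abs_of_pos (EE_pos _ _ _)]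
    gcongr
    exact EE_mono hρ hs.2
  have I3 : Integrable (fun p : ℝ × ℝ => ((Ioc S1 S2).indicator (fun s => EE ρ L s * f s) p.1) * (Real.exp (-a*p.2) * g p.2)) :=
    (hEf.integrable_indicator measurableSet_Ioc).mul_prod (hg.int_full ha hρ na)
  have E3 : ∫ p : ℝ × ℝ, ((Ioc S1 S2).indicator (fun s => EE ρ L s * f s) p.1) * (Real.exp (-a*p.2) * g p.2) =
      (∫ s in Ioc S1 S2, EE ρ L s * f s) * l2 a g := by
    rw [Measure.volume_eq_prod, integral_prod_mul ((Ioc S1 S2).indicator (fun s => EE ρ L s * f s))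
      (fun z => Real.exp (-a*z) * g z), integral_indicator measurableSet_Ioc]; rfl
  have b1 : ∀ s, bil a κ (AF s) f g = ∫ p in {p | (s,p) ∈ {q : ℝ × (ℝ × ℝ) | q.2.1 < q.1 ∧ Real.exp q.1 < Real.exp q.2.1 + Real.exp q.2.2}}, kk a κ p * f p.1 * g p.2 :=
    fun s => rfl
  have b2 : ∀ s, l2 a f * ∫ z in Ioi s, g z =
      ∫ p in {p | (s,p) ∈ {q : ℝ × (ℝ × ℝ) | q.1 < q.2.2}}, (Real.exp (-a*p.1) * f p.1) * g p.2 := by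
    intro s
    have : {p : ℝ × ℝ | (s,p) ∈ {q : ℝ × (ℝ × ℝ) | q.1 < q.2.2}} = univ ×ˢ Ioi s := by
      ext p
      simp
    rw [this, Measure.volume_eq_prod, setIntegral_prod_mul (fun y => Real.exp (-a*y) * f y) g]
    simp [l2]
  have c1 : ∀ p : ℝ × ℝ, {s | (s,p) ∈ {q : ℝ × (ℝ × ℝ) | q.2.1 < q.1 ∧ Real.exp q.1 < Real.exp q.2.1 + Real.exp q.2.2}} = Ioo p.1 (lam p.1 p.2) := by
    intro p; ext s
    exact and_congr Iff.rfl lt_lam.symm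
  have c2 : ∀ p : ℝ × ℝ, {s | (s,p) ∈ {q : ℝ × (ℝ × ℝ) | q.1 < q.2.2}} = Iio p.2 := fun p => rfl
  have key : ∀ s, EE ρ L s * HH a κ ρ f g s = ρ * (EE ρ L s * (∫ p in {p | (s,p) ∈ {q : ℝ × (ℝ × ℝ) | q.2.1 < q.1 ∧ Real.exp q.1 < Real.exp q.2.1 + Real.exp q.2.2}}, kk a κ p * f p.1 * g p.2))
      - ρ * (EE ρ L s * (∫ p in {p | (s,p) ∈ {q : ℝ × (ℝ × ℝ) | q.1 < q.2.2}}, (Real.exp (-a*p.1) * f p.1) * g p.2))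
      - ρ * l2 a g * (EE ρ L s * f s) := by
    intro s
    rw [← b1, ← b2]
    unfold HH Gf
    ring
  simp_rw [key]
  rw [integral_sub, integral_sub, integral_const_mul, integral_const_mul, integral_const_mul, E1, E2,
    mul_assoc ρ, mul_comm (l2 a g), ← E3, ← mul_sub, ← mul_sub]
  · rw [← integral_sub I1 I2]
    refine congrArg (ρ * ·) ((integral_sub (I1.sub I2) I3).symm.trans ?_)
    congr 1; ext p
    simp only [Pi.sub_apply]
    rw [c1, c2]
    unfold Psi
    by_cases h : p.1 ∈ Ioc S1 S2
    · rw [indicator_of_mem h, indicator_of_mem h]; ring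
    · rw [indicator_of_notMem h, indicator_of_notMem h]; ring
  · exact J1.const_mul ρ
  · exact J2.const_mul ρ
  · exact (J1.const_mul ρ).sub (J2.const_mul ρ)
  · exact hEf.const_mul _

end

theorem iB_meas (S : ℝ) : Measurable (iB S) := measurable_const.indicator (bd_meas S)

theorem iB_int {S : ℝ} {m : ℝ → ℝ} (hm : Measurable m) (hn : ∀ z, 0 ≤ m z)
    (hi : IntegrableOn (fun z => 2*Real.exp (z-S) * m z) (Iic S)) :
    Integrable (fun p : ℝ × ℝ => iB S p * m p.2) ∧
    ∫ p : ℝ × ℝ, iB S p * m p.2 = ∫ z in Iic S, 2*Real.exp (z-S) * m z := by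
  have hB := iB_meas S
  have sec : ∀ z, z ≤ S → (fun y => iB S (y,z) * m z) = (Ioc (S - 2*Real.exp (z-S)) S).indicator (fun _ => m z) := by
    intro z hz; ext y
    by_cases h : y ∈ Ioc (S - 2*Real.exp (z-S)) S
    · rw [indicator_of_mem h, iB_eq (show (y,z) ∈ bd S from ⟨hz, h.1, h.2⟩), one_mul]
    · rw [indicator_of_notMem h, iB, indicator_of_notMem, zero_mul]
      exact fun h' => h ⟨h'.2.1, h'.2.2⟩
  have sec2 : ∀ z, ¬ z ≤ S → (fun y => iB S (y,z) * m z) = fun _ => 0 := by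
    intro z hz; ext y
    rw [iB, indicator_of_notMem, zero_mul]
    exact fun h' => hz h'.1
  have es : ∀ z, ∫ y, iB S (y,z) * m z = (Iic S).indicator (fun z => 2*Real.exp (z-S) * m z) z := by
    intro z
    by_cases hz : z ≤ S
    · rw [sec z hz, integral_indicator measurableSet_Ioc, indicator_of_mem (show z ∈ Iic S from hz)]
      simp
      left; positivity
    · rw [sec2 z hz, indicator_of_notMem (show z ∉ Iic S from hz)]; simp
  have hmeas : Measurable (fun p : ℝ × ℝ => iB S p * m p.2) := by fun_prop
  have hI : Integrable (fun p : ℝ × ℝ => iB S p * m p.2) := by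
    rw [Measure.volume_eq_prod, integrable_prod_iff' hmeas.aestronglyMeasurable]
    refine ⟨Eventually.of_forall fun z => ?_, ?_⟩
    · by_cases hz : z ≤ S
      · simp only [sec z hz]
        rw [integrable_indicator_iff measurableSet_Ioc]
        exact continuous_const.integrableOn_Ioc
      · simp only [sec2 z hz]; simp
    · have : (fun z => ∫ y, ‖iB S (y,z) * m z‖) = (Iic S).indicator (fun z => 2*Real.exp (z-S) * m z) := by
        ext z; rw [← es z]
        congr 1; ext y; exact Real.norm_of_nonneg (mul_nonneg (iB_nn _ _) (hn _))
      simp only [this]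
      exact hi.integrable_indicator measurableSet_Iic
  refine ⟨hI, ?_⟩
  rw [Measure.volume_eq_prod] at hI ⊢
  rw [integral_prod_symm _ hI]
  simp only [es]
  rw [integral_indicator measurableSet_Iic]

/-- the version used for the decaying part -/
theorem iB_int_le {S δ : ℝ} {m : ℝ → ℝ} (hδ1 : δ ≤ 1) (hm : Measurable m) (hn : ∀ z, 0 ≤ m z)
    (hi : Integrable (fun z => Real.exp (δ*z) * m z)) :
    Integrable (fun p : ℝ × ℝ => iB S p * m p.2) ∧
    ∫ p : ℝ × ℝ, iB S p * m p.2 ≤ 2*Real.exp (-δ*S) * ∫ z, Real.exp (δ*z) * m z := by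
  have hle : ∀ z ∈ Iic S, 2*Real.exp (z-S) * m z ≤ 2*Real.exp (-δ*S) * (Real.exp (δ*z) * m z) := by
    intro z hz
    have hz' : z ≤ S := hz
    rw [← mul_assoc]
    refine mul_le_mul_of_nonneg_right ?_ (hn z)
    rw [mul_assoc, ← Real.exp_add]
    refine mul_le_mul_of_nonneg_left (Real.exp_le_exp.2 (by nlinarith)) (by norm_num)
  have hi2 : Integrable (fun z => 2*Real.exp (-δ*S) * (Real.exp (δ*z) * m z)) := hi.const_mul _
  have hI : IntegrableOn (fun z => 2*Real.exp (z-S) * m z) (Iic S) := by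
    refine hi2.integrableOn.mono' (by fun_prop : Measurable _).aestronglyMeasurable
      ((ae_restrict_iff' measurableSet_Iic).2 (Eventually.of_forall fun z hz => ?_))
    rw [Real.norm_of_nonneg (mul_nonneg (by positivity) (hn z))]
    exact hle z hz
  obtain ⟨h1, h2⟩ := iB_int hm hn hI
  refine ⟨h1, ?_⟩
  rw [h2, ← integral_const_mul]
  calc _ ≤ ∫ z in Iic S, 2*Real.exp (-δ*S) * (Real.exp (δ*z) * m z) :=
        setIntegral_mono_on hI hi2.integrableOn measurableSet_Iic hle
    _ ≤ _ := setIntegral_le_integral hi2 (Eventually.of_forall fun z => by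
        have := hn z; simp only [Pi.zero_apply]; positivity)

section
variable {a K0 δ : ℝ} {κ : ℝ → ℝ}

theorem indE_int {σ S : ℝ} (hσ : 0 < σ) :
    Integrable ((Ioi S).indicator fun z => Real.exp (-σ*z)) ∧
    ∫ z, (Ioi S).indicator (fun z => Real.exp (-σ*z)) z = Real.exp (-σ*S)/σ := by
  refine ⟨(integrableOn_exp_mul_Ioi (neg_lt_zero.2 hσ) S).integrable_indicator measurableSet_Ioi, ?_⟩
  rw [integral_indicator measurableSet_Ioi, integral_exp_mul_Ioi (neg_lt_zero.2 hσ), neg_div_neg_eq]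

set_option maxHeartbeats 1000000 in
theorem Hint (hk : Ker a K0 δ κ) : ∃ C, 0 < C ∧ ∀ ρ L S1 S2 cf cg : ℝ, ∀ f g : ℝ → ℝ, 0 < ρ → ρ ≤ 1 → 0 ≤ S1 →
    L ≤ S1 → S1 ≤ S2 → Cls a ρ L cf f → Cls a ρ L cg g →
    |∫ s in Ioc S1 S2, EE ρ L s * HH a κ ρ f g s| ≤ C * Real.exp (-(δ/2)*S1) * cf * cg := by
  obtain ⟨ha, hK, hδ, hδ1, hδa, -⟩ := id hk
  set σ := δ/2 with hσ
  have hσ0 : 0 < σ := by linarith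
  set A1 : ℝ → ℝ := fun y => Real.exp (-(a-δ)*y) * Real.exp (-(3/4)*kU a y) with hA1
  have iA1 : Integrable A1 := int_full ha (by norm_num) (by linarith)
  set I := ∫ y, A1 y with hI
  have hI0 : 0 ≤ I := integral_nonneg fun y => by rw [hA1]; positivity
  set C0 := 10*(1+K0)*(1/σ) with hC0
  have hC0p : 0 < C0 := by positivity
  refine ⟨C0 * (6*I/σ + 3/σ + 4*I), by positivity, ?_⟩
  intro ρ L S1 S2 cf cg f g hρ hρ1 hS1 hLS h12 hf hg
  have hcf := hf.nn
  have hcg := hg.nn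
  rw [HH_fubini hk hρ hf hg]
  set B1 : ℝ → ℝ := (Ioi (S1-1)).indicator fun z => Real.exp (-σ*z) with hB1
  set V : ℝ → ℝ := (Ioi S1).indicator fun z => Real.exp (ρ*L) * Real.exp (-ρ*z) with hV
  set m : ℝ → ℝ := fun z => Real.exp (-a*z) * Real.exp (-(3/4)*kU a z) with hm
  have hmm : Measurable m := by have := kU_cont a; rw [hm]; fun_prop
  have hmn : ∀ z, 0 ≤ m z := fun z => by rw [hm]; positivity
  have hB1n : ∀ z, 0 ≤ B1 z := fun z => indicator_nonneg (fun _ _ => (Real.exp_pos _).le) _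
  have hVn : ∀ z, 0 ≤ V z := fun z => indicator_nonneg (fun _ _ => by positivity) _
  obtain ⟨iB1, eB1⟩ := indE_int (S := S1-1) hσ0
  have iV : Integrable V := by
    have : IntegrableOn (fun z => Real.exp (ρ*L) * Real.exp (-ρ*z)) (Ioi S1) :=
      (integrableOn_exp_mul_Ioi (neg_lt_zero.2 hρ) S1).const_mul _
    exact this.integrable_indicator measurableSet_Ioi
  have eV : ∫ z, V z ≤ 1/ρ := by
    rw [hV, integral_indicator measurableSet_Ioi, integral_const_mul, integral_exp_mul_Ioi (neg_lt_zero.2 hρ), neg_div_neg_eq, ← mul_div_assoc, ← Real.exp_add]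
    gcongr
    apply Real.exp_le_one_iff.2; nlinarith
  have hem : (fun z => Real.exp (δ*z) * m z) = A1 := by
    ext z; rw [hm, hA1]; simp only; rw [← mul_assoc, ← Real.exp_add]; congr 2; ring
  have hmi : Integrable (fun z => Real.exp (δ*z) * m z) := by rw [hem]; exact iA1
  obtain ⟨j1, k1⟩ := iB_int_le (S := S1) hδ1.le hmm hmn hmi
  obtain ⟨j2, k2⟩ := iB_int_le (S := S2) hδ1.le hmm hmn hmi
  rw [hem] at k1 k2
  have d1 : Integrable (fun p : ℝ × ℝ => A1 p.1 * B1 p.2) := iA1.mul_prod iB1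
  have d2 : Integrable (fun p : ℝ × ℝ => B1 p.1 * A1 p.2) := iB1.mul_prod iA1
  have d3 : Integrable (fun p : ℝ × ℝ => B1 p.1 * V p.2) := iB1.mul_prod iV
  have e1 : ∫ p : ℝ × ℝ, A1 p.1 * B1 p.2 = I * (Real.exp (-σ*(S1-1))/σ) := by
    rw [Measure.volume_eq_prod, integral_prod_mul A1 B1, eB1]
  have e2 : ∫ p : ℝ × ℝ, B1 p.1 * A1 p.2 = (Real.exp (-σ*(S1-1))/σ) * I := by
    rw [Measure.volume_eq_prod, integral_prod_mul B1 A1, eB1]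
  have e3 : ∫ p : ℝ × ℝ, B1 p.1 * V p.2 = (Real.exp (-σ*(S1-1))/σ) * ∫ z, V z := by
    rw [Measure.volume_eq_prod, integral_prod_mul B1 V, eB1]
  have dI := ((((d1.add d2).add d3).add (j1.add j2)).const_mul (C0*cf*cg))
  have hWE : ∀ y, kW a ρ L y * EE ρ L y ≤ 1 := kW_EE ha hρ
  have hP : ∀ y S, S1 - 1 ≤ S → iP σ ρ L S y * kW a ρ L y ≤ B1 y := by
    intro y S hS
    by_cases h : S < y
    · rw [iP_eq h, hB1, indicator_of_mem (show y ∈ Ioi (S1-1) from lt_of_le_of_lt hS h)]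
      have := mul_le_mul_of_nonneg_left (hWE y) (Real.exp_pos (-σ*y)).le
      linarith
    · rw [iP, indicator_of_notMem (show y ∉ Ioi S from h), zero_mul]; exact hB1n y
  have hA : ∀ y, Real.exp (-(a-δ)*y) * kW a ρ L y ≤ A1 y := fun y =>
    mul_le_mul_of_nonneg_left (kW_le_U hρ y) (Real.exp_pos _).le
  have hVV : ∀ z, i1 S1 z * kW a ρ L z ≤ V z := by
    intro z
    by_cases h : S1 < z
    · rw [i1_eq h, hV, indicator_of_mem (show z ∈ Ioi S1 from h), one_mul, ← Real.exp_add]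
      refine (kW_le_E ha hρ z).trans (Real.exp_le_exp.2 (by linarith))
    · rw [i1, indicator_of_notMem (show z ∉ Ioi S1 from h), zero_mul]; exact hVn z
  have hmW : ∀ z, Real.exp (-a*z) * kW a ρ L z ≤ m z := fun z =>
    mul_le_mul_of_nonneg_left (kW_le_U hρ z) (Real.exp_pos _).le
  have dom : ∀ p : ℝ × ℝ, ‖Psi a κ ρ L S1 S2 p.1 p.2 * (f p.1 * g p.2)‖ ≤
      C0*cf*cg * (A1 p.1 * B1 p.2 + B1 p.1 * A1 p.2 + B1 p.1 * V p.2 + (iB S1 p * m p.2 + iB S2 p * m p.2)) := by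
    rintro ⟨y, z⟩
    simp only
    rw [Real.norm_eq_abs, abs_mul, abs_mul]
    have wy := kW_pos a ρ L y
    have wz := kW_pos a ρ L z
    have hfg : |f y| * |g z| ≤ cf * kW a ρ L y * (cg * kW a ρ L z) :=
      mul_le_mul (hf.2 y) (hg.2 z) (abs_nonneg _) (by positivity)
    have t1 : Real.exp (-(a-δ)*y) * iP σ ρ L (S1-1) z * (kW a ρ L y * kW a ρ L z) ≤ A1 y * B1 z := by
      have := mul_le_mul (hA y) (hP z (S1-1) le_rfl) (mul_nonneg (iP_nn _ _ _ _ _) wz.le) (by rw [hA1]; positivity)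
      linarith
    have t2 : Real.exp (-(a-δ)*z) * iP σ ρ L (S1-1) y * (kW a ρ L y * kW a ρ L z) ≤ B1 y * A1 z := by
      have := mul_le_mul (hP y (S1-1) le_rfl) (hA z) (by positivity) (hB1n y)
      linarith
    have t3 : iP σ ρ L S1 y * i1 S1 z * (kW a ρ L y * kW a ρ L z) ≤ B1 y * V z := by
      have := mul_le_mul (hP y S1 (by linarith)) (hVV z) (mul_nonneg (i1_nn _ _) wz.le) (hB1n y)
      linarith
    have t4 : Real.exp (-a*z) * EE ρ L y * (iB S1 (y,z) + iB S2 (y,z)) * (kW a ρ L y * kW a ρ L z) ≤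
        iB S1 (y,z) * m z + iB S2 (y,z) * m z := by
      have h1 := mul_le_mul (hWE y) (hmW z) (by positivity) zero_le_one
      have h2 := mul_le_mul_of_nonneg_left h1 (add_nonneg (iB_nn S1 (y,z)) (iB_nn S2 (y,z)))
      linarith
    have n1 : 0 ≤ A1 y * B1 z := mul_nonneg (by rw [hA1]; positivity) (hB1n z)
    have n2 : 0 ≤ B1 y * A1 z := mul_nonneg (hB1n y) (by rw [hA1]; positivity)
    have n3 : 0 ≤ B1 y * V z := mul_nonneg (hB1n y) (hVn z)
    have n4 : 0 ≤ iB S1 (y,z) * m z + iB S2 (y,z) * m z :=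
      add_nonneg (mul_nonneg (iB_nn _ _) (hmn z)) (mul_nonneg (iB_nn _ _) (hmn z))
    rcases lt_or_ge y z with h | h
    · have hp := Psi1 (L := L) (S2 := S2) hk hρ hρ1 hS1 h
      rw [← hσ, ← hC0] at hp
      calc _ ≤ _ := mul_le_mul hp hfg (by positivity) ((abs_nonneg _).trans hp)
        _ = C0*cf*cg * (Real.exp (-(a-δ)*y) * iP σ ρ L (S1-1) z * (kW a ρ L y * kW a ρ L z) + Real.exp (-(a-δ)*z) * iP σ ρ L (S1-1) y * (kW a ρ L y * kW a ρ L z) + iP σ ρ L S1 y * i1 S1 z * (kW a ρ L y * kW a ρ L z)) := by ring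
        _ ≤ _ := mul_le_mul_of_nonneg_left (by linarith) (by positivity)
    · have hp := Psi2 (L := L) (S2 := S2) hk hρ hρ1 hS1 h
      rw [← hσ, ← hC0] at hp
      calc _ ≤ _ := mul_le_mul hp hfg (by positivity) ((abs_nonneg _).trans hp)
        _ = C0*cf*cg * (Real.exp (-(a-δ)*y) * iP σ ρ L (S1-1) z * (kW a ρ L y * kW a ρ L z) + Real.exp (-(a-δ)*z) * iP σ ρ L (S1-1) y * (kW a ρ L y * kW a ρ L z) + Real.exp (-a*z) * EE ρ L y * (iB S1 (y,z) + iB S2 (y,z)) * (kW a ρ L y * kW a ρ L z)) := by ring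
        _ ≤ _ := mul_le_mul_of_nonneg_left (by linarith) (by positivity)
  have main : |∫ p : ℝ × ℝ, Psi a κ ρ L S1 S2 p.1 p.2 * (f p.1 * g p.2)| ≤
      ∫ p : ℝ × ℝ, C0*cf*cg * (A1 p.1 * B1 p.2 + B1 p.1 * A1 p.2 + B1 p.1 * V p.2 + (iB S1 p * m p.2 + iB S2 p * m p.2)) := by
    rw [← Real.norm_eq_abs]
    exact norm_integral_le_of_norm_le dI (Eventually.of_forall dom)
  have eD : ∫ p : ℝ × ℝ, C0*cf*cg * (A1 p.1 * B1 p.2 + B1 p.1 * A1 p.2 + B1 p.1 * V p.2 + (iB S1 p * m p.2 + iB S2 p * m p.2)) =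
      C0*cf*cg * (I * (Real.exp (-σ*(S1-1))/σ) + (Real.exp (-σ*(S1-1))/σ) * I + (Real.exp (-σ*(S1-1))/σ) * (∫ z, V z) + ((∫ p : ℝ × ℝ, iB S1 p * m p.2) + (∫ p : ℝ × ℝ, iB S2 p * m p.2))) := by
    rw [integral_const_mul]
    congr 1
    rw [← e1, ← e2, ← e3, ← integral_add j1 j2, ← integral_add d1 d2]
    refine (integral_add ((d1.add d2).add d3) (j1.add j2)).trans ?_
    congr 1
    exact integral_add (d1.add d2) d3
  have x1 : Real.exp (-σ*(S1-1)) ≤ 3 * Real.exp (-σ*S1) := by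
    rw [show -σ*(S1-1) = σ + -σ*S1 by ring, Real.exp_add]
    gcongr
    exact (Real.exp_le_exp.2 (by linarith)).trans exp_one_le
  have x2 : Real.exp (-δ*S1) ≤ Real.exp (-σ*S1) := Real.exp_le_exp.2 (by nlinarith)
  have x3 : Real.exp (-δ*S2) ≤ Real.exp (-σ*S1) := Real.exp_le_exp.2 (by nlinarith)
  set X := Real.exp (-σ*S1) with hX
  have hXp : 0 < X := Real.exp_pos _
  rw [abs_mul, abs_of_pos hρ]
  have y1 : ρ * (Real.exp (-σ*(S1-1))/σ * I) ≤ 3*X/σ*I := by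
    have : Real.exp (-σ*(S1-1))/σ * I ≤ 3*X/σ*I := by gcongr
    have h0 : 0 ≤ Real.exp (-σ*(S1-1))/σ * I := by positivity
    nlinarith
  have y2 : ρ * (Real.exp (-σ*(S1-1))/σ * (∫ z, V z)) ≤ 3*X/σ := by
    have hV0 : 0 ≤ ∫ z, V z := integral_nonneg hVn
    calc _ ≤ ρ * (3*X/σ * (1/ρ)) := by gcongr
      _ = _ := by rw [mul_one_div, mul_div_assoc']; exact mul_div_cancel_left₀ _ hρ.ne'
  have y3 : ρ * (∫ p : ℝ × ℝ, iB S1 p * m p.2) ≤ 2*X*I := by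
    have h0 : 0 ≤ ∫ p : ℝ × ℝ, iB S1 p * m p.2 := integral_nonneg fun p => mul_nonneg (iB_nn _ _) (hmn _)
    have : 2*Real.exp (-δ*S1)*I ≤ 2*X*I := by gcongr
    nlinarith
  have y4 : ρ * (∫ p : ℝ × ℝ, iB S2 p * m p.2) ≤ 2*X*I := by
    have h0 : 0 ≤ ∫ p : ℝ × ℝ, iB S2 p * m p.2 := integral_nonneg fun p => mul_nonneg (iB_nn _ _) (hmn _)
    have : 2*Real.exp (-δ*S2)*I ≤ 2*X*I := by gcongr
    nlinarith
  calc _ ≤ ρ * _ := mul_le_mul_of_nonneg_left (main.trans eD.le) hρ.le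
    _ = C0*cf*cg * (2*(ρ * (Real.exp (-σ*(S1-1))/σ * I)) + ρ * (Real.exp (-σ*(S1-1))/σ * (∫ z, V z)) + (ρ * (∫ p : ℝ × ℝ, iB S1 p * m p.2) + ρ * (∫ p : ℝ × ℝ, iB S2 p * m p.2))) := by ring
    _ ≤ C0*cf*cg * (2*(3*X/σ*I) + 3*X/σ + (2*X*I + 2*X*I)) := by gcongr
    _ = _ := by ring

end

def AC (s : ℝ) : Set (ℝ × ℝ) := {p | p ∈ AF s ∧ p.2 < p.1}
def AN (s : ℝ) : Set (ℝ × ℝ) := {p | p ∈ AF s ∧ p.1 ≤ p.2}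

theorem AC_meas (s : ℝ) : MeasurableSet (AC s) :=
  (AF_meas s).inter (measurableSet_lt measurable_snd measurable_fst)
theorem AN_meas (s : ℝ) : MeasurableSet (AN s) :=
  (AF_meas s).inter (measurableSet_le measurable_fst measurable_snd)
theorem AC_sub (s : ℝ) : AC s ⊆ AT s := fun _ h => AF_sub s h.1
theorem AN_sub (s : ℝ) : AN s ⊆ AT s := fun _ h => AF_sub s h.1

section
variable {a K0 δ : ℝ} {κ : ℝ → ℝ} {ρ L cf cg : ℝ} {f g : ℝ → ℝ}

theorem bil_AF_split (hk : Ker a K0 δ κ) (hρ : 0 < ρ) (hf : Cls a ρ L cf f) (hg : Cls a ρ L cg g) (s : ℝ) :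
    bil a κ (AF s) f g = bil a κ (AN s) f g + bil a κ (AC s) f g := by
  unfold bil
  rw [← setIntegral_union _ (AC_meas s) ((hk.bil_int hρ hf hg s).mono_set (AN_sub s))
    ((hk.bil_int hρ hf hg s).mono_set (AC_sub s))]
  · congr 2; ext p
    constructor
    · intro h
      rcases le_or_gt p.1 p.2 with h' | h'
      · exact Or.inl ⟨h, h'⟩
      · exact Or.inr ⟨h, h'⟩
    · rintro (h | h)
      · exact h.1
      · exact h.1
  · rw [disjoint_left]; intro p h1 h2; exact absurd h1.2 (not_le.2 h2.2)

theorem half_lt {s y z : ℝ} (hzy : z ≤ y) (h : s < lam y z) : s - Real.log 2 < y := by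
  have := lam_le_log hzy; linarith

theorem expE_half (hρ : 0 < ρ) (hρ1 : ρ ≤ 1) {s y : ℝ} (h : s - Real.log 2 < y) :
    Real.exp (-ρ*(y-L)) ≤ 2 * Real.exp (-ρ*(s-L)) := by
  rw [← Real.exp_log (show (0:ℝ) < 2 by norm_num), ← Real.exp_add]
  apply Real.exp_le_exp.2
  have := Real.log_pos (show (1:ℝ) < 2 by norm_num)
  nlinarith

theorem kk_le1 (hk : Ker a K0 δ κ) {y z : ℝ} (h : y ≤ z) : kk a κ (y,z) ≤ (1+2*K0) * Real.exp (-a*y) := by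
  have := hk.le_of_lt (t := y-z) (by have := Real.log_pos (show (1:ℝ) < 2 by norm_num); linarith)
  unfold kk
  rw [mul_comm]; gcongr

set_option maxHeartbeats 1000000 in
theorem HA (hk : Ker a K0 δ κ) : ∃ C, 0 < C ∧ ∀ ρ L s cf cg : ℝ, ∀ f g : ℝ → ℝ, 0 < ρ → ρ ≤ 1 →
    L ≤ s → Cls a ρ L cf f → Cls a ρ L cg g →
    |ρ * bil a κ (AF s) f g - l2 a f * Gf ρ g s - ρ * bil a κ (AC s) f g| ≤
      (Real.exp (-a*s)/a + ρ * C * Real.exp (-δ*s)) * cf * cg * Real.exp (-ρ*(s-L)) := by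
  obtain ⟨ha, hK, hδ, hδ1, hδa, -⟩ := id hk
  set A1 : ℝ → ℝ := fun y => Real.exp (-(a-δ)*y) * Real.exp (-(3/4)*kU a y) with hA1
  have iA1 : Integrable A1 := int_full ha (by norm_num) (by linarith)
  have hA1n : ∀ y, 0 ≤ A1 y := fun y => by rw [hA1]; positivity
  set I := ∫ y, A1 y with hI
  have hI0 : 0 ≤ I := integral_nonneg hA1n
  refine ⟨K0*I/δ + 4*(1+2*K0)*I + 1, by positivity, ?_⟩
  intro ρ L s cf cg f g hρ hρ1 hLs hf hg
  have hcf := hf.nn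
  have hcg := hg.nn
  have hf1 := hf.1
  have hg1 := hg.1
  have hkm := hk.kk_cont.measurable
  set E1 := Real.exp (-ρ*(s-L)) with hE1
  have hE1p : 0 < E1 := Real.exp_pos _
  have hE1le : E1 ≤ 1 := Real.exp_le_one_iff.2 (by nlinarith)
  set B1 : ℝ → ℝ := (Ioi s).indicator fun z => Real.exp (-δ*z) with hB1
  set B2 : ℝ → ℝ := (Ici s).indicator fun z => Real.exp (-a*z) with hB2
  set V : ℝ → ℝ := (Ioi s).indicator fun z => Real.exp (ρ*L) * Real.exp (-ρ*z) with hV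
  set m : ℝ → ℝ := fun z => Real.exp (-a*z) * Real.exp (-(3/4)*kU a z) with hm
  have hmm : Measurable m := by have := kU_cont a; rw [hm]; fun_prop
  have hmn : ∀ z, 0 ≤ m z := fun z => by rw [hm]; positivity
  have hB1n : ∀ z, 0 ≤ B1 z := fun z => indicator_nonneg (fun _ _ => (Real.exp_pos _).le) _
  have hB2n : ∀ z, 0 ≤ B2 z := fun z => indicator_nonneg (fun _ _ => (Real.exp_pos _).le) _
  have hVn : ∀ z, 0 ≤ V z := fun z => indicator_nonneg (fun _ _ => by positivity) _
  obtain ⟨iB1, eB1⟩ := indE_int (S := s) hδ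
  have iB2 : Integrable B2 := by
    have : IntegrableOn (fun z => Real.exp (-a*z)) (Ici s) :=
      (integrableOn_Ici_iff_integrableOn_Ioi).2 (integrableOn_exp_mul_Ioi (neg_lt_zero.2 ha) s)
    exact this.integrable_indicator measurableSet_Ici
  have eB2 : ∫ z, B2 z = Real.exp (-a*s)/a := by
    rw [hB2, integral_indicator measurableSet_Ici, integral_Ici_eq_integral_Ioi,
      integral_exp_mul_Ioi (neg_lt_zero.2 ha), neg_div_neg_eq]
  have iV : Integrable V := by
    have : IntegrableOn (fun z => Real.exp (ρ*L) * Real.exp (-ρ*z)) (Ioi s) :=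
      (integrableOn_exp_mul_Ioi (neg_lt_zero.2 hρ) s).const_mul _
    exact this.integrable_indicator measurableSet_Ioi
  have eV : ∫ z, V z = E1/ρ := by
    rw [hV, integral_indicator measurableSet_Ioi, integral_const_mul, integral_exp_mul_Ioi (neg_lt_zero.2 hρ), neg_div_neg_eq, ← mul_div_assoc, ← Real.exp_add]
    congr 2; ring
  have hem : (fun z => Real.exp (δ*z) * m z) = A1 := by
    ext z; rw [hm, hA1]; simp only; rw [← mul_assoc, ← Real.exp_add]; congr 2; ring
  have hmi : Integrable (fun z => Real.exp (δ*z) * m z) := by rw [hem]; exact iA1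
  obtain ⟨j1', k1'⟩ := iB_int_le (S := s) hδ1.le hmm hmn hmi
  rw [hem] at k1'
  have j1 : Integrable (fun p : ℝ × ℝ => iB s p.swap * m p.1) := j1'.swap
  have k1 : ∫ p : ℝ × ℝ, iB s p.swap * m p.1 ≤ 2*Real.exp (-δ*s) * I := by
    refine le_of_eq_of_le ?_ k1'
    exact integral_prod_swap (μ := volume) (ν := volume) (fun p : ℝ × ℝ => iB s p * m p.2)
  have d1 : Integrable (fun p : ℝ × ℝ => A1 p.1 * B1 p.2) := iA1.mul_prod iB1
  have d2 : Integrable (fun p : ℝ × ℝ => B2 p.1 * V p.2) := iB2.mul_prod iV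
  have e1 : ∫ p : ℝ × ℝ, A1 p.1 * B1 p.2 = I * (Real.exp (-δ*s)/δ) := by
    rw [Measure.volume_eq_prod, integral_prod_mul A1 B1, eB1]
  have e2 : ∫ p : ℝ × ℝ, B2 p.1 * V p.2 = (Real.exp (-a*s)/a) * (E1/ρ) := by
    rw [Measure.volume_eq_prod, integral_prod_mul B2 V, eB2, eV]
  -- rewriting
  rw [bil_AF_split hk hρ hf hg]
  have I1 : IntegrableOn (fun p : ℝ × ℝ => kk a κ p * f p.1 * g p.2) (AN s) :=
    (hk.bil_int hρ hf hg s).mono_set (AN_sub s)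
  have I1' := I1.integrable_indicator (AN_meas s)
  have I2 : Integrable (fun p : ℝ × ℝ => (Real.exp (-a*p.1) * f p.1) * (Ioi s).indicator g p.2) :=
    (hf.int_full ha hρ (by linarith)).mul_prod ((hg.int ha hρ).indicator measurableSet_Ioi)
  have E2 : ∫ p : ℝ × ℝ, (Real.exp (-a*p.1) * f p.1) * (Ioi s).indicator g p.2 = l2 a f * ∫ z in Ioi s, g z := by
    rw [Measure.volume_eq_prod, integral_prod_mul (fun y => Real.exp (-a*y) * f y) ((Ioi s).indicator g),
      integral_indicator measurableSet_Ioi]; rfl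
  have E1' : bil a κ (AN s) f g = ∫ p, (AN s).indicator (fun p : ℝ × ℝ => kk a κ p * f p.1 * g p.2) p := by
    rw [integral_indicator (AN_meas s)]; rfl
  have key : ρ * (bil a κ (AN s) f g + bil a κ (AC s) f g) - l2 a f * Gf ρ g s - ρ * bil a κ (AC s) f g =
      ρ * ∫ p : ℝ × ℝ, ((AN s).indicator (fun p : ℝ × ℝ => kk a κ p * f p.1 * g p.2) p
        - (Real.exp (-a*p.1) * f p.1) * (Ioi s).indicator g p.2) := by
    rw [integral_sub I1' I2, E2, ← E1']; unfold Gf; ring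
  rw [key, abs_mul, abs_of_pos hρ]
  have dom : ∀ p : ℝ × ℝ, ‖(AN s).indicator (fun p : ℝ × ℝ => kk a κ p * f p.1 * g p.2) p
        - (Real.exp (-a*p.1) * f p.1) * (Ioi s).indicator g p.2‖ ≤
      cf*cg * (K0*E1 * (A1 p.1 * B1 p.2) + B2 p.1 * V p.2 + 2*(1+2*K0)*E1*(iB s p.swap * m p.1)) := by
    rintro ⟨y, z⟩
    simp only [Prod.swap_prod_mk]
    have wy := kW_pos a ρ L y
    have wz := kW_pos a ρ L z
    have n1 : 0 ≤ A1 y * B1 z := mul_nonneg (hA1n y) (hB1n z)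
    have n2 : 0 ≤ B2 y * V z := mul_nonneg (hB2n y) (hVn z)
    have n3 : 0 ≤ iB s (z,y) * m y := mul_nonneg (iB_nn _ _) (hmn y)
    have n1' : 0 ≤ K0*E1 * (A1 y * B1 z) := by positivity
    have n3' : 0 ≤ 2*(1+2*K0)*E1*(iB s (z,y) * m y) := by positivity
    rw [Real.norm_eq_abs]
    rcases lt_or_ge s z with hz | hz
    · rw [indicator_of_mem (show z ∈ Ioi s from hz)]
      rcases lt_or_ge y s with hy | hy
      · have hmem : (y,z) ∈ AN s := by
          refine ⟨⟨hy, ?_⟩, (hy.trans hz).le⟩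
          have := Real.exp_lt_exp.2 hz
          have := Real.exp_pos y
          show Real.exp s < Real.exp y + Real.exp z
          linarith
        rw [indicator_of_mem hmem]
        simp only
        rw [show kk a κ (y,z) * f y * g z - Real.exp (-a*y) * f y * g z = (kk a κ (y,z) - Real.exp (-a*y)) * (f y * g z) by ring,
          abs_mul, abs_mul]
        have h1 := kk_near1 hk (hy.trans hz).le
        have h2 : |f y| * |g z| ≤ cf * Real.exp (-(3/4)*kU a y) * (cg * E1) := by
          refine mul_le_mul (hf.le_U hρ y) ((hg.le_E ha hρ z).trans ?_) (abs_nonneg _) (by positivity)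
          refine mul_le_mul_of_nonneg_left (Real.exp_le_exp.2 (by nlinarith)) hcg
        calc _ ≤ _ := mul_le_mul h1 h2 (by positivity) (by positivity)
          _ = cf*cg*(K0*E1*(A1 y * B1 z)) := by
            rw [hA1, hB1, indicator_of_mem (show z ∈ Ioi s from hz)]; ring
          _ ≤ _ := mul_le_mul_of_nonneg_left (by linarith) (by positivity)
      · rw [indicator_of_notMem (show (y,z) ∉ AN s from fun h => absurd h.1.1 (not_lt.2 hy)), zero_sub, abs_neg,
          abs_mul, abs_mul, Real.abs_exp]
        have h1 : |f y| ≤ cf := by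
          have := hf.2 y
          have h3 := kW_le_one (L := L) ha hρ y
          nlinarith
        calc _ ≤ Real.exp (-a*y) * cf * (cg * Real.exp (-ρ*(z-L))) := by
              gcongr
              exact hg.le_E ha hρ z
          _ = cf*cg*(B2 y * V z) := by
            rw [hB2, hV, indicator_of_mem (show z ∈ Ioi s from hz), indicator_of_mem (show y ∈ Ici s from hy), ← Real.exp_add,
              show ρ*L + -ρ*z = -ρ*(z-L) by ring]; ring
          _ ≤ _ := mul_le_mul_of_nonneg_left (by linarith) (by positivity)
    · rw [indicator_of_notMem (show z ∉ Ioi s from not_lt.2 hz), mul_zero, sub_zero]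
      by_cases hmem : (y,z) ∈ AN s
      · rw [indicator_of_mem hmem]
        simp only
        have hyz : y ≤ z := hmem.2
        have hl : s < lam z y := by rw [lam_comm]; exact lt_lam.2 hmem.1.2
        have hb := mem_bd hyz hz hl
        rw [abs_mul, abs_mul, abs_of_nonneg (hk.kk_nn _)]
        calc _ ≤ ((1+2*K0) * Real.exp (-a*y)) * (cf * Real.exp (-(3/4)*kU a y)) * (cg * (2*E1)) := by
              gcongr
              · exact kk_le1 hk hyz
              · exact hf.le_U hρ y
              · exact (hg.le_E ha hρ z).trans (mul_le_mul_of_nonneg_left (expE_half hρ hρ1 (half_lt hyz hl)) hcg)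
          _ = cf*cg*(2*(1+2*K0)*E1*(iB s (z,y) * m y)) := by rw [iB_eq hb, hm]; ring
          _ ≤ _ := mul_le_mul_of_nonneg_left (by linarith) (by positivity)
      · rw [indicator_of_notMem hmem, abs_zero]; positivity
  have D1 := d1.const_mul (K0*E1)
  have D3 := j1.const_mul (2*(1+2*K0)*E1)
  have main := norm_integral_le_of_norm_le (((D1.add d2).add D3).const_mul (cf*cg)) (Eventually.of_forall dom)
  rw [Real.norm_eq_abs] at main
  have eD : ∫ p : ℝ × ℝ, cf*cg * (K0*E1 * (A1 p.1 * B1 p.2) + B2 p.1 * V p.2 + 2*(1+2*K0)*E1*(iB s p.swap * m p.1)) =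
      cf*cg * (K0*E1 * (I * (Real.exp (-δ*s)/δ)) + (Real.exp (-a*s)/a) * (E1/ρ) + 2*(1+2*K0)*E1* ∫ p : ℝ × ℝ, iB s p.swap * m p.1) := by
    have q1 : ∫ p : ℝ × ℝ, K0*E1 * (A1 p.1 * B1 p.2) = K0*E1 * (I * (Real.exp (-δ*s)/δ)) := by
      rw [integral_const_mul, e1]
    have q3 : ∫ p : ℝ × ℝ, 2*(1+2*K0)*E1*(iB s p.swap * m p.1) = 2*(1+2*K0)*E1* ∫ p : ℝ × ℝ, iB s p.swap * m p.1 :=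
      integral_const_mul _ _
    rw [integral_const_mul, ← e2, ← q1, ← q3]
    congr 1
    refine (integral_add (D1.add d2) D3).trans ?_
    congr 1
    exact integral_add D1 d2
  have main' := main.trans eD.le
  have r : ρ * (Real.exp (-a*s)/a * (E1/ρ)) = Real.exp (-a*s)/a * E1 := by
    rw [mul_comm ρ, mul_assoc, div_mul_cancel₀ _ hρ.ne']
  calc _ ≤ _ := mul_le_mul_of_nonneg_left main' hρ.le
    _ = cf*cg * (ρ*(K0*E1 * (I * (Real.exp (-δ*s)/δ))) + ρ * (Real.exp (-a*s)/a * (E1/ρ)) + ρ*(2*(1+2*K0)*E1* ∫ p : ℝ × ℝ, iB s p.swap * m p.1)) := by ring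
    _ ≤ cf*cg * (ρ*(K0*E1 * (I * (Real.exp (-δ*s)/δ))) + Real.exp (-a*s)/a * E1 + ρ*(2*(1+2*K0)*E1* (2*Real.exp (-δ*s) * I)) + ρ*Real.exp (-δ*s)*E1) := by
        have : 0 ≤ ρ*Real.exp (-δ*s)*E1 := by positivity
        rw [r]
        refine mul_le_mul_of_nonneg_left ?_ (by positivity)
        have := mul_le_mul_of_nonneg_left k1 (show 0 ≤ ρ*(2*(1+2*K0)*E1) by positivity)
        linarith
    _ = _ := by ring

set_option maxHeartbeats 1000000 in
theorem HC (hk : Ker a K0 δ κ) : ∃ C, 0 < C ∧ ∀ ρ L s b cf cg : ℝ, ∀ f g : ℝ → ℝ, 0 < ρ → ρ ≤ 1 →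
    Cls a ρ L cf f → Cls a ρ L cg g → (∀ y, s - Real.log 2 < y → y ≤ s → |f y| ≤ b * Real.exp (-ρ*(y-L))) → 
    |bil a κ (AC s) f g| ≤ C * b * cg * Real.exp (-ρ*(s-L)) ∧ |l2 a g| ≤ C * cg := by
  obtain ⟨ha, hK, hδ, hδ1, hδa, -⟩ := id hk
  set m : ℝ → ℝ := fun z => Real.exp (-a*z) * Real.exp (-(3/4)*kU a z) with hm
  have im : Integrable m := int_full ha (by norm_num) (by linarith)
  have hmm : Measurable m := by have := kU_cont a; rw [hm]; fun_prop
  have hmn : ∀ y, 0 ≤ m y := fun y => by rw [hm]; positivity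
  set J := ∫ y, m y with hJ
  have hJ0 : 0 ≤ J := integral_nonneg hmn
  refine ⟨4*(1+2*K0)*J + J + 1, by positivity, ?_⟩
  intro ρ L s b cf cg f g hρ hρ1 hf hg hb
  have hcg := hg.nn
  have hl2 := Real.log_pos (show (1:ℝ) < 2 by norm_num)
  have hb0 : 0 ≤ b := by
    have := (abs_nonneg _).trans (hb s (by linarith) le_rfl)
    exact nonneg_of_mul_nonneg_left this (Real.exp_pos _)
  set E1 := Real.exp (-ρ*(s-L)) with hE1
  have hE1p : 0 < E1 := Real.exp_pos _
  constructor
  · set m2 : ℝ → ℝ := fun z => Real.exp (s-z) * m z with hm2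
    have e : (fun z => 2*Real.exp (z-s) * m2 z) = fun z => 2 * m z := by
      ext z; rw [hm2]; simp only
      have : Real.exp (z-s) * Real.exp (s-z) = 1 := by rw [← Real.exp_add]; simp
      linear_combination 2 * m z * this
    have im2 : Integrable (fun z => 2 * m z) := im.const_mul 2
    obtain ⟨j, k⟩ := iB_int (S := s) (m := m2) (by rw [hm2]; fun_prop)
      (fun z => mul_nonneg (Real.exp_pos _).le (hmn z)) (by rw [e]; exact im2.integrableOn)
    rw [e] at k
    have k' : ∫ p : ℝ × ℝ, iB s p * m2 p.2 ≤ 2*J := by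
      rw [k, hJ, ← integral_const_mul]
      exact setIntegral_le_integral im2 (Eventually.of_forall fun z => mul_nonneg (by norm_num) (hmn z))
    have dom : ∀ p : ℝ × ℝ, ‖(AC s).indicator (fun p : ℝ × ℝ => kk a κ p * f p.1 * g p.2) p‖ ≤
        2*(1+2*K0)*b*cg*E1 * (iB s p * m2 p.2) := by
      rintro ⟨y, z⟩
      by_cases h : (y,z) ∈ AC s
      · rw [indicator_of_mem h, Real.norm_eq_abs]
        simp only
        have hzy : z < y := h.2
        have hys : y < s := h.1.1
        have hl : s < lam y z := lt_lam.2 h.1.2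
        have hh := half_lt hzy.le hl
        rw [abs_mul, abs_mul, abs_of_nonneg (hk.kk_nn _), kk_sym hk, iB_eq (mem_bd hzy.le hys.le hl)]
        calc _ ≤ (Real.exp (s-z) * ((1+2*K0) * Real.exp (-a*z))) * (b * (2*E1)) * (cg * Real.exp (-(3/4)*kU a z)) := by
              gcongr
              · exact hk.kk_nn _
              · exact kk_le1 hk hzy.le
              · exact (hb y hh hys.le).trans (mul_le_mul_of_nonneg_left (expE_half hρ hρ1 hh) hb0)
              · exact hg.le_U hρ z
          _ = _ := by rw [hm2, hm]; ring
      · rw [indicator_of_notMem h, norm_zero]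
        exact mul_nonneg (by positivity) (mul_nonneg (iB_nn _ _) (mul_nonneg (Real.exp_pos _).le (hmn _)))
    have main := norm_integral_le_of_norm_le (j.const_mul (2*(1+2*K0)*b*cg*E1)) (Eventually.of_forall dom)
    rw [Real.norm_eq_abs, integral_indicator (AC_meas s), integral_const_mul] at main
    calc _ ≤ _ := main
      _ ≤ 2*(1+2*K0)*b*cg*E1 * (2*J) := by gcongr
      _ ≤ 2*(1+2*K0)*b*cg*E1 * (2*J) + (J+1)*b*cg*E1 := by
        have : 0 ≤ (J+1)*b*cg*E1 := by positivity
        linarith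
      _ = _ := by ring
  · have := norm_integral_le_of_norm_le (im.const_mul cg) (Eventually.of_forall fun z =>
      (show ‖Real.exp (-a*z) * g z‖ ≤ cg * m z by
        rw [norm_mul, Real.norm_eq_abs, Real.norm_eq_abs, Real.abs_exp, hm]
        have := mul_le_mul_of_nonneg_left (hg.le_U hρ z) (Real.exp_pos (-a*z)).le
        linarith))
    rw [Real.norm_eq_abs, integral_const_mul] at this
    unfold l2
    have h0 : 0 ≤ (4*(1+2*K0)*J + 1)*cg := by positivity
    linarith

/-- pointwise bound for `HH` -/
theorem Hpt (hk : Ker a K0 δ κ) : ∃ C, 0 < C ∧ ∀ ρ L s cf cg : ℝ, ∀ f g : ℝ → ℝ, 0 < ρ → ρ ≤ 1 → 0 ≤ L →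
    L ≤ s → Cls a ρ L cf f → Cls a ρ L cg g →
    |HH a κ ρ f g s| ≤ (Real.exp (-a*L)/a + ρ * C) * cf * cg * Real.exp (-ρ*(s-L)) := by
  obtain ⟨C1, h1, H1⟩ := HA hk
  obtain ⟨C2, h2, H2⟩ := HC hk
  have ha := hk.ha
  refine ⟨C1 + C2 + C2, by positivity, ?_⟩
  intro ρ L s cf cg f g hρ hρ1 hL hLs hf hg
  have hcf := hf.nn
  have hcg := hg.nn
  have b1 := H1 ρ L s cf cg f g hρ hρ1 hLs hf hg
  obtain ⟨b2, b3⟩ := H2 ρ L s cf cf cg f g hρ hρ1 hf hg (fun y _ _ => hf.le_E ha hρ y)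
  have b4 := hf.le_E ha hρ s
  set E1 := Real.exp (-ρ*(s-L)) with hE1
  have hE1p : 0 < E1 := Real.exp_pos _
  have c1 : Real.exp (-a*s) ≤ Real.exp (-a*L) := Real.exp_le_exp.2 (by nlinarith)
  have c2 : Real.exp (-δ*s) ≤ 1 := Real.exp_le_one_iff.2 (by have := hk.hδ; nlinarith)
  have b1' : (Real.exp (-a*s)/a + ρ * C1 * Real.exp (-δ*s)) * cf * cg * E1 ≤ (Real.exp (-a*L)/a + ρ * C1 * 1) * cf * cg * E1 := by
    gcongr
  have b5 : |ρ * l2 a g * f s| ≤ ρ * (C2*cg) * (cf * E1) := by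
    rw [abs_mul, abs_mul, abs_of_pos hρ]; gcongr
  have b6 : |ρ * bil a κ (AC s) f g| ≤ ρ * (C2*cf*cg*E1) := by
    rw [abs_mul, abs_of_pos hρ]; gcongr
  have e : HH a κ ρ f g s = (ρ * bil a κ (AF s) f g - l2 a f * Gf ρ g s - ρ * bil a κ (AC s) f g)
      + ρ * bil a κ (AC s) f g - ρ * l2 a g * f s := by unfold HH; ring
  rw [e]
  have t1 := abs_sub ((ρ * bil a κ (AF s) f g - l2 a f * Gf ρ g s - ρ * bil a κ (AC s) f g)
      + ρ * bil a κ (AC s) f g) (ρ * l2 a g * f s)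
  have t2 := abs_add_le (ρ * bil a κ (AF s) f g - l2 a f * Gf ρ g s - ρ * bil a κ (AC s) f g)
      (ρ * bil a κ (AC s) f g)
  linarith

end

noncomputable def NR (a : ℝ) (κ : ℝ → ℝ) (ρ L : ℝ) (f g : ℝ → ℝ) (s : ℝ) : ℝ :=
  (1+ρ) * HH a κ ρ f g s - ρ * (1+ρ) * Real.exp (-ρ*(s-L)) * ∫ y in L..s, EE ρ L y * HH a κ ρ f g y

noncomputable def NN (a : ℝ) (κ : ℝ → ℝ) (ρ L : ℝ) (f g : ℝ → ℝ) (s : ℝ) : ℝ :=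
  if s < L then NL a κ ρ L f g s else NR a κ ρ L f g s

section
variable {a K0 δ : ℝ} {κ : ℝ → ℝ} {ρ L cf cg c1 c2 : ℝ} {f g f1 f2 : ℝ → ℝ}

theorem Gf_cont (hg : Integrable g) : Continuous (Gf ρ g) := by
  have h : ∀ s, ∫ z in Ioi s, g z = (∫ z in Ioi 0, g z) - ∫ z in (0:ℝ)..s, g z := by
    intro s
    have := intervalIntegral.integral_Ioi_sub_Ioi' (a := 0) (b := s) hg.integrableOn hg.integrableOn
    linarith
  have e : Gf ρ g = fun s => ρ * ((∫ z in Ioi 0, g z) - ∫ z in (0:ℝ)..s, g z) := by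
    ext s; unfold Gf; rw [h s]
  rw [e]
  exact continuous_const.mul (continuous_const.sub (intervalIntegral.continuous_primitive (fun _ _ => hg.intervalIntegrable) 0))

theorem HH_meas (hk : Ker a K0 δ κ) (hρ : 0 < ρ) (hf : Cls a ρ L cf f) (hg : Cls a ρ L cg g) :
    Measurable (HH a κ ρ f g) := by
  have h1 := (bilF_cont hk hρ hf hg).measurable
  have h2 := (Gf_cont (ρ := ρ) (hg.int hk.ha hρ)).measurable
  have h3 := hf.1
  unfold HH; fun_prop

theorem HH_ii (hk : Ker a K0 δ κ) (hρ : 0 < ρ) (hf : Cls a ρ L cf f) (hg : Cls a ρ L cg g) (b c : ℝ) :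
    IntervalIntegrable (fun y => EE ρ L y * HH a κ ρ f g y) volume b c := by
  have h1 := bilF_cont hk hρ hf hg
  have h2 := Gf_cont (ρ := ρ) (hg.int hk.ha hρ)
  have hE := EE_cont ρ L
  have i1 : IntervalIntegrable (fun y => EE ρ L y * (ρ * bil a κ (AF y) f g - l2 a f * Gf ρ g y)) volume b c :=
    (by fun_prop : Continuous _).intervalIntegrable _ _
  have i2 : IntervalIntegrable (fun y => (ρ * l2 a g * EE ρ L y) * f y) volume b c :=
    ((hf.int hk.ha hρ).intervalIntegrable).continuousOn_mul (by fun_prop)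
  refine (i1.sub i2).congr (fun y _ => ?_)
  simp only [HH, Pi.sub_apply]; ring

theorem l2_sub (ha : 0 < a) (hρ : 0 < ρ) (h1 : Cls a ρ L c1 f1) (h2 : Cls a ρ L c2 f2) :
    l2 a (fun s => f1 s - f2 s) = l2 a f1 - l2 a f2 := by
  unfold l2
  rw [← integral_sub (h1.int_full ha hρ (by linarith)) (h2.int_full ha hρ (by linarith))]
  congr 1; ext s; ring

theorem Gf_sub (ha : 0 < a) (hρ : 0 < ρ) (h1 : Cls a ρ L c1 f1) (h2 : Cls a ρ L c2 f2) (s : ℝ) :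
    Gf ρ (fun s => f1 s - f2 s) s = Gf ρ f1 s - Gf ρ f2 s := by
  unfold Gf
  rw [integral_sub (h1.int ha hρ).integrableOn (h2.int ha hρ).integrableOn]
  ring

theorem HH_subl (hk : Ker a K0 δ κ) (hρ : 0 < ρ) (h1 : Cls a ρ L c1 f1) (h2 : Cls a ρ L c2 f2) (hg : Cls a ρ L cg g) (s : ℝ) :
    HH a κ ρ (fun s => f1 s - f2 s) g s = HH a κ ρ f1 g s - HH a κ ρ f2 g s := by
  unfold HH
  rw [bil_sub_left hk hρ h1 h2 hg (AF_sub s), l2_sub hk.ha hρ h1 h2]; ring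

theorem HH_subr (hk : Ker a K0 δ κ) (hρ : 0 < ρ) (h1 : Cls a ρ L c1 f1) (h2 : Cls a ρ L c2 f2) (hg : Cls a ρ L cg g) (s : ℝ) :
    HH a κ ρ g (fun s => f1 s - f2 s) s = HH a κ ρ g f1 s - HH a κ ρ g f2 s := by
  unfold HH
  rw [bil_sub_right hk hρ h1 h2 hg (AF_sub s), l2_sub hk.ha hρ h1 h2, Gf_sub hk.ha hρ h1 h2]; ring

theorem rL_subl (hk : Ker a K0 δ κ) (hρ : 0 < ρ) (h1 : Cls a ρ L c1 f1) (h2 : Cls a ρ L c2 f2) (hg : Cls a ρ L cg g) (s : ℝ) :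
    rL a κ ρ L (fun s => f1 s - f2 s) g s = rL a κ ρ L f1 g s - rL a κ ρ L f2 g s := by
  unfold rL
  rw [bil_sub_left hk hρ h1 h2 hg (AP_sub s)]
  split_ifs <;> ring

theorem rL_subr (hk : Ker a K0 δ κ) (hρ : 0 < ρ) (h1 : Cls a ρ L c1 f1) (h2 : Cls a ρ L c2 f2) (hg : Cls a ρ L cg g) (s : ℝ) :
    rL a κ ρ L g (fun s => f1 s - f2 s) s = rL a κ ρ L g f1 s - rL a κ ρ L g f2 s := by
  unfold rL Qf
  rw [bil_sub_right hk hρ h1 h2 hg (AP_sub s), integral_sub (h1.int hk.ha hρ) (h2.int hk.ha hρ)]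
  have : ∫ z, κ (s-z) * (f1 z - f2 z) = (∫ z, κ (s-z) * f1 z) - ∫ z, κ (s-z) * f2 z := by
    rw [← integral_sub (Qint hk hρ h1 s) (Qint hk hρ h2 s)]
    congr 1; ext z; ring
  rw [this]
  split_ifs <;> ring

theorem NN_subl (hk : Ker a K0 δ κ) (hρ : 0 < ρ) (h1 : Cls a ρ L c1 f1) (h2 : Cls a ρ L c2 f2) (hg : Cls a ρ L cg g) (s : ℝ) :
    NN a κ ρ L (fun s => f1 s - f2 s) g s = NN a κ ρ L f1 g s - NN a κ ρ L f2 g s := by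
  unfold NN NL NR
  simp only [HH_subl hk hρ h1 h2 hg, rL_subl hk hρ h1 h2 hg, bil_sub_left hk hρ h1 h2 hg (AP_sub s), mul_sub]
  rw [intervalIntegral.integral_sub (rL_ii hk hρ h1 hg _ _) (rL_ii hk hρ h2 hg _ _),
    intervalIntegral.integral_sub (HH_ii hk hρ h1 hg _ _) (HH_ii hk hρ h2 hg _ _)]
  split_ifs <;> ring

theorem NN_subr (hk : Ker a K0 δ κ) (hρ : 0 < ρ) (h1 : Cls a ρ L c1 f1) (h2 : Cls a ρ L c2 f2) (hg : Cls a ρ L cg g) (s : ℝ) :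
    NN a κ ρ L g (fun s => f1 s - f2 s) s = NN a κ ρ L g f1 s - NN a κ ρ L g f2 s := by
  unfold NN NL NR
  simp only [HH_subr hk hρ h1 h2 hg, rL_subr hk hρ h1 h2 hg, bil_sub_right hk hρ h1 h2 hg (AP_sub s), mul_sub]
  rw [intervalIntegral.integral_sub (rL_ii hk hρ hg h1 _ _) (rL_ii hk hρ hg h2 _ _),
    intervalIntegral.integral_sub (HH_ii hk hρ hg h1 _ _) (HH_ii hk hρ hg h2 _ _)]
  split_ifs <;> ring

theorem NL_cont (hk : Ker a K0 δ κ) (hρ : 0 < ρ) (hf : Cls a ρ L cf f) (hg : Cls a ρ L cg g) :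
    Continuous (NL a κ ρ L f g) := by
  have h1 := bilP_cont hk hρ hf hg
  have h2 := kU_cont a
  have h3 : Continuous fun s => ∫ y in s..L, rL a κ ρ L f g y := by
    have : (fun s => ∫ y in s..L, rL a κ ρ L f g y) = fun s => -∫ y in L..s, rL a κ ρ L f g y := by
      ext s; exact intervalIntegral.integral_symm _ _
    rw [this]
    exact (intervalIntegral.continuous_primitive (rL_ii hk hρ hf hg) L).neg
  unfold NL; fun_prop

theorem NN_meas (hk : Ker a K0 δ κ) (hρ : 0 < ρ) (hf : Cls a ρ L cf f) (hg : Cls a ρ L cg g) :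
    Measurable (NN a κ ρ L f g) := by
  have h1 := (NL_cont hk hρ hf hg).measurable
  have h2 := HH_meas hk hρ hf hg
  have h3 := (intervalIntegral.continuous_primitive (HH_ii hk hρ hf hg) L).measurable
  unfold NN
  refine Measurable.ite measurableSet_Iio h1 ?_
  unfold NR; fun_prop

theorem expE_le (hu : kU a L ≤ 1/4) (ha : 0 < a) {s : ℝ} (hs : L ≤ s) :
    Real.exp (-ρ*(s-L)) ≤ 3/2 * kW a ρ L s := by
  rw [kW_right hs, ← mul_assoc]
  have h1 : Real.exp ((3/4)*kU a s) ≤ 3/2 := by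
    have h2 := (kU_anti ha hs).trans hu
    have h3 := Real.abs_exp_sub_one_le (x := (3/4)*kU a s) (by
      rw [abs_of_nonneg (by have := kU_pos ha s; positivity)]; linarith)
    rw [abs_of_nonneg (by have := kU_pos ha s; positivity : 0 ≤ (3/4)*kU a s)] at h3
    have := (abs_le.1 h3).2
    linarith
  have h4 : 1 ≤ 3/2 * Real.exp (-(3/4)*kU a s) := by
    rw [show -(3/4)*kU a s = -((3/4)*kU a s) by ring, Real.exp_neg, ← div_eq_mul_inv, le_div_iff₀ (Real.exp_pos _)]
    linarith
  nlinarith [Real.exp_pos (-ρ*(s-L))]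

theorem NN_bound (hk : Ker a K0 δ κ) (L : ℝ) (hL : 0 ≤ L) (hu : kU a L ≤ 1/4) : ∃ C, 0 < C ∧ ∀ ρ, 0 < ρ → ρ ≤ 1 →
    ∀ (cf cg : ℝ) (f g : ℝ → ℝ), Cls a ρ L cf f → Cls a ρ L cg g →
    Cls a ρ L ((4*kU a L + ρ*C)*cf*cg) (NN a κ ρ L f g) := by
  obtain ⟨C1, p1, H1⟩ := NL_bound hk L
  obtain ⟨C2, p2, H2⟩ := Hpt hk
  obtain ⟨C3, p3, H3⟩ := Hint hk
  have ha := hk.ha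
  have hδ := hk.hδ
  have uL := kU_pos ha L
  refine ⟨C1 + 4*C2 + 4*C3, by positivity, ?_⟩
  intro ρ hρ hρ1 cf cg f g hf hg
  have hcf := hf.nn
  have hcg := hg.nn
  refine ⟨NN_meas hk hρ hf hg, fun s => ?_⟩
  have hW := kW_pos a ρ L s
  unfold NN
  split_ifs with hs
  · have := H1 ρ hρ cf cg f g hf hg s hs
    rw [← kW_left (ρ := ρ) hs.le] at this
    refine this.trans ?_
    have h0 : 0 ≤ (4*kU a L + ρ * (4*C2+4*C3))*cf*cg*kW a ρ L s := by positivity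
    linarith
  · have hs' : L ≤ s := not_lt.1 hs
    have b1 := H2 ρ L s cf cg f g hρ hρ1 hL hs' hf hg
    have b2 := H3 ρ L L s cf cg f g hρ hρ1 hL le_rfl hs' hf hg
    rw [← intervalIntegral.integral_of_le hs'] at b2
    have x1 : Real.exp (-(δ/2)*L) ≤ 1 := Real.exp_le_one_iff.2 (by nlinarith)
    have b3 : |∫ y in L..s, EE ρ L y * HH a κ ρ f g y| ≤ C3*cf*cg := by
      refine b2.trans ?_
      have : 0 ≤ C3*cf*cg := by positivity
      nlinarith
    have hE := expE_le (ρ := ρ) hu ha hs'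
    set E1 := Real.exp (-ρ*(s-L)) with hE1
    have hE1p : 0 < E1 := Real.exp_pos _
    unfold NR
    have t1 : |(1+ρ) * HH a κ ρ f g s| ≤ (1+ρ) * ((kU a L + ρ*C2)*cf*cg*E1) := by
      rw [abs_mul, abs_of_pos (by linarith : 0 < 1+ρ)]
      gcongr
      exact b1
    have t2 : |ρ*(1+ρ)*E1*∫ y in L..s, EE ρ L y * HH a κ ρ f g y| ≤ ρ*(1+ρ)*E1*(C3*cf*cg) := by
      rw [abs_mul, abs_of_pos (by positivity : 0 < ρ*(1+ρ)*E1)]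
      gcongr
    calc _ ≤ _ := abs_sub _ _
      _ ≤ (1+ρ) * ((kU a L + ρ*C2)*cf*cg*E1) + ρ*(1+ρ)*E1*(C3*cf*cg) := add_le_add t1 t2
      _ = (1+ρ) * ((kU a L + ρ*C2 + ρ*C3)*cf*cg*E1) := by ring
      _ ≤ 2 * ((kU a L + ρ*C2 + ρ*C3)*cf*cg*(3/2*kW a ρ L s)) := by gcongr; linarith
      _ = 3 * ((kU a L + ρ*C2 + ρ*C3)*cf*cg*kW a ρ L s) := by ring
      _ ≤ 3 * ((kU a L + ρ*C2 + ρ*C3)*cf*cg*kW a ρ L s) + (kU a L + ρ*C1 + ρ*C2 + ρ*C3)*cf*cg*kW a ρ L s := by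
        have : 0 ≤ (kU a L + ρ*C1 + ρ*C2 + ρ*C3)*cf*cg*kW a ρ L s := by positivity
        linarith
      _ = _ := by ring

end

theorem banach {W : ℝ → ℝ} {P : (ℝ → ℝ) → Prop} {c : ℝ} {T : (ℝ → ℝ) → ℝ → ℝ}
    (hP : ∀ f, P f ↔ Measurable f ∧ ∀ s, |f s| ≤ c * W s) (h0 : P (fun _ => 0)) (hT : ∀ f, P f → P (T f))
    (hd : ∀ f f' d, P f → P f' → 0 ≤ d → (∀ s, |f s - f' s| ≤ d * W s) → ∀ s, |T f s - T f' s| ≤ d/2 * W s)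
    (hc : 0 ≤ c) :
    ∃ g, P g ∧ T g = g := by
  set F : ℕ → ℝ → ℝ := fun n => T^[n] (fun _ => 0) with hF
  have F1 : ∀ n, F (n+1) = T (F n) := fun n => by rw [hF]; exact Function.iterate_succ_apply' T n _
  have FP : ∀ n, P (F n) := by
    intro n
    induction n with
    | zero => exact h0
    | succ n ih => rw [F1]; exact hT _ ih
  have Fd : ∀ n s, |F n s - F (n+1) s| ≤ (c * (1/2)^n) * W s := by
    intro n
    induction n with
    | zero =>
      intro s
      have := ((hP _).1 (FP 1)).2 s
      simpa [hF, abs_sub_comm] using this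
    | succ n ih =>
      intro s
      rw [F1, F1 (n+1)]
      have := hd _ _ _ (FP n) (FP (n+1)) (by positivity) ih s
      rw [pow_succ]
      linarith
  have Fd' : ∀ s n, dist (F n s) (F (n+1) s) ≤ (c * W s) * (1/2)^n := by
    intro s n
    rw [Real.dist_eq]
    have := Fd n s
    linarith
  have hlim : ∀ s, ∃ x, Tendsto (fun n => F n s) atTop (nhds x) := fun s =>
    cauchySeq_tendsto_of_complete (cauchySeq_of_le_geometric (1/2) _ (by norm_num) (Fd' s))
  choose g hg using hlim
  have hgd : ∀ n s, |g s - F n s| ≤ (2 * c * (1/2)^n) * W s := by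
    intro n s
    have := dist_le_of_le_geometric_of_tendsto (1/2) _ (by norm_num) (Fd' s) (hg s) n
    rw [Real.dist_eq, abs_sub_comm] at this
    refine this.trans (le_of_eq ?_)
    ring
  have gP : P g := by
    refine (hP g).2 ⟨measurable_of_tendsto_metrizable (fun n => ((hP _).1 (FP n)).1) (tendsto_pi_nhds.2 hg), fun s => ?_⟩
    exact le_of_tendsto (hg s).abs (Eventually.of_forall fun n => ((hP _).1 (FP n)).2 s)
  refine ⟨g, gP, ?_⟩
  ext s
  have h1 : Tendsto (fun n => F (n+1) s) atTop (nhds (T g s)) := by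
    rw [tendsto_iff_dist_tendsto_zero]
    have hz : Tendsto (fun n : ℕ => (2 * c * (1/2)^n)/2 * W s) atTop (nhds 0) := by
      have := tendsto_pow_atTop_nhds_zero_of_lt_one (r := (1/2:ℝ)) (by norm_num) (by norm_num)
      have := (this.const_mul (c * W s))
      rw [mul_zero] at this
      refine this.congr fun n => by ring
    refine squeeze_zero (fun _ => dist_nonneg) (fun n => ?_) hz
    rw [Real.dist_eq, abs_sub_comm, F1]
    exact hd _ _ _ gP (FP n) (by positivity) (hgd n) s
  exact tendsto_nhds_unique h1 ((tendsto_add_atTop_iff_nat 1).2 (hg s))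

noncomputable def e1 (ρ : ℝ) (f : ℝ → ℝ) : ℝ := ρ * ∫ s, f s
noncomputable def phi1 (a L s : ℝ) : ℝ := if s < L then Real.exp (kU a L - kU a s) else 0
noncomputable def phi2 (ρ L s : ℝ) : ℝ := if s < L then 0 else Real.exp (-ρ*(s-L))

section
variable {a K0 δ : ℝ} {κ : ℝ → ℝ} {ρ L : ℝ}

theorem phi1_nn (s : ℝ) : 0 ≤ phi1 a L s := by unfold phi1; split_ifs <;> positivity
theorem phi2_nn (s : ℝ) : 0 ≤ phi2 ρ L s := by unfold phi2; split_ifs <;> positivity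

theorem phi1_cls (ha : 0 < a) (hu : kU a L ≤ 1/4) : Cls a ρ L (3/2) (phi1 a L) := by
  have := (kU_cont a).measurable
  refine ⟨Measurable.ite measurableSet_Iio (by fun_prop) measurable_const, fun s => ?_⟩
  rw [abs_of_nonneg (phi1_nn s)]
  unfold phi1
  split_ifs with h
  · have h1 := expE_le (ρ := ρ) hu ha (le_refl L)
    rw [kW_left le_rfl] at h1
    rw [kW_left h.le]
    have h2 := kU_anti ha h.le
    simp only [sub_self, mul_zero, Real.exp_zero] at h1
    calc Real.exp (kU a L - kU a s) ≤ 1 * Real.exp ((3/4)*kU a L + -(3/4)*kU a s) := by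
          rw [one_mul]; exact Real.exp_le_exp.2 (by linarith)
      _ ≤ (3/2 * Real.exp (-(3/4)*kU a L)) * Real.exp ((3/4)*kU a L + -(3/4)*kU a s) := by gcongr
      _ = _ := by rw [mul_assoc, ← Real.exp_add]; congr 2; ring
  · have := kW_pos a ρ L s; positivity

theorem phi2_cls (ha : 0 < a) (hu : kU a L ≤ 1/4) : Cls a ρ L (3/2) (phi2 ρ L) := by
  refine ⟨Measurable.ite measurableSet_Iio measurable_const (by fun_prop), fun s => ?_⟩
  rw [abs_of_nonneg (phi2_nn s)]
  unfold phi2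
  split_ifs with h
  · have := kW_pos a ρ L s; positivity
  · exact expE_le hu ha (not_lt.1 h)

theorem phi2_ind (ρ L : ℝ) : phi2 ρ L = (Ici L).indicator fun s => Real.exp (ρ*L) * Real.exp (-ρ*s) := by
  ext s; unfold phi2
  split_ifs with h
  · rw [indicator_of_notMem (show s ∉ Ici L from not_le.2 h)]
  · rw [indicator_of_mem (show s ∈ Ici L from not_lt.1 h), ← Real.exp_add]; congr 1; ring

theorem e1_phi2 (hρ : 0 < ρ) : e1 ρ (phi2 ρ L) = 1 := by
  unfold e1
  rw [phi2_ind, integral_indicator measurableSet_Ici, integral_Ici_eq_integral_Ioi, integral_const_mul,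
    integral_exp_mul_Ioi (neg_lt_zero.2 hρ), neg_div_neg_eq, ← mul_div_assoc, ← Real.exp_add,
    mul_div_cancel₀ _ hρ.ne']
  simp

theorem l2_phi2 (ha : 0 < a) (hρ : 0 < ρ) : 0 ≤ l2 a (phi2 ρ L) ∧ l2 a (phi2 ρ L) ≤ kU a L := by
  refine ⟨integral_nonneg fun s => mul_nonneg (Real.exp_pos _).le (phi2_nn s), ?_⟩
  have i1 : IntegrableOn (fun s => Real.exp (-a*s)) (Ici L) :=
    (integrableOn_Ici_iff_integrableOn_Ioi).2 (integrableOn_exp_mul_Ioi (neg_lt_zero.2 ha) L)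
  have e : kU a L = ∫ s, (Ici L).indicator (fun s => Real.exp (-a*s)) s := by
    rw [integral_indicator measurableSet_Ici, integral_Ici_eq_integral_Ioi,
      integral_exp_mul_Ioi (neg_lt_zero.2 ha), neg_div_neg_eq]; rfl
  rw [e]
  refine integral_mono_of_nonneg (Eventually.of_forall fun s => mul_nonneg (Real.exp_pos _).le (phi2_nn s))
    (i1.integrable_indicator measurableSet_Ici) (Eventually.of_forall fun s => ?_)
  simp only
  unfold phi2
  split_ifs with h
  · rw [mul_zero]; exact indicator_nonneg (fun _ _ => (Real.exp_pos _).le) _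
  · have hs : L ≤ s := not_lt.1 h
    rw [indicator_of_mem (show s ∈ Ici L from hs)]
    have : Real.exp (-ρ*(s-L)) ≤ 1 := Real.exp_le_one_iff.2 (by nlinarith)
    have := Real.exp_pos (-a*s)
    nlinarith

theorem kU_bot (ha : 0 < a) : Tendsto (kU a) atBot atTop := by
  unfold kU
  refine Tendsto.atTop_div_const ha (Real.tendsto_exp_atTop.comp ?_)
  exact tendsto_id.const_mul_atBot_of_neg (neg_lt_zero.2 ha)

theorem l2_phi1 (ha : 0 < a) : l2 a (phi1 a L) = 1 := by
  have e : (fun s => Real.exp (-a*s) * phi1 a L s) =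
      (Iio L).indicator fun s => Real.exp (kU a L) * (Real.exp (-a*s) * Real.exp (-1*kU a s)) := by
    ext s; unfold phi1
    split_ifs with h
    · rw [indicator_of_mem (show s ∈ Iio L from h), sub_eq_add_neg, Real.exp_add, neg_one_mul]; ring
    · rw [indicator_of_notMem (show s ∉ Iio L from h), mul_zero]
  unfold l2
  rw [e, integral_indicator measurableSet_Iio, ← integral_Iic_eq_integral_Iio]
  have hd : ∀ s, HasDerivAt (fun s => Real.exp (kU a L) * Real.exp (-1*kU a s)) (Real.exp (kU a L) * (Real.exp (-a*s) * Real.exp (-1*kU a s))) s := by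
    intro s
    have := (((kU_deriv ha s).const_mul (-1)).exp).const_mul (Real.exp (kU a L))
    exact this.congr_deriv (by ring)
  have hi : IntegrableOn (fun s => Real.exp (kU a L) * (Real.exp (-a*s) * Real.exp (-1*kU a s))) (Iic L) := by
    have := int_left ha (show (0:ℝ) < 1 by norm_num) (-a) (L+1)
    have h2 : IntegrableOn (fun s => Real.exp (-a*s) * Real.exp (-1*kU a s)) (Iic L) :=
      this.mono_set (fun s (hs : s ≤ L) => (by show s < L + 1; linarith))
    exact h2.const_mul _
  have ht : Tendsto (fun s => Real.exp (kU a L) * Real.exp (-1*kU a s)) atBot (nhds 0) := by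
    have h1 : Tendsto (fun s => -1*kU a s) atBot atBot := (kU_bot ha).const_mul_atTop_of_neg (by norm_num)
    have := (Real.tendsto_exp_atBot.comp h1).const_mul (Real.exp (kU a L))
    simpa using this
  rw [integral_Iic_of_hasDerivAt_of_tendsto' (fun s _ => hd s) hi ht, ← Real.exp_add]
  simp

theorem e1_phi1 : ∃ C, 0 < C ∧ ∀ ρ, 0 < ρ → 0 ≤ e1 ρ (phi1 a L) ∧ e1 ρ (phi1 a L) ≤ ρ*C := by
  have : 0 ≤ ∫ s, phi1 a L s := integral_nonneg phi1_nn
  refine ⟨(∫ s, phi1 a L s) + 1, by linarith, fun ρ hρ => ⟨mul_nonneg hρ.le this, ?_⟩⟩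
  unfold e1; nlinarith

end

set_option linter.unusedVariables false

noncomputable def cC (α β M n1 n2 : ℝ) : ℝ := (M - n2 - β*(1-n1))/(1-α*β)
noncomputable def cD (α β M n1 n2 : ℝ) : ℝ := 1 - n1 - α*cC α β M n1 n2

theorem cC_eq {α β τ : ℝ} (hτ : τ ≤ 1/1000) (hα : 0 ≤ α) (hα1 : α ≤ τ) (hβ : 0 ≤ β) (hβ1 : β ≤ τ) (M n1 n2 : ℝ) :
    cC α β M n1 n2 * (1-α*β) = M - n2 - β*(1-n1) := by
  have : α*β ≤ 1/1000*1 := mul_le_mul (by linarith) (by linarith) hβ (by norm_num)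
  unfold cC
  rw [div_mul_cancel₀]
  linarith

theorem cC_bd {α β τ M n1 n2 : ℝ} (hτ : τ ≤ 1/1000) (hα : 0 ≤ α) (hα1 : α ≤ τ) (hβ : 0 ≤ β) (hβ1 : β ≤ τ)
    (hM : |M - 1| ≤ τ) (h1 : |n1| ≤ 32*τ) (h2 : |n2| ≤ 16*τ) :
    |cC α β M n1 n2 - 1| ≤ 20*τ ∧ |cD α β M n1 n2 - 1| ≤ 34*τ := by
  have hτ0 : 0 ≤ τ := hα.trans hα1
  have e := cC_eq hτ hα hα1 hβ hβ1 M n1 n2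
  have w0 : 0 ≤ α*β := mul_nonneg hα hβ
  have w1 : α*β ≤ 1/1000*τ := mul_le_mul (by linarith) hβ1 hβ (by norm_num)
  have bn : |β*n1| ≤ 1/1000*(32*τ) := by
    rw [abs_mul, abs_of_nonneg hβ]; exact mul_le_mul (by linarith) h1 (abs_nonneg _) (by norm_num)
  rw [abs_le] at hM h1 h2 bn
  have hC : |cC α β M n1 n2 - 1| ≤ 20*τ := by
    set c := cC α β M n1 n2
    have e2 : (c-1)*(1-α*β) = M - 1 - n2 - β + β*n1 + α*β := by linear_combination e
    rw [abs_le]; constructor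
    · by_contra hh
      push Not at hh
      have : (c-1)*(1-α*β) ≤ (-(20*τ))*(1-α*β) := mul_le_mul_of_nonneg_right hh.le (by linarith)
      have : τ*(α*β) ≤ τ*(1/1000) := mul_le_mul_of_nonneg_left (by linarith) hτ0
      have : 0 ≤ τ*(α*β) := by positivity
      have : 0 < τ ∨ τ = 0 := by rcases hτ0.lt_or_eq with h | h; exacts [Or.inl h, Or.inr h.symm]
      rcases this with h | h
      · linarith
      · subst h; nlinarith
    · by_contra hh
      push Not at hh
      have : (20*τ)*(1-α*β) ≤ (c-1)*(1-α*β) := mul_le_mul_of_nonneg_right hh.le (by linarith)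
      have : τ*(α*β) ≤ τ*(1/1000) := mul_le_mul_of_nonneg_left (by linarith) hτ0
      have : 0 ≤ τ*(α*β) := by positivity
      have : 0 < τ ∨ τ = 0 := by rcases hτ0.lt_or_eq with h | h; exacts [Or.inl h, Or.inr h.symm]
      rcases this with h | h
      · linarith
      · subst h; nlinarith
  refine ⟨hC, ?_⟩
  have : |α * cC α β M n1 n2| ≤ τ * 2 := by
    rw [abs_mul, abs_of_nonneg hα]
    rw [abs_le] at hC
    refine mul_le_mul hα1 (abs_le.2 ⟨by linarith, by linarith⟩) (abs_nonneg _) hτ0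
  unfold cD
  rw [abs_le] at this ⊢
  constructor <;> linarith

theorem cC_df {α β τ M n1 n2 n1' n2' d : ℝ} (hτ : τ ≤ 1/1000) (hα : 0 ≤ α) (hα1 : α ≤ τ) (hβ : 0 ≤ β) (hβ1 : β ≤ τ)
    (hd : 0 ≤ d) (h1 : |n1-n1'| ≤ 16*τ*d) (h2 : |n2-n2'| ≤ 8*τ*d) :
    |cC α β M n1 n2 - cC α β M n1' n2'| ≤ 10*τ*d ∧ |cD α β M n1 n2 - cD α β M n1' n2'| ≤ 18*τ*d := by
  have hτ0 : 0 ≤ τ := hα.trans hα1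
  have e := cC_eq hτ hα hα1 hβ hβ1 M n1 n2
  have e' := cC_eq hτ hα hα1 hβ hβ1 M n1' n2'
  have w0 : 0 ≤ α*β := mul_nonneg hα hβ
  have w1 : α*β ≤ 1/1000*(1/1000) := mul_le_mul (by linarith) (by linarith) hβ (by norm_num)
  have hx : 0 ≤ τ*d := mul_nonneg hτ0 hd
  have bn : |β*(n1-n1')| ≤ 1/1000*(16*τ*d) := by
    rw [abs_mul, abs_of_nonneg hβ]; exact mul_le_mul (by linarith) h1 (abs_nonneg _) (by norm_num)
  have hC : |cC α β M n1 n2 - cC α β M n1' n2'| ≤ 10*τ*d := by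
    have e2 : (cC α β M n1 n2 - cC α β M n1' n2')*(1-α*β) = -(n2-n2') + β*(n1-n1') := by linear_combination e - e'
    have h3 := congrArg abs e2
    rw [abs_mul, abs_of_nonneg (show 0 ≤ 1-α*β by linarith)] at h3
    have h4 := abs_add_le (-(n2-n2')) (β*(n1-n1'))
    rw [abs_neg] at h4
    have h5 : |cC α β M n1 n2 - cC α β M n1' n2'| * (1 - 1/1000) ≤ |cC α β M n1 n2 - cC α β M n1' n2'| *(1-α*β) :=
      mul_le_mul_of_nonneg_left (by linarith) (abs_nonneg _)
    linarith
  refine ⟨hC, ?_⟩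
  have : |α * (cC α β M n1 n2 - cC α β M n1' n2')| ≤ 1/1000 * (10*τ*d) := by
    rw [abs_mul, abs_of_nonneg hα]
    exact mul_le_mul (by linarith) hC (abs_nonneg _) (by norm_num)
  unfold cD
  rw [abs_le] at this h1 ⊢
  constructor <;> linarith

section
variable {a K0 δ : ℝ} {κ : ℝ → ℝ} {ρ L : ℝ}

theorem Cls.comb {c1 c2 c3 x y : ℝ} {f1 f2 f3 : ℝ → ℝ} (h1 : Cls a ρ L c1 f1) (h2 : Cls a ρ L c2 f2) (h3 : Cls a ρ L c3 f3) :
    Cls a ρ L (|x| *c1+|y| *c2+c3) (fun s => x*f1 s + y*f2 s + f3 s) := by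
  refine ⟨((h1.1.const_mul x).add (h2.1.const_mul y)).add h3.1, fun s => ?_⟩
  have i1 := mul_le_mul_of_nonneg_left (h1.2 s) (abs_nonneg x)
  have i2 := mul_le_mul_of_nonneg_left (h2.2 s) (abs_nonneg y)
  have i3 := h3.2 s
  have := abs_add_three (x*f1 s) (y*f2 s) (f3 s)
  rw [abs_mul, abs_mul] at this
  linarith

theorem Cls.mono {c c' : ℝ} {f : ℝ → ℝ} (h : Cls a ρ L c f) (hc : c ≤ c') : Cls a ρ L c' f :=
  ⟨h.1, fun s => (h.2 s).trans (mul_le_mul_of_nonneg_right hc (kW_pos _ _ _ _).le)⟩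

theorem comb_e1 (ha : 0 < a) (hρ : 0 < ρ) {c1 c2 c3 x y : ℝ} {f1 f2 f3 : ℝ → ℝ} (h1 : Cls a ρ L c1 f1) (h2 : Cls a ρ L c2 f2) (h3 : Cls a ρ L c3 f3) :
    e1 ρ (fun s => x*f1 s + y*f2 s + f3 s) = x*e1 ρ f1 + y*e1 ρ f2 + e1 ρ f3 := by
  have i1 := (h1.int ha hρ).const_mul x
  have i2 := (h2.int ha hρ).const_mul y
  unfold e1
  have e : (∫ s, x*f1 s + y*f2 s + f3 s) = (∫ s, (x*f1 s + y*f2 s)) + ∫ s, f3 s := integral_add (i1.add i2) (h3.int ha hρ)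
  rw [e, integral_add i1 i2, integral_const_mul, integral_const_mul]; ring

theorem comb_l2 (ha : 0 < a) (hρ : 0 < ρ) {c1 c2 c3 x y : ℝ} {f1 f2 f3 : ℝ → ℝ} (h1 : Cls a ρ L c1 f1) (h2 : Cls a ρ L c2 f2) (h3 : Cls a ρ L c3 f3) :
    l2 a (fun s => x*f1 s + y*f2 s + f3 s) = x*l2 a f1 + y*l2 a f2 + l2 a f3 := by
  have hn : -a < 0 := by linarith
  have i1 := (h1.int_full ha hρ hn).const_mul x
  have i2 := (h2.int_full ha hρ hn).const_mul y
  have i3 := h3.int_full ha hρ hn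
  unfold l2
  have e0 : (fun s => Real.exp (-a*s) * (x*f1 s + y*f2 s + f3 s)) =
    fun s => (x*(Real.exp (-a*s)*f1 s) + y*(Real.exp (-a*s)*f2 s)) + Real.exp (-a*s)*f3 s := by ext s; ring
  have e := integral_add (i1.add i2) i3
  simp only [Pi.add_apply] at e
  rw [e0, e, integral_add i1 i2, integral_const_mul, integral_const_mul]

theorem fixpt (hk : Ker a K0 δ κ) (hu : kU a L ≤ 1/4) (hρ : 0 < ρ) {τ η J : ℝ} (hτ : τ ≤ 1/1000) 
    (hη0 : 0 ≤ η) (hη : η ≤ τ) (hηJ : J*η ≤ τ) (hα : e1 ρ (phi1 a L) ≤ τ) (hβ : kU a L ≤ τ) (hρτ : ρ ≤ τ)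
    (hN : ∀ cf cg f g, Cls a ρ L cf f → Cls a ρ L cg g → Cls a ρ L (η*cf*cg) (NN a κ ρ L f g))
    (hJ : ∀ c g, Cls a ρ L c g → |l2 a g| ≤ J*c) (he : ∀ c g, Cls a ρ L c g → |e1 ρ g| ≤ 2*c) :
    ∃ g C D, Cls a ρ L 4 g ∧ (∀ s, g s = C*phi1 a L s + D*phi2 ρ L s + NN a κ ρ L g g s) ∧
      e1 ρ g = 1 ∧ l2 a g = 1/(1+ρ) ∧ |C-1| ≤ 20*τ ∧ |D-1| ≤ 34*τ := by
  have ha := hk.ha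
  set α := e1 ρ (phi1 a L) with hαd
  set β := l2 a (phi2 ρ L) with hβd
  have hα0 : 0 ≤ α := mul_nonneg hρ.le (integral_nonneg phi1_nn)
  obtain ⟨hβ0, hβ1⟩ := l2_phi2 (L := L) ha hρ
  have hβ1 : β ≤ τ := hβ1.trans hβ
  have hM : |1/(1+ρ) - 1| ≤ τ := by
    have : 1/(1+ρ) - 1 = -(ρ/(1+ρ)) := by field_simp; ring
    rw [this, abs_neg, abs_of_pos (by positivity)]
    exact (div_le_self hρ.le (by linarith)).trans hρτ
  have p1 := phi1_cls (ρ := ρ) ha hu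
  have p2 := phi2_cls (ρ := ρ) ha hu
  have n1b : ∀ f, Cls a ρ L 4 f → |e1 ρ (NN a κ ρ L f f)| ≤ 32*τ := fun f hf => by
    have := he _ _ (hN _ _ _ _ hf hf); linarith
  have n2b : ∀ f, Cls a ρ L 4 f → |l2 a (NN a κ ρ L f f)| ≤ 16*τ := fun f hf => by
    have := hJ _ _ (hN _ _ _ _ hf hf)
    linarith
  set Cf : (ℝ → ℝ) → ℝ := fun f => cC α β (1/(1+ρ)) (e1 ρ (NN a κ ρ L f f)) (l2 a (NN a κ ρ L f f)) with hCf
  set Df : (ℝ → ℝ) → ℝ := fun f => cD α β (1/(1+ρ)) (e1 ρ (NN a κ ρ L f f)) (l2 a (NN a κ ρ L f f)) with hDf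
  have bd : ∀ f, Cls a ρ L 4 f → |Cf f - 1| ≤ 20*τ ∧ |Df f - 1| ≤ 34*τ := fun f hf =>
    cC_bd hτ hα0 hα hβ0 hβ1 hM (n1b f hf) (n2b f hf)
  set T : (ℝ → ℝ) → ℝ → ℝ := fun f s => Cf f*phi1 a L s + Df f*phi2 ρ L s + NN a κ ρ L f f s with hT
  obtain ⟨g, hg, hTg⟩ := banach (W := kW a ρ L) (P := Cls a ρ L 4) (c := 4) (T := T) (fun f => Iff.rfl)
    ⟨measurable_const, fun s => by rw [abs_zero]; have := kW_pos a ρ L s; positivity⟩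
    (fun f hf => by
      refine (Cls.comb p1 p2 (hN _ _ _ _ hf hf)).mono ?_
      obtain ⟨h1, h2⟩ := bd f hf
      have h1' : |Cf f| ≤ 1 + 20*τ := by
        have := abs_add_le (Cf f - 1) 1; rw [sub_add_cancel, abs_one] at this; linarith
      have h2' : |Df f| ≤ 1 + 34*τ := by
        have := abs_add_le (Df f - 1) 1; rw [sub_add_cancel, abs_one] at this; linarith
      linarith)
    (fun f f' d hf hf' hd hdd s => by
      have hs : Cls a ρ L d (fun s => f s - f' s) := ⟨hf.1.sub hf'.1, hdd⟩
      have q1 := hN _ _ _ _ hs hf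
      have q2 := hN _ _ _ _ hf' hs
      have eN : ∀ s, NN a κ ρ L f f s - NN a κ ρ L f' f' s =
          1*NN a κ ρ L (fun s => f s - f' s) f s + 0*(0:ℝ) + NN a κ ρ L f' (fun s => f s - f' s) s := fun s => by
        rw [NN_subl hk hρ hf hf' hf, NN_subr hk hρ hf hf' hf']; ring
      have z0 : Cls a ρ L 0 (fun _ => (0:ℝ)) := ⟨measurable_const, fun s => by simp⟩
      have qq : Cls a ρ L (8*η*d) (fun s => NN a κ ρ L f f s - NN a κ ρ L f' f' s) := by
        rw [show (fun s => NN a κ ρ L f f s - NN a κ ρ L f' f' s) = _ from funext eN]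
        refine (Cls.comb q1 z0 q2).mono (le_of_eq ?_)
        simp; ring
      have d1 : |e1 ρ (NN a κ ρ L f f) - e1 ρ (NN a κ ρ L f' f')| ≤ 16*τ*d := by
        have e : e1 ρ (NN a κ ρ L f f) - e1 ρ (NN a κ ρ L f' f') = e1 ρ (fun s => NN a κ ρ L f f s - NN a κ ρ L f' f' s) := by
          unfold e1
          rw [integral_sub ((hN _ _ _ _ hf hf).int ha hρ) ((hN _ _ _ _ hf' hf').int ha hρ)]; ring
        rw [e]
        refine (he _ _ qq).trans ?_
        have := mul_le_mul_of_nonneg_right hη hd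
        linarith
      have d2 : |l2 a (NN a κ ρ L f f) - l2 a (NN a κ ρ L f' f')| ≤ 8*τ*d := by
        rw [← l2_sub ha hρ (hN _ _ _ _ hf hf) (hN _ _ _ _ hf' hf')]
        refine (hJ _ _ qq).trans ?_
        have := mul_le_mul_of_nonneg_right hηJ hd
        linarith
      obtain ⟨f1, f2⟩ := cC_df (M := 1/(1+ρ)) hτ hα0 hα hβ0 hβ1 hd d1 d2
      have e3 : T f s - T f' s = (Cf f - Cf f')*phi1 a L s + (Df f - Df f')*phi2 ρ L s + (NN a κ ρ L f f s - NN a κ ρ L f' f' s) := by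
        simp only [hT]; ring
      rw [e3]
      refine ((Cls.comb p1 p2 qq).mono ?_).2 s
      have := mul_le_mul_of_nonneg_right hη hd
      have := mul_le_mul_of_nonneg_right hτ hd
      have f1' : |Cf f - Cf f'| ≤ 10*τ*d := f1
      have f2' : |Df f - Df f'| ≤ 18*τ*d := f2
      linarith)
    (by norm_num)
  have hgT : ∀ s, g s = Cf g*phi1 a L s + Df g*phi2 ρ L s + NN a κ ρ L g g s := fun s => (congrFun hTg s).symm
  have hgT' : g = fun s => Cf g*phi1 a L s + Df g*phi2 ρ L s + NN a κ ρ L g g s := funext hgT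
  have eC := cC_eq hτ hα0 hα hβ0 hβ1 (1/(1+ρ)) (e1 ρ (NN a κ ρ L g g)) (l2 a (NN a κ ρ L g g))
  refine ⟨g, Cf g, Df g, hg, hgT, ?_, ?_, (bd g hg).1, (bd g hg).2⟩
  · have := comb_e1 (x := Cf g) (y := Df g) ha hρ p1 p2 (hN _ _ _ _ hg hg)
    rw [← hgT', e1_phi2 hρ] at this
    rw [this]; simp only [hDf, hCf, cD]; ring
  · have := comb_l2 (x := Cf g) (y := Df g) ha hρ p1 p2 (hN _ _ _ _ hg hg)
    rw [← hgT', l2_phi1 ha] at this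
    rw [this]; simp only [hDf, hCf, cD] 
    linear_combination eC
end

section
variable {a K0 δ : ℝ} {κ : ℝ → ℝ} {ρ L cg C D : ℝ} {g : ℝ → ℝ}

theorem Q_cont (hk : Ker a K0 δ κ) (hρ : 0 < ρ) (hg : Cls a ρ L cg g) : Continuous (Qf κ ρ g) := by
  have ha := hk.ha
  have hm := hg.1
  have hκ := hk.cont.measurable
  rw [continuous_iff_continuousAt]
  intro y0
  have h1 := (hg.int ha hρ).norm
  have h2 := ((hg.int_full ha hρ (show -(1+a) < 0 by linarith)).norm.const_mul (Real.exp ((1+a)*(y0+1))))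
  unfold Qf
  refine ContinuousAt.mul continuousAt_const ?_
  refine continuousAt_of_dominated (bound := fun z => (1+2*K0) * (‖g z‖ + Real.exp ((1+a)*(y0+1)) * ‖Real.exp (-(1+a)*z) * g z‖))
    (Eventually.of_forall fun y => (by fun_prop : Measurable _).aestronglyMeasurable) ?_ ((h1.add h2).const_mul (1+2*K0)) ?_
  · filter_upwards [Iio_mem_nhds (show y0 < y0+1 by linarith)] with y hy
    refine Eventually.of_forall fun z => ?_
    have hy' : y < y0+1 := hy
    simp only [norm_mul, Real.norm_eq_abs, Real.abs_exp]
    rw [abs_of_nonneg (hk.nn _)]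
    have := hk.le (y-z)
    have hK := hk.hK0
    calc _ ≤ ((1 + 2*K0) * (1 + Real.exp ((1+a)*(y-z)))) * |g z| := by gcongr
      _ ≤ ((1 + 2*K0) * (1 + Real.exp ((1+a)*(y0+1-z)))) * |g z| := by gcongr
      _ = _ := by
        rw [show (1+a)*(y0+1-z) = (1+a)*(y0+1) + -(1+a)*z by ring, Real.exp_add]; ring
  · refine Eventually.of_forall fun z => ?_
    have := hk.cont
    exact (by fun_prop : Continuous fun y => κ (y-z) * g z).continuousAt

noncomputable def vL (a : ℝ) (κ : ℝ → ℝ) (ρ L C : ℝ) (g : ℝ → ℝ) (s : ℝ) : ℝ :=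
  Real.exp (-kU a s) * (C * Real.exp (kU a L) - ∫ y in s..L, rL a κ ρ L g g y)

noncomputable def vR (a : ℝ) (κ : ℝ → ℝ) (ρ L D : ℝ) (g : ℝ → ℝ) (s : ℝ) : ℝ :=
  Real.exp (-ρ*(s-L)) * (D - ρ*(1+ρ)*∫ y in L..s, EE ρ L y * HH a κ ρ g g y)

theorem vL_L : vL a κ ρ L C g L = C := by
  unfold vL
  rw [intervalIntegral.integral_same, sub_zero, mul_left_comm, ← Real.exp_add]; simp

theorem vL_eq (hgT : ∀ s, g s = C*phi1 a L s + D*phi2 ρ L s + NN a κ ρ L g g s) {s : ℝ} (hs : s < L) :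
    vL a κ ρ L C g s = g s + ρ * bil a κ (AP s) g g := by
  have := hgT s
  unfold phi1 phi2 NN NL at this
  rw [if_pos hs, if_pos hs, if_pos hs, sub_eq_add_neg (kU a L), Real.exp_add] at this
  unfold vL
  linear_combination -this

theorem vR_eq (hgT : ∀ s, g s = C*phi1 a L s + D*phi2 ρ L s + NN a κ ρ L g g s) {s : ℝ} (hs : L ≤ s) :
    vR a κ ρ L D g s = g s - (1+ρ)*HH a κ ρ g g s := by
  have := hgT s
  unfold phi1 phi2 NN NR at this
  rw [if_neg (not_lt.2 hs), if_neg (not_lt.2 hs), if_neg (not_lt.2 hs)] at this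
  unfold vR
  linear_combination -this

theorem vL_cont (hk : Ker a K0 δ κ) (hρ : 0 < ρ) (hg : Cls a ρ L cg g) : Continuous (vL a κ ρ L C g) := by
  have h1 := intervalIntegral.continuous_primitive (rL_ii hk hρ hg hg) L
  have h2 := kU_cont a
  have e : vL a κ ρ L C g = fun s => Real.exp (-kU a s) * (C * Real.exp (kU a L) + ∫ y in L..s, rL a κ ρ L g g y) := by
    ext s; unfold vL; rw [intervalIntegral.integral_symm s L]; ring
  rw [e]; fun_prop

theorem vR_cont (hk : Ker a K0 δ κ) (hρ : 0 < ρ) (hg : Cls a ρ L cg g) : Continuous (vR a κ ρ L D g) := by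
  have h1 := intervalIntegral.continuous_primitive (HH_ii hk hρ hg hg) L
  unfold vR; fun_prop

theorem vL_deriv (hk : Ker a K0 δ κ) (hρ : 0 < ρ) (hg : Cls a ρ L cg g) 
    (hgT : ∀ s, g s = C*phi1 a L s + D*phi2 ρ L s + NN a κ ρ L g g s) (he : e1 ρ g = 1) {s : ℝ} (hs : s < L) :
    HasDerivAt (vL a κ ρ L C g) (Real.exp (-a*s) * Qf κ ρ g s * g s) s := by
  have hP := bilP_cont hk hρ hg hg
  have hv := vL_cont (C := C) hk hρ hg
  have hQ := Q_cont hk hρ hg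
  have hU := kU_cont a
  have gc : ContinuousAt g s := by
    have : (fun s => vL a κ ρ L C g s - ρ * bil a κ (AP s) g g) =ᶠ[nhds s] g := by
      filter_upwards [Iio_mem_nhds hs] with y hy
      rw [vL_eq hgT hy]; ring
    exact ContinuousAt.congr (by fun_prop) this
  have rc : ContinuousAt (rL a κ ρ L g g) s := by
    have : (fun y => Real.exp (kU a y - a*y) * ((Qf κ ρ g y - ρ * ∫ z, g z) * g y - ρ * bil a κ (AP y) g g)) =ᶠ[nhds s] rL a κ ρ L g g := by
      filter_upwards [Iio_mem_nhds hs] with y hy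
      unfold rL; rw [if_pos (show y < L from hy)]
    have hP' := hP.continuousAt (x := s)
    have hQ' := hQ.continuousAt (x := s)
    have hU' := hU.continuousAt (x := s)
    exact ContinuousAt.congr (by fun_prop) this
  have d1 := intervalIntegral.integral_hasDerivAt_left (rL_ii hk hρ hg hg s L)
    ((rL_meas hk hρ hg hg).stronglyMeasurable.stronglyMeasurableAtFilter) rc
  have d2 := ((kU_deriv hk.ha s).neg.exp).mul (d1.const_sub (C * Real.exp (kU a L)))
  refine d2.congr_deriv ?_
  have e := vL_eq hgT hs
  unfold vL at e
  have er : rL a κ ρ L g g s = Real.exp (kU a s) * (Real.exp (-a*s) * ((Qf κ ρ g s - ρ * ∫ z, g z) * g s - ρ * bil a κ (AP s) g g)) := by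
    unfold rL; rw [if_pos hs, ← mul_assoc, ← Real.exp_add]; congr 3; ring
  rw [er]
  unfold e1 at he
  rw [he]
  have ee : Real.exp (-kU a s) * Real.exp (kU a s) = 1 := by rw [← Real.exp_add]; simp
  simp only [Pi.neg_apply]
  linear_combination (Real.exp (-a*s)) * e + Real.exp (-a*s) * ((Qf κ ρ g s - 1) * g s - ρ * bil a κ (AP s) g g) * ee

theorem decay (hρ : 0 < ρ) : Tendsto (fun s => Real.exp (-ρ*(s-L))) atTop (nhds 0) := by
  refine Real.tendsto_exp_atBot.comp ?_
  exact (tendsto_atTop_add_const_right _ (-L) tendsto_id).const_mul_atTop_of_neg (neg_lt_zero.2 hρ)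

theorem uDecay (ha : 0 < a) {c : ℝ} (hc : c < 0) : Tendsto (fun s => Real.exp (c*kU a s)) atBot (nhds 0) :=
  Real.tendsto_exp_atBot.comp ((kU_bot ha).const_mul_atTop_of_neg hc)

theorem sol_left (hk : Ker a K0 δ κ) (hρ : 0 < ρ) (hg : Cls a ρ L cg g) 
    (hgT : ∀ s, g s = C*phi1 a L s + D*phi2 ρ L s + NN a κ ρ L g g s) (he : e1 ρ g = 1) {s : ℝ} (hs : s < L) :
    g s = ρ * bil a κ (AF s) g g := by
  have ha := hk.ha
  obtain ⟨C1, p1, H1⟩ := Q_bound hk L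
  obtain ⟨C2, p2, H2⟩ := P_bound hk L
  have hi : IntegrableOn (fun y => Real.exp (-a*y) * Qf κ ρ g y * g y) (Iic s) := by
    have h1 : IntegrableOn (fun y => Real.exp (-a*y) * g y) (Iic s) :=
      (hg.int_left ha hρ (-a) L).mono_set (fun y (hy : y ≤ s) => (by show y < L; linarith))
    have hQ := Q_meas (ρ := ρ) hk hg.1
    have hm := hg.1
    refine (h1.norm.const_mul (1+ρ*C1*cg)).mono' (by fun_prop : Measurable _).aestronglyMeasurable ?_
    filter_upwards [ae_restrict_mem measurableSet_Iic] with y hy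
    have hy' : y ≤ L := (show y ≤ s from hy).trans hs.le
    have := H1 ρ hρ cg g hg y hy'
    unfold e1 at he
    rw [he] at this
    have q : |Qf κ ρ g y| ≤ 1 + ρ*C1*cg := by
      have := abs_add_le (Qf κ ρ g y - 1) 1; rw [sub_add_cancel, abs_one] at this; linarith
    rw [Real.norm_eq_abs, Real.norm_eq_abs, show Real.exp (-a*y) * Qf κ ρ g y * g y = Qf κ ρ g y * (Real.exp (-a*y) * g y) by ring, abs_mul]
    gcongr
  have ht : Tendsto (vL a κ ρ L C g) atBot (nhds 0) := by
    have l1 : Tendsto (fun s => cg * Real.exp (-(3/4)*kU a s) + ρ * (C2*cg*cg*Real.exp (-(5/4)*kU a s))) atBot (nhds 0) := by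
      have := ((uDecay ha (show -(3/4:ℝ) < 0 by norm_num)).const_mul cg).add
        (((uDecay ha (show -(5/4:ℝ) < 0 by norm_num)).const_mul (C2*cg*cg)).const_mul ρ)
      simpa using this
    refine squeeze_zero_norm' ?_ l1
    filter_upwards [Iio_mem_atBot L] with y hy
    have hy' : y < L := hy
    rw [vL_eq hgT hy', Real.norm_eq_abs]
    refine (abs_add_le _ _).trans (add_le_add (hg.le_U hρ y) ?_)
    rw [abs_mul, abs_of_pos hρ]
    exact mul_le_mul_of_nonneg_left (H2 ρ hρ _ _ _ _ hg hg y hy'.le) hρ.le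
  have key := integral_Iic_of_hasDerivAt_of_tendsto' (fun y (hy : y ≤ s) => vL_deriv hk hρ hg hgT he (lt_of_le_of_lt hy hs)) hi ht
  rw [sub_zero, vL_eq hgT hs, integral_Iic_eq_integral_Iio] at key
  have e1 := bil_total_iter hk hρ hg hg s
  have e2 := bil_total hk hρ hg hg s
  have e3 : ∫ y in Iio s, Real.exp (-a*y) * Qf κ ρ g y * g y = ρ * bil a κ (AT s) g g := by
    rw [e1, ← integral_const_mul]
    congr 1; ext y; unfold Qf; ring
  rw [e3, e2] at key
  linarith

theorem sol_right (hk : Ker a K0 δ κ) (hρ : 0 < ρ) (hρ1 : ρ ≤ 1) (hL : 0 ≤ L) (hg : Cls a ρ L cg g) 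
    (hgT : ∀ s, g s = C*phi1 a L s + D*phi2 ρ L s + NN a κ ρ L g g s) (hl : l2 a g = 1/(1+ρ)) {s : ℝ} (hs : L ≤ s) :
    g s = ρ * bil a κ (AF s) g g ∧ vR a κ ρ L D g s = Gf ρ g s := by
  have ha := hk.ha
  have hv := vR_cont (D := D) hk hρ hg
  have hF := bilF_cont hk hρ hg hg
  have hG := Gf_cont (ρ := ρ) (hg.int ha hρ)
  have r0 : (1+ρ) ≠ 0 := by linarith
  have gf : ∀ y, L ≤ y → g y = (vR a κ ρ L D g y + (1+ρ)*(ρ * bil a κ (AF y) g g) - Gf ρ g y)/(1+ρ) := by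
    intro y hy
    have := vR_eq hgT hy
    rw [this, eq_div_iff r0]
    unfold HH; rw [hl]; field_simp; ring
  have hd : ∀ y ∈ Ioi s, HasDerivAt (vR a κ ρ L D g) (-ρ*g y) y := by
    intro y hy
    have hy' : L < y := lt_of_le_of_lt hs hy
    have gc : ContinuousAt g y := by
      have : (fun y => (vR a κ ρ L D g y + (1+ρ)*(ρ * bil a κ (AF y) g g) - Gf ρ g y)/(1+ρ)) =ᶠ[nhds y] g := by
        filter_upwards [Ioi_mem_nhds hy'] with z hz
        rw [← gf z (le_of_lt hz)]
      exact ContinuousAt.congr (by fun_prop) this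
    have hc : ContinuousAt (fun y => EE ρ L y * HH a κ ρ g g y) y := by
      have h1 := (EE_cont ρ L).continuousAt (x := y)
      have h2 := hF.continuousAt (x := y)
      have h3 := hG.continuousAt (x := y)
      unfold HH; fun_prop
    have d1 := intervalIntegral.integral_hasDerivAt_right (HH_ii hk hρ hg hg L y)
      (((EE_cont ρ L).measurable.mul (HH_meas hk hρ hg hg)).stronglyMeasurable.stronglyMeasurableAtFilter) hc
    have d0 : HasDerivAt (fun y => -ρ*(y-L)) (-ρ*1) y := ((hasDerivAt_id y).sub_const L).const_mul (-ρ)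
    have d2 := d0.exp.mul ((d1.const_mul (ρ*(1+ρ))).const_sub D)
    refine d2.congr_deriv ?_
    have e := vR_eq hgT hy'.le
    unfold vR at e
    have ei := EE_inv ρ L y
    linear_combination (-ρ) * e - ρ*(1+ρ)*HH a κ ρ g g y * ei
  obtain ⟨C1, p1, H1⟩ := Hpt hk
  have ht : Tendsto (vR a κ ρ L D g) atTop (nhds 0) := by
    have l1 : Tendsto (fun s => (cg + (1+ρ)*((Real.exp (-a*L)/a + ρ * C1) * cg * cg)) * Real.exp (-ρ*(s-L))) atTop (nhds 0) := by
      simpa using (decay (L := L) hρ).const_mul (cg + (1+ρ)*((Real.exp (-a*L)/a + ρ * C1) * cg * cg))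
    refine squeeze_zero_norm' ?_ l1
    filter_upwards [Ici_mem_atTop L] with y hy
    rw [vR_eq hgT hy, Real.norm_eq_abs]
    refine (abs_sub _ _).trans ?_
    have h1 := hg.le_E ha hρ y
    have h2 := H1 ρ L y cg cg g g hρ hρ1 hL hy hg hg
    rw [abs_mul, abs_of_pos (show 0 < 1+ρ by linarith)]
    have := mul_le_mul_of_nonneg_left h2 (show 0 ≤ 1+ρ by linarith)
    linarith
  have key := integral_Ioi_of_hasDerivAt_of_tendsto hv.continuousWithinAt hd ((hg.int ha hρ).const_mul (-ρ)).integrableOn ht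
  rw [integral_const_mul] at key
  have k2 : vR a κ ρ L D g s = Gf ρ g s := by unfold Gf; linarith
  refine ⟨?_, k2⟩
  have := gf s hs
  rw [k2] at this
  rw [this]; field_simp; ring

theorem sol_cont (hk : Ker a K0 δ κ) (hρ : 0 < ρ) (hg : Cls a ρ L cg g) (h : ∀ s, g s = ρ * bil a κ (AF s) g g) : Continuous g := by
  have hF := bilF_cont hk hρ hg hg
  rw [show g = fun s => ρ * bil a κ (AF s) g g from funext h]
  fun_prop
end

noncomputable def psi (a : ℝ) (κ : ℝ → ℝ) (ρ L : ℝ) (g : ℝ → ℝ) (s : ℝ) : ℝ := ∫ y in s..L, Real.exp (-a*y) * Qf κ ρ g y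

section
variable {a K0 δ : ℝ} {κ : ℝ → ℝ} {ρ L cg C D : ℝ} {g : ℝ → ℝ}

theorem psi_deriv (hk : Ker a K0 δ κ) (hρ : 0 < ρ) (hg : Cls a ρ L cg g) (s : ℝ) :
    HasDerivAt (psi a κ ρ L g) (-(Real.exp (-a*s) * Qf κ ρ g s)) s := by
  have hQ := Q_cont hk hρ hg
  have hc : Continuous (fun y => Real.exp (-a*y) * Qf κ ρ g y) := by fun_prop
  exact intervalIntegral.integral_hasDerivAt_left (hc.intervalIntegrable _ _)
    hc.stronglyMeasurable.stronglyMeasurableAtFilter hc.continuousAt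

theorem psi_bd (hk : Ker a K0 δ κ) (hρ : 0 < ρ) (hg : Cls a ρ L cg g) (hQb : ∀ y ≤ L, |Qf κ ρ g y - 1| ≤ 1/8)
    {s : ℝ} (hs : s ≤ L) : 7/8*(kU a s - kU a L) ≤ psi a κ ρ L g s ∧ psi a κ ρ L g s ≤ 9/8*(kU a s - kU a L) := by
  have ha := hk.ha
  have hQ := Q_cont hk hρ hg
  have hc : Continuous (fun y => Real.exp (-a*y) * Qf κ ρ g y) := by fun_prop
  have he : Continuous (fun y => Real.exp (-a*y)) := by fun_prop
  have e : ∫ y in s..L, Real.exp (-a*y) = kU a s - kU a L := by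
    have := intervalIntegral.integral_eq_sub_of_hasDerivAt (fun y _ => (kU_deriv ha y).neg) (he.neg.neg.intervalIntegrable s L)
    simp only [neg_neg, Pi.neg_apply] at this
    rw [this]; ring
  unfold psi
  rw [← e, ← intervalIntegral.integral_const_mul, ← intervalIntegral.integral_const_mul]
  constructor
  · refine intervalIntegral.integral_mono_on hs ((he.const_mul _).intervalIntegrable _ _) (hc.intervalIntegrable _ _) fun y hy => ?_
    have := abs_le.1 (hQb y hy.2)
    rw [mul_comm]
    exact mul_le_mul_of_nonneg_left (by linarith) (Real.exp_pos _).le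
  · refine intervalIntegral.integral_mono_on hs (hc.intervalIntegrable _ _) ((he.const_mul _).intervalIntegrable _ _) fun y hy => ?_
    have := abs_le.1 (hQb y hy.2)
    rw [mul_comm (9/8:ℝ)]
    exact mul_le_mul_of_nonneg_left (by linarith) (Real.exp_pos _).le

theorem left_bd (hk : Ker a K0 δ κ) (hρ : 0 < ρ) (hg : Cls a ρ L cg g) 
    (hgT : ∀ s, g s = C*phi1 a L s + D*phi2 ρ L s + NN a κ ρ L g g s) (he : e1 ρ g = 1)
    (hQb : ∀ y ≤ L, |Qf κ ρ g y - 1| ≤ 1/8) {B : ℝ} (hP : ∀ s ≤ L, |ρ * bil a κ (AP s) g g| ≤ B * Real.exp (-(5/4)*kU a s))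
    {s : ℝ} (hs : s < L) : |g s * Real.exp (psi a κ ρ L g s) - C| ≤ 10*B := by
  have ha := hk.ha
  have hB : 0 ≤ B := by
    have := (abs_nonneg _).trans (hP L le_rfl)
    exact nonneg_of_mul_nonneg_left this (Real.exp_pos _)
  have hPe : ∀ y ≤ L, |ρ * bil a κ (AP y) g g * Real.exp (psi a κ ρ L g y)| ≤ B * Real.exp (-(1/8)*kU a y) := by
    intro y hy
    rw [abs_mul, Real.abs_exp]
    have h1 := (psi_bd hk hρ hg hQb hy).2
    have h2 := kU_pos ha L
    calc _ ≤ B * Real.exp (-(5/4)*kU a y) * Real.exp (9/8*kU a y) :=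
          mul_le_mul (hP y hy) (Real.exp_le_exp.2 (by linarith)) (Real.exp_pos _).le (by positivity)
      _ = _ := by rw [mul_assoc, ← Real.exp_add]; congr 2; ring
  have dw : ∀ y < L, HasDerivAt (fun y => vL a κ ρ L C g y * Real.exp (psi a κ ρ L g y))
      (-(Real.exp (-a*y) * Qf κ ρ g y * (ρ * bil a κ (AP y) g g * Real.exp (psi a κ ρ L g y)))) y := by
    intro y hy
    have := (vL_deriv hk hρ hg hgT he hy).mul (psi_deriv hk hρ hg y).exp
    refine this.congr_deriv ?_
    rw [vL_eq hgT hy]; ring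
  have db : ∀ y, HasDerivAt (fun y => 9*B*Real.exp (-(1/8)*kU a y)) (9*B*(Real.exp (-(1/8)*kU a y) * (1/8*Real.exp (-a*y)))) y := by
    intro y
    exact (((kU_deriv ha y).const_mul (-(1/8:ℝ))).exp.const_mul (9*B)).congr_deriv (by ring)
  have hb : ∀ y < L, |-(Real.exp (-a*y) * Qf κ ρ g y * (ρ * bil a κ (AP y) g g * Real.exp (psi a κ ρ L g y)))| ≤
      9*B*(Real.exp (-(1/8)*kU a y) * (1/8*Real.exp (-a*y))) := by
    intro y hy
    rw [abs_neg, abs_mul, abs_mul, Real.abs_exp]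
    have h1 : |Qf κ ρ g y| ≤ 9/8 := by
      have := abs_le.1 (hQb y hy.le); rw [abs_le]; constructor <;> linarith
    calc _ ≤ Real.exp (-a*y) * (9/8) * (B * Real.exp (-(1/8)*kU a y)) := by
          have := hPe y hy.le; gcongr
      _ = _ := by ring
  have cw : Continuous (fun y => vL a κ ρ L C g y * Real.exp (psi a κ ρ L g y)) := by
    have h1 := vL_cont (C := C) hk hρ hg
    have h2 : Continuous (psi a κ ρ L g) := continuous_iff_continuousAt.2 fun y => (psi_deriv hk hρ hg y).continuousAt
    fun_prop
  have cb : Continuous (fun y => 9*B*Real.exp (-(1/8)*kU a y)) := by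
    have := kU_cont a; fun_prop
  have m1 : MonotoneOn (fun y => 9*B*Real.exp (-(1/8)*kU a y) + vL a κ ρ L C g y * Real.exp (psi a κ ρ L g y)) (Icc s L) := by
    refine monotoneOn_of_deriv_nonneg (convex_Icc _ _) (cb.add cw).continuousOn ?_ ?_ <;> rw [interior_Icc]
    · exact fun y hy => ((db y).add (dw y hy.2)).differentiableAt.differentiableWithinAt
    · intro y hy
      refine le_of_le_of_eq ?_ ((db y).add (dw y hy.2)).deriv.symm
      have := abs_le.1 (hb y hy.2); linarith
  have m2 : MonotoneOn (fun y => 9*B*Real.exp (-(1/8)*kU a y) - vL a κ ρ L C g y * Real.exp (psi a κ ρ L g y)) (Icc s L) := by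
    refine monotoneOn_of_deriv_nonneg (convex_Icc _ _) (cb.sub cw).continuousOn ?_ ?_ <;> rw [interior_Icc]
    · exact fun y hy => ((db y).sub (dw y hy.2)).differentiableAt.differentiableWithinAt
    · intro y hy
      refine le_of_le_of_eq ?_ ((db y).sub (dw y hy.2)).deriv.symm
      have := abs_le.1 (hb y hy.2); linarith
  have k1 := m1 (left_mem_Icc.2 hs.le) (right_mem_Icc.2 hs.le) hs.le
  have k2 := m2 (left_mem_Icc.2 hs.le) (right_mem_Icc.2 hs.le) hs.le
  have pL : psi a κ ρ L g L = 0 := by unfold psi; exact intervalIntegral.integral_same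
  simp only [vL_L, pL, Real.exp_zero, mul_one, vL_eq hgT hs] at k1 k2
  have hp := abs_le.1 (hPe s hs.le)
  have e1 : Real.exp (-(1/8)*kU a s) ≤ 1 := Real.exp_le_one_iff.2 (by have := kU_pos ha s; linarith)
  have e2 : Real.exp (-(1/8)*kU a L) ≤ 1 := Real.exp_le_one_iff.2 (by have := kU_pos ha L; linarith)
  have e3 := Real.exp_pos (-(1/8)*kU a s)
  have f1 := mul_le_mul_of_nonneg_left e1 hB
  have f2 := mul_le_mul_of_nonneg_left e2 hB
  have f3 := mul_nonneg hB e3.le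
  rw [abs_le]
  constructor <;> nlinarith

theorem right_bd (ha : 0 < a) (hρ : 0 < ρ) (hgT : ∀ s, g s = C*phi1 a L s + D*phi2 ρ L s + NN a κ ρ L g g s) {b : ℝ}
    (hN : Cls a ρ L b (NN a κ ρ L g g)) {s : ℝ} (hs : L ≤ s) :
    |g s - D * Real.exp (-ρ*(s-L))| ≤ b * Real.exp (-ρ*(s-L)) := by
  have := hgT s
  unfold phi1 phi2 at this
  rw [if_neg (not_lt.2 hs), if_neg (not_lt.2 hs)] at this
  have h2 := hN.le_E ha hρ s
  rw [show g s - D * Real.exp (-ρ*(s-L)) = NN a κ ρ L g g s by linarith]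
  exact h2
end

section
variable {a K0 δ : ℝ} {κ : ℝ → ℝ} {ρ L cg C D : ℝ} {g : ℝ → ℝ}

set_option maxHeartbeats 1000000 in
theorem ACz (hk : Ker a K0 δ κ) (hρ : 0 < ρ) (hρ1 : ρ ≤ 1) {s : ℝ} (hs : L + Real.log 2 ≤ s) (z : ℝ) :
    |EE ρ L s * (∫ y, (AC s).indicator (fun p : ℝ × ℝ => kk a κ p * phi2 ρ L p.1) (y,z)) - Real.exp (-a*z)| ≤
      (4*K0+2) * (Real.exp (δ*(z-s)) * Real.exp (-a*z)) := by
  obtain ⟨ha, hK, hδ, hδ1, hδa, -⟩ := id hk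
  have hl2 := Real.log_pos (show (1:ℝ) < 2 by norm_num)
  have hE := EE_pos ρ L s
  rcases le_or_gt s z with hz | hz
  · have : ∀ y, (AC s).indicator (fun p : ℝ × ℝ => kk a κ p * phi2 ρ L p.1) (y,z) = 0 := by
      intro y
      refine indicator_of_notMem (fun h => ?_) _
      have h1 : z < y := h.2
      have h2 : y < s := h.1.1
      linarith
    simp only [this, integral_zero, mul_zero, zero_sub, abs_neg, Real.abs_exp]
    have h1 : 1 ≤ Real.exp (δ*(z-s)) := Real.one_le_exp (by nlinarith)
    have h2 := Real.exp_pos (-a*z)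
    nlinarith [mul_le_mul_of_nonneg_right h1 h2.le]
  · have hr : Real.exp (z-s) < 1 := by rw [← Real.exp_zero]; exact Real.exp_lt_exp.2 (by linarith)
    set b := s + Real.log (1 - Real.exp (z-s)) with hb
    have eb : Real.exp b = Real.exp s - Real.exp z := by
      rw [hb, Real.exp_add, Real.exp_log (by linarith), mul_sub, mul_one, ← Real.exp_add]; congr 2; ring
    have hbs : b < s := Real.exp_lt_exp.1 (by rw [eb]; have := Real.exp_pos z; linarith)
    have cI : Continuous (fun y : ℝ => Real.exp (y-z)) := by fun_prop
    have iI : Integrable ((Ioo b s).indicator fun y => Real.exp (y-z)) :=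
      ((cI.integrableOn_Icc).mono_set Ioo_subset_Icc_self).integrable_indicator measurableSet_Ioo
    have vI : ∫ y, (Ioo b s).indicator (fun y => Real.exp (y-z)) y = 1 := by
      rw [integral_indicator measurableSet_Ioo, ← integral_Ioc_eq_integral_Ioo, ← intervalIntegral.integral_of_le hbs.le]
      simp only [sub_eq_add_neg, Real.exp_add]
      rw [intervalIntegral.integral_mul_const, integral_exp, eb, Real.exp_neg]
      have := (Real.exp_pos z).ne'
      field_simp; ring
    set X : ℝ → ℝ := fun y => (AC s).indicator (fun p : ℝ × ℝ => kk a κ p * phi2 ρ L p.1) (y,z) with hX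
    have dom : ∀ y, |EE ρ L s * X y - Real.exp (-a*z) * (Ioo b s).indicator (fun y => Real.exp (y-z)) y| ≤
        (4*K0+2) * (Real.exp (δ*(z-s)) * Real.exp (-a*z)) * (Ioo b s).indicator (fun y => Real.exp (y-z)) y := by
      intro y
      by_cases hy : y ∈ Ioo b s
      · have hly : Real.exp s < Real.exp y + Real.exp z := by
          have := Real.exp_lt_exp.2 hy.1; rw [eb] at this; linarith
        rw [indicator_of_mem hy]
        by_cases hzy : z < y
        · have hA : (y,z) ∈ AC s := ⟨⟨hy.2, hly⟩, hzy⟩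
          have hh := half_lt hzy.le (lt_lam.2 hly)
          rw [hX]; simp only
          rw [indicator_of_mem hA]; simp only
          have hLy : L ≤ y := by linarith
          unfold phi2
          rw [if_neg (not_lt.2 hLy), kk_sym hk]
          unfold kk
          simp only
          set w := Real.exp (ρ*(s-y)) with hw
          have ew : EE ρ L s * Real.exp (-ρ*(y-L)) = w := by
            unfold EE; rw [← Real.exp_add, hw]; congr 1; ring
          have hsy : y < s := hy.2
          have w1 : 1 ≤ w := Real.one_le_exp (mul_nonneg hρ.le (by linarith))
          have hsum : Real.exp s ≤ 2 * Real.exp y := by have := Real.exp_lt_exp.2 hzy; linarith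
          have e2 : Real.exp (s-y) ≤ 2 := by
            rw [Real.exp_sub, div_le_iff₀ (Real.exp_pos y)]; exact hsum
          have w2 : w ≤ Real.exp (s-y) := Real.exp_le_exp.2 (by nlinarith)
          have hd : Real.exp (z-s) ≤ Real.exp (δ*(z-s)) := Real.exp_le_exp.2 (by nlinarith)
          have w3 : w - 1 ≤ 2 * Real.exp (δ*(z-s)) := by
            have h1 : Real.exp (s-y) - 1 ≤ Real.exp (z-y) := by
              rw [Real.exp_sub, Real.exp_sub, sub_le_iff_le_add, div_add_one (Real.exp_pos y).ne']
              exact div_le_div_of_nonneg_right (by linarith) (Real.exp_pos y).le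
            have h2 : Real.exp (z-y) = Real.exp (z-s) * Real.exp (s-y) := by rw [← Real.exp_add]; congr 1; ring
            have h3 : Real.exp (z-s) * Real.exp (s-y) ≤ Real.exp (δ*(z-s)) * 2 :=
              mul_le_mul hd e2 (Real.exp_pos _).le (Real.exp_pos _).le
            linarith
          have k1 := hk.near (t := z-y) (by linarith)
          have k2 : Real.exp (δ*(z-y)) ≤ 2 * Real.exp (δ*(z-s)) := by
            have h2 : Real.exp (δ*(z-y)) = Real.exp (δ*(z-s)) * Real.exp (δ*(s-y)) := by rw [← Real.exp_add]; congr 1; ring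
            have h3 : Real.exp (δ*(s-y)) ≤ Real.exp (s-y) := Real.exp_le_exp.2 (by nlinarith)
            rw [h2, mul_comm]
            exact mul_le_mul_of_nonneg_right (by linarith) (Real.exp_pos _).le
          have k3 : |κ (z-y) - 1| ≤ 2*K0*Real.exp (δ*(z-s)) := k1.trans (by nlinarith)
          have fin : |κ (z-y) * w - 1| ≤ (4*K0+2) * Real.exp (δ*(z-s)) := by
            have e : κ (z-y) * w - 1 = (κ (z-y) - 1)*w + (w-1) := by ring
            rw [e]
            refine (abs_add_le _ _).trans ?_
            rw [abs_mul, abs_of_nonneg (show 0 ≤ w - 1 by linarith), abs_of_nonneg (show 0 ≤ w by linarith)]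
            have := mul_le_mul k3 (show w ≤ 2 by linarith) (by linarith) (by positivity)
            linarith
          have e : EE ρ L s * (Real.exp (y-z) * (Real.exp (-a*z) * κ (z-y)) * Real.exp (-ρ*(y-L))) - Real.exp (-a*z) * Real.exp (y-z)
              = (Real.exp (-a*z) * Real.exp (y-z)) * (κ (z-y) * w - 1) := by rw [← ew]; ring
          rw [e, abs_mul, abs_of_pos (by positivity)]
          calc _ ≤ (Real.exp (-a*z) * Real.exp (y-z)) * ((4*K0+2) * Real.exp (δ*(z-s))) := by gcongr
            _ = _ := by ring
        · have : X y = 0 := indicator_of_notMem (fun h => hzy h.2) _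
          rw [this, mul_zero, zero_sub, abs_neg, abs_of_pos (by positivity)]
          have h2 : 1 ≤ 2 * Real.exp (δ*(z-s)) := by
            have := Real.exp_le_exp.2 (not_lt.1 hzy)
            have h1 : Real.exp (s-z) ≤ 2 := by
              rw [Real.exp_sub, div_le_iff₀ (Real.exp_pos z)]; linarith
            have h3 : Real.exp (δ*(s-z)) ≤ Real.exp (s-z) := Real.exp_le_exp.2 (by nlinarith)
            have h4 : Real.exp (δ*(s-z)) * Real.exp (δ*(z-s)) = 1 := by
              rw [← Real.exp_add]; rw [show δ*(s-z) + δ*(z-s) = 0 by ring, Real.exp_zero]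
            rw [← h4]
            exact mul_le_mul_of_nonneg_right (by linarith) (Real.exp_pos _).le
          have h3 : 1 ≤ (4*K0+2) * Real.exp (δ*(z-s)) := by
            have := mul_pos hK (Real.exp_pos (δ*(z-s))); linarith
          calc _ = 1 * (Real.exp (-a*z) * Real.exp (y-z)) := by ring
            _ ≤ ((4*K0+2) * Real.exp (δ*(z-s))) * (Real.exp (-a*z) * Real.exp (y-z)) := by gcongr
            _ = _ := by ring
      · rw [indicator_of_notMem hy]
        have : X y = 0 := by
          refine indicator_of_notMem (fun h => hy ⟨?_, h.1.1⟩) _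
          have h1 : Real.exp s < Real.exp y + Real.exp z := h.1.2
          exact Real.exp_lt_exp.1 (by rw [eb]; linarith)
        rw [this]; simp
    have mX : Measurable X := by
      have h1 := hk.kk_cont.measurable
      have h2 : Measurable (phi2 ρ L) := Measurable.ite measurableSet_Iio measurable_const (by fun_prop)
      have h3 : Measurable ((AC s).indicator (fun p : ℝ × ℝ => kk a κ p * phi2 ρ L p.1)) :=
        Measurable.indicator (by fun_prop) (AC_meas s)
      exact h3.comp (by fun_prop : Measurable fun y : ℝ => (y,z))
    have iF : Integrable (fun y => EE ρ L s * X y - Real.exp (-a*z) * (Ioo b s).indicator (fun y => Real.exp (y-z)) y) := by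
      refine (iI.const_mul ((4*K0+2) * (Real.exp (δ*(z-s)) * Real.exp (-a*z)))).mono' ?_ (Eventually.of_forall dom)
      exact ((mX.aestronglyMeasurable.const_mul _).sub (iI.aestronglyMeasurable.const_mul _))
    have iX : Integrable (fun y => EE ρ L s * X y) := by
      have := iF.add (iI.const_mul (Real.exp (-a*z)))
      refine this.congr (Eventually.of_forall fun y => ?_)
      simp only [Pi.add_apply]; ring
    have main := norm_integral_le_of_norm_le
      (f := fun y => EE ρ L s * X y - Real.exp (-a*z) * (Ioo b s).indicator (fun y => Real.exp (y-z)) y)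
      (iI.const_mul ((4*K0+2) * (Real.exp (δ*(z-s)) * Real.exp (-a*z)))) (Eventually.of_forall dom)
    rw [integral_sub iX (iI.const_mul _), integral_const_mul, integral_const_mul, integral_const_mul, vI, mul_one, mul_one] at main
    exact main

theorem AClim (hk : Ker a K0 δ κ) (hρ : 0 < ρ) (hρ1 : ρ ≤ 1) (hu : kU a L ≤ 1/4) (hg : Cls a ρ L cg g) {s : ℝ} (hs : L + Real.log 2 ≤ s) :
    |EE ρ L s * bil a κ (AC s) (phi2 ρ L) g - l2 a g| ≤ (4*K0+2) * (Real.exp (-δ*s) * ∫ z, |Real.exp (-(a-δ)*z) * g z|) := by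
  obtain ⟨ha, hK, hδ, hδ1, hδa, -⟩ := id hk
  have hp := phi2_cls (ρ := ρ) ha hu
  have i0 := ((hk.bil_int hρ hp hg s).mono_set (AC_sub s)).integrable_indicator (AC_meas s)
  have e0 : bil a κ (AC s) (phi2 ρ L) g = ∫ z, ∫ y, (AC s).indicator (fun p : ℝ × ℝ => kk a κ p * phi2 ρ L p.1 * g p.2) (y,z) := by
    unfold bil
    rw [← integral_indicator (AC_meas s)]
    exact integral_prod_symm _ i0
  have e1 : ∀ z, (∫ y, (AC s).indicator (fun p : ℝ × ℝ => kk a κ p * phi2 ρ L p.1 * g p.2) (y,z)) =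
      (∫ y, (AC s).indicator (fun p : ℝ × ℝ => kk a κ p * phi2 ρ L p.1) (y,z)) * g z := by
    intro z
    rw [← integral_mul_const]
    congr 1; ext y
    by_cases h : (y,z) ∈ AC s
    · rw [indicator_of_mem h, indicator_of_mem h]
    · rw [indicator_of_notMem h, indicator_of_notMem h, zero_mul]
  have i1 := i0.integral_prod_right
  have i2 := hg.int_full ha hρ (show -a < 0 by linarith)
  have i3 := hg.int_full ha hρ (show -(a-δ) < 0 by linarith)
  have ee : EE ρ L s * bil a κ (AC s) (phi2 ρ L) g - l2 a g = ∫ z, 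
      (EE ρ L s * (∫ y, (AC s).indicator (fun p : ℝ × ℝ => kk a κ p * phi2 ρ L p.1) (y,z)) - Real.exp (-a*z)) * g z := by
    unfold l2
    rw [e0, ← integral_const_mul, ← integral_sub (i1.const_mul _) i2]
    congr 1; ext z
    rw [e1]; ring
  rw [ee, ← Real.norm_eq_abs, ← integral_const_mul, ← integral_const_mul]
  refine norm_integral_le_of_norm_le ((i3.norm.const_mul _).const_mul _) (Eventually.of_forall fun z => ?_)
  rw [norm_mul, Real.norm_eq_abs, Real.norm_eq_abs]
  have := mul_le_mul_of_nonneg_right (ACz hk hρ hρ1 hs z) (abs_nonneg (g z))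
  refine this.trans (le_of_eq ?_)
  rw [abs_mul, Real.abs_exp, ← Real.exp_add]
  rw [show δ*(z-s) + -a*z = -δ*s + -(a-δ)*z by ring, Real.exp_add]; ring
end

theorem lim_iter {θ e : ℝ → ℝ} {B S0 r : ℝ} (hr : 0 ≤ r) (he : Tendsto e atTop (nhds 0)) (hB : ∀ s ≥ S0, |θ s| ≤ B)
    (h : ∀ s ≥ S0 + r, ∀ b, (∀ y, s - r < y → y ≤ s → |θ y| ≤ b) → |θ s| ≤ e s + b/2) :
    Tendsto θ atTop (nhds 0) := by
  have hB0 : 0 ≤ B := (abs_nonneg _).trans (hB S0 le_rfl)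
  have key : ∀ η > 0, ∀ n : ℕ, ∃ S, S0 ≤ S ∧ ∀ s ≥ S, |θ s| ≤ B/2^n + 2*η := by
    intro η hη n
    induction n with
    | zero => exact ⟨S0, le_rfl, fun s hs => (hB s hs).trans (by simp; linarith)⟩
    | succ n ih =>
      obtain ⟨S, hS, hh⟩ := ih
      obtain ⟨S1, h1⟩ := eventually_atTop.1 (he.eventually (gt_mem_nhds hη))
      refine ⟨max (S+r) S1, by have := le_max_left (S+r) S1; linarith, fun s hs => ?_⟩
      have a1 : S + r ≤ s := (le_max_left _ _).trans hs
      have a2 : S1 ≤ s := (le_max_right _ _).trans hs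
      have := h s (by linarith) _ (fun y hy _ => hh y (by linarith))
      have := h1 s a2
      rw [pow_succ]
      have e : B/(2^n*2) = (B/2^n)/2 := by field_simp
      linarith
  rw [Metric.tendsto_atTop]
  intro ε hε
  obtain ⟨n, hn⟩ := pow_unbounded_of_one_lt (2*B/ε) (show (1:ℝ) < 2 by norm_num)
  obtain ⟨S, -, hS⟩ := key (ε/8) (by positivity) n
  refine ⟨S, fun s hs => ?_⟩
  rw [Real.dist_eq, sub_zero]
  have h2 : B/2^n ≤ ε/2 := by
    rw [div_le_iff₀ (by positivity)]
    rw [div_lt_iff₀ hε] at hn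
    linarith
  have := hS s hs
  linarith

section
variable {a K0 δ : ℝ} {κ : ℝ → ℝ} {ρ L cg C D : ℝ} {g : ℝ → ℝ}

theorem exp_decay {c : ℝ} (hc : 0 < c) : Tendsto (fun s => Real.exp (-c*s)) atTop (nhds 0) :=
  Real.tendsto_exp_atBot.comp (tendsto_id.const_mul_atTop_of_neg (neg_lt_zero.2 hc))

theorem bil_smul (A : Set (ℝ × ℝ)) (k : ℝ) (f g : ℝ → ℝ) : bil a κ A (fun s => k * f s) g = k * bil a κ A f g := by
  unfold bil
  rw [← integral_const_mul]
  congr 1; ext p; ring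

theorem G_lim (hk : Ker a K0 δ κ) : ∃ C, 0 < C ∧ ∀ ρ L D cg : ℝ, ∀ g : ℝ → ℝ, 0 < ρ → ρ ≤ 1 → 0 ≤ L → Cls a ρ L cg g →
    (∀ s ≥ L, vR a κ ρ L D g s = Gf ρ g s) → ∃ k, |k - D| ≤ ρ * C * cg * cg ∧
    Tendsto (fun s => EE ρ L s * Gf ρ g s) atTop (nhds k) := by
  obtain ⟨C, hC, H⟩ := Hint hk
  have hδ := hk.hδ
  refine ⟨2*C, by positivity, ?_⟩
  intro ρ L D cg g hρ hρ1 hL hg hv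
  have hcg := hg.nn
  set I : ℝ → ℝ := fun s => ∫ y in L..s, EE ρ L y * HH a κ ρ g g y with hI
  have ii := HH_ii hk hρ hg hg
  have hd : ∀ S1 S2, L ≤ S1 → S1 ≤ S2 → |I S2 - I S1| ≤ C * cg * cg * Real.exp (-(δ/2)*S1) := by
    intro S1 S2 h1 h2
    rw [hI]; simp only
    rw [intervalIntegral.integral_interval_sub_left (ii _ _) (ii _ _), intervalIntegral.integral_of_le h2]
    refine (H ρ L S1 S2 cg cg g g hρ hρ1 (hL.trans h1) h1 h2 hg hg).trans (le_of_eq (by ring))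
  have hcau : CauchySeq I := by
    rw [Metric.cauchySeq_iff']
    intro ε hε
    have := ((exp_decay (show 0 < δ/2 by linarith)).const_mul (C*cg*cg)).eventually (gt_mem_nhds (show C*cg*cg*0 < ε by simpa using hε))
    obtain ⟨N, hN⟩ := eventually_atTop.1 this
    refine ⟨max N L, fun n hn => ?_⟩
    rw [Real.dist_eq]
    exact lt_of_le_of_lt (hd _ _ (le_max_right _ _) hn) (hN _ (le_max_left _ _))
  obtain ⟨x, hx⟩ := cauchySeq_tendsto_of_complete hcau
  have hx1 : |x| ≤ C*cg*cg := by
    refine le_of_tendsto hx.abs ?_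
    filter_upwards [Ici_mem_atTop L] with s hs
    have := hd L s le_rfl hs
    have h0 : I L = 0 := by rw [hI]; exact intervalIntegral.integral_same
    rw [h0, sub_zero] at this
    refine this.trans (mul_le_of_le_one_right (by positivity) (Real.exp_le_one_iff.2 ?_))
    nlinarith
  refine ⟨D - ρ*(1+ρ)*x, ?_, ?_⟩
  · rw [show D - ρ*(1+ρ)*x - D = -(ρ*(1+ρ)*x) by ring, abs_neg, abs_mul, abs_of_pos (by positivity)]
    calc _ ≤ ρ*(1+1)*(C*cg*cg) := by gcongr
      _ = _ := by ring
  · have := (hx.const_mul (ρ*(1+ρ))).const_sub D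
    refine this.congr' ?_
    filter_upwards [Ici_mem_atTop L] with s hs
    rw [← hv s hs]
    unfold vR
    have := EE_inv ρ L s
    rw [← mul_assoc, mul_comm (EE ρ L s), this, one_mul]

set_option maxHeartbeats 1000000 in
theorem decay_lim (hk : Ker a K0 δ κ) : ∃ C, 0 < C ∧ ∀ ρ L D cg : ℝ, ∀ g : ℝ → ℝ, 0 < ρ → ρ ≤ 1 → 0 ≤ L → kU a L ≤ 1/4 → Cls a ρ L cg g →
    (∀ s, g s = ρ * bil a κ (AF s) g g) → l2 a g = 1/(1+ρ) → 
    (∀ s ≥ L, vR a κ ρ L D g s = Gf ρ g s) → ρ * C * cg ≤ 1/2 → ∃ k, |k - D| ≤ ρ * C * cg * cg ∧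
    Tendsto (fun s => EE ρ L s * g s) atTop (nhds k) := by
  obtain ⟨C1, hC1, H1⟩ := G_lim hk
  obtain ⟨C2, hC2, H2⟩ := HC hk
  obtain ⟨C3, hC3, H3⟩ := HA hk
  obtain ⟨ha, hK, hδ, hδ1, hδa, -⟩ := id hk
  refine ⟨C1 + C2, by positivity, ?_⟩
  intro ρ L D cg g hρ hρ1 hL hu hg hF hM hv hs
  have hcg := hg.nn
  obtain ⟨k, hk1, hk2⟩ := H1 ρ L D cg g hρ hρ1 hL hg hv
  have hl2 := Real.log_pos (show (1:ℝ) < 2 by norm_num)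
  have x1 : 0 ≤ ρ*C1*cg := by positivity
  have x2 : 0 ≤ ρ*C2*cg*cg := by positivity
  refine ⟨k, by linarith, ?_⟩
  have hp := phi2_cls (ρ := ρ) ha hu
  have hkp : Cls a ρ L (|k| * (3/2)) (fun s => k * phi2 ρ L s) :=
    ⟨hp.1.const_mul k, fun s => by rw [abs_mul, mul_assoc]; exact mul_le_mul_of_nonneg_left (hp.2 s) (abs_nonneg _)⟩
  set J := ∫ z, |Real.exp (-(a-δ)*z) * g z| with hJ
  set e : ℝ → ℝ := fun s => |EE ρ L s * Gf ρ g s - k| + (Real.exp (-a*s)/a + ρ*C3*Real.exp (-δ*s)) * cg * cg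
    + |k| * ((4*K0+2) * (Real.exp (-δ*s) * J)) with he
  have he0 : Tendsto e atTop (nhds 0) := by
    have t1 := (hk2.sub_const k).abs
    have t2 := ((((exp_decay ha).div_const a).add ((exp_decay hδ).const_mul (ρ*C3))).mul_const cg).mul_const cg
    have t3 := ((((exp_decay hδ).mul_const J)).const_mul (4*K0+2)).const_mul |k|
    have := (t1.add t2).add t3
    simpa [he] using this
  have main : Tendsto (fun s => EE ρ L s * g s - k) atTop (nhds 0) := by
    refine lim_iter (B := cg + |k|) (S0 := L) hl2.le he0 ?_ ?_
    · intro s hs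
      have h1 := hg.le_E ha hρ s
      have h2 := EE_inv ρ L s
      have h3 : |EE ρ L s * g s| ≤ cg := by
        rw [abs_mul, abs_of_pos (EE_pos ρ L s)]
        calc _ ≤ EE ρ L s * (cg * Real.exp (-ρ*(s-L))) := mul_le_mul_of_nonneg_left h1 (EE_pos ρ L s).le
          _ = _ := by linear_combination cg * h2
      have := abs_sub (EE ρ L s * g s) k
      linarith
    · intro s hs b hb
      have hLs : L ≤ s := by linarith
      have hE := EE_pos ρ L s
      have hinv := EE_inv ρ L s
      have bb := H2 ρ L s b _ cg (fun y => g y - k * phi2 ρ L y) g hρ hρ1 (hg.sub hkp) hg (fun y hy hys => by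
        have hLy : L ≤ y := by linarith
        have := hb y hy hys
        unfold phi2; rw [if_neg (not_lt.2 hLy)]
        have e1 : g y - k * Real.exp (-ρ*(y-L)) = (EE ρ L y * g y - k) * Real.exp (-ρ*(y-L)) := by
          linear_combination (-g y) * EE_inv ρ L y
        rw [e1, abs_mul, Real.abs_exp]
        exact mul_le_mul_of_nonneg_right this (Real.exp_pos _).le)
      have b1 := bb.1
      rw [bil_sub_left hk hρ hg hkp hg (AC_sub s), bil_smul] at b1
      have b2 := H3 ρ L s cg cg g g hρ hρ1 hLs hg hg
      have b3 := AClim hk hρ hρ1 hu hg hs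
      rw [← hF s, hM] at b2
      rw [hM] at b3
      have c1 := mul_le_mul_of_nonneg_left b1 hE.le
      have c2 := mul_le_mul_of_nonneg_left b2 hE.le
      rw [← abs_of_pos hE, ← abs_mul, abs_of_pos hE] at c1 c2
      set X := bil a κ (AC s) g g
      set Y := bil a κ (AC s) (phi2 ρ L) g
      have d1 : EE ρ L s * (C2*b*cg*Real.exp (-ρ*(s-L))) = C2*b*cg := by linear_combination C2*b*cg*hinv
      have d2 : EE ρ L s * ((Real.exp (-a*s)/a + ρ*C3*Real.exp (-δ*s)) * cg * cg * Real.exp (-ρ*(s-L))) =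
        (Real.exp (-a*s)/a + ρ*C3*Real.exp (-δ*s)) * cg * cg := by
          linear_combination (Real.exp (-a*s)/a + ρ*C3*Real.exp (-δ*s)) * cg * cg*hinv
      rw [d1] at c1
      rw [d2] at c2
      have id1 : EE ρ L s * g s - k = 1/(1+ρ) * (EE ρ L s * Gf ρ g s - k) +
          EE ρ L s * (g s - 1/(1+ρ)*Gf ρ g s - ρ*X) + ρ * (EE ρ L s * (X - k*Y)) + (ρ*k)*(EE ρ L s * Y - 1/(1+ρ)) := by
        have : 1/(1+ρ)*k + ρ*(1/(1+ρ))*k = k := by field_simp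
        linear_combination this
      rw [id1]
      have hM1 : 1/(1+ρ) ≤ 1 := by rw [div_le_one (by linarith)]; linarith
      have t1 : |1/(1+ρ) * (EE ρ L s * Gf ρ g s - k)| ≤ |EE ρ L s * Gf ρ g s - k| := by
        rw [abs_mul, abs_of_pos (by positivity)]
        exact mul_le_of_le_one_left (abs_nonneg _) hM1
      have t3 : |ρ * (EE ρ L s * (X - k*Y))| ≤ b/2 := by
        rw [abs_mul, abs_of_pos hρ]
        have hb0 : 0 ≤ b := (abs_nonneg _).trans (hb s (by linarith) le_rfl)
        calc _ ≤ ρ * (C2*b*cg) := by gcongr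
          _ = (ρ*C2*cg)*b := by ring
          _ ≤ 1/2*b := by
            refine mul_le_mul_of_nonneg_right ?_ hb0
            linarith
          _ = _ := by ring
      have t4 : |(ρ*k)*(EE ρ L s * Y - 1/(1+ρ))| ≤ |k| * ((4*K0+2) * (Real.exp (-δ*s) * J)) := by
        rw [abs_mul]
        refine mul_le_mul ?_ b3 (abs_nonneg _) (abs_nonneg _)
        rw [abs_mul, abs_of_pos hρ]
        exact mul_le_of_le_one_left (abs_nonneg _) hρ1
      have q1 := abs_add_le (1/(1+ρ) * (EE ρ L s * Gf ρ g s - k) + EE ρ L s * (g s - 1/(1+ρ)*Gf ρ g s - ρ*X) + ρ * (EE ρ L s * (X - k*Y))) ((ρ*k)*(EE ρ L s * Y - 1/(1+ρ)))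
      have q2 := abs_add_three (1/(1+ρ) * (EE ρ L s * Gf ρ g s - k)) (EE ρ L s * (g s - 1/(1+ρ)*Gf ρ g s - ρ*X)) (ρ * (EE ρ L s * (X - k*Y)))
      simp only [he]
      linarith
  have := main.add_const k
  simpa using this
end

set_option linter.unusedVariables false

section
variable {a K0 δ : ℝ} {κ : ℝ → ℝ}

set_option maxHeartbeats 1000000 in
theorem core (hk : Ker a K0 δ κ) {τ : ℝ} (hτ0 : 0 < τ) (hτ : τ ≤ 1/1000) : ∃ L1 : ℝ, 0 ≤ L1 ∧ ∀ L, L1 < L → ∃ r, 0 < r ∧ ∀ ρ, 0 < ρ → ρ < r →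
    ρ * L ≤ τ ∧ ∃ g : ℝ → ℝ, Continuous g ∧ Cls a ρ L 4 g ∧ (∀ s, g s = ρ * bil a κ (AF s) g g) ∧ e1 ρ g = 1 ∧ l2 a g = 1/(1+ρ) ∧
    (∀ s ≤ L, 7/8*(kU a s - kU a L) ≤ psi a κ ρ L g s) ∧
    (∀ s < L, |g s * Real.exp (psi a κ ρ L g s) - 1| ≤ 1/2) ∧
    (∀ s, L ≤ s → |g s - Real.exp (-ρ*(s-L))| ≤ 1/2 * Real.exp (-ρ*(s-L))) ∧
    ∃ k, |k - 1| ≤ 35*τ ∧ Tendsto (fun s => EE ρ L s * g s) atTop (nhds k) := by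
  obtain ⟨J, hJ, H1⟩ := HC hk
  obtain ⟨Cd, hCd, Hd⟩ := decay_lim hk
  have ha := hk.ha
  set θ := τ/(1+J) with hθ
  have hθ0 : 0 < θ := by positivity
  have hθτ : θ * (1+J) = τ := by rw [hθ]; field_simp
  have hJθ : 0 < J * θ := by positivity
  have hθ1 : θ ≤ τ := by linarith
  have ev : ∀ᶠ s in atTop, kU a s < θ/8 := by
    have : Tendsto (fun s => kU a s) atTop (nhds 0) := by
      unfold kU
      simpa using (exp_decay ha).div_const a
    exact this.eventually_lt_const (by positivity)
  obtain ⟨L1, hL1⟩ := eventually_atTop.1 ev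
  refine ⟨max L1 0, le_max_right _ _, fun L hL => ?_⟩
  have hL0 : 0 < L := (le_max_right _ _).trans_lt hL
  have hul := (hL1 L ((le_max_left _ _).trans hL.le)).le
  have hu : kU a L ≤ 1/4 := by linarith
  have hu0 := kU_pos ha L
  obtain ⟨CN, hCN, HN⟩ := NN_bound hk L hL0.le hu
  obtain ⟨Ce, hCe, He⟩ := e1_phi1 (a := a) (L := L)
  obtain ⟨CW, hCW, HW⟩ := int_W_le ha L
  obtain ⟨CQ, hCQ, HQ⟩ := Q_bound hk L
  obtain ⟨CP, hCP, HP⟩ := P_bound hk L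
  set S := CN + Ce + CW + CQ + CP + Cd + L + 1 with hS
  have hS0 : 0 < S := by positivity
  refine ⟨θ/1000/S, by positivity, fun ρ hρ hρr => ?_⟩
  have hρS : ρ * S ≤ θ/1000 := ((lt_div_iff₀ hS0).1 hρr).le
  rw [hS] at hρS
  have p1 := mul_pos hρ hCN
  have p2 := mul_pos hρ hCe
  have p3 := mul_pos hρ hCW
  have p4 := mul_pos hρ hCQ
  have p5 := mul_pos hρ hCP
  have p6 := mul_pos hρ hCd
  have p7 := mul_pos hρ hL0
  have hexp : ρ * (CN + Ce + CW + CQ + CP + Cd + L + 1) = ρ*CN+ρ*Ce+ρ*CW+ρ*CQ+ρ*CP+ρ*Cd+ρ*L+ρ := by ring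
  rw [hexp] at hρS
  have hρ1 : ρ ≤ 1 := by linarith
  refine ⟨by linarith, ?_⟩
  have hηθ : 4*kU a L + ρ*CN ≤ θ := by linarith
  have hl2 : ∀ c g, Cls a ρ L c g → |l2 a g| ≤ J*c := fun c g hg =>
    (H1 ρ L 0 (c * 1) c c g g hρ hρ1 hg hg (fun y _ _ => by rw [mul_one]; exact hg.le_E ha hρ y)).2
  have hee : ∀ c g, Cls a ρ L c g → |e1 ρ g| ≤ 2*c := by
    intro c g hg
    have h1 : |∫ s, g s| ≤ ∫ s, c * kW a ρ L s := by
      rw [← Real.norm_eq_abs]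
      exact norm_integral_le_of_norm_le (f := g) ((int_W ha hρ).const_mul c) (Eventually.of_forall hg.2)
    rw [integral_const_mul] at h1
    unfold e1
    rw [abs_mul, abs_of_pos hρ]
    have h2 := HW ρ hρ
    have h3 := hg.nn
    calc _ ≤ ρ * (c * ∫ s, kW a ρ L s) := by gcongr
      _ = c * (ρ * ∫ s, kW a ρ L s) := by ring
      _ ≤ c * 2 := by gcongr; linarith
      _ = _ := by ring
  obtain ⟨g, C, D, hg, hgT, he, hl, hC, hD⟩ := fixpt hk hu hρ (τ := τ) (η := 4*kU a L + ρ*CN) (J := J) hτ (by positivity) (by linarith)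
    (by have := mul_le_mul_of_nonneg_left hηθ hJ.le; linarith) (by have := (He ρ hρ).2; linarith) (by linarith) (by linarith)
    (HN ρ hρ hρ1) hl2 hee
  have hsol : ∀ s, g s = ρ * bil a κ (AF s) g g := by
    intro s
    rcases lt_or_ge s L with h | h
    · exact sol_left hk hρ hg hgT he h
    · exact (sol_right hk hρ hρ1 hL0.le hg hgT hl h).1
  have hQb : ∀ y ≤ L, |Qf κ ρ g y - 1| ≤ 1/8 := by
    intro y hy
    have := HQ ρ hρ 4 g hg y hy
    rw [show ρ * ∫ z, g z = 1 from he] at this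
    linarith
  have hB : ∀ s ≤ L, |ρ * bil a κ (AP s) g g| ≤ (1/50) * Real.exp (-(5/4)*kU a s) := by
    intro s hs
    have := HP ρ hρ 4 4 g g hg hg s hs
    rw [abs_mul, abs_of_pos hρ]
    calc _ ≤ ρ * (CP*4*4*Real.exp (-(5/4)*kU a s)) := by gcongr
      _ = (16*(ρ*CP)) * Real.exp (-(5/4)*kU a s) := by ring
      _ ≤ _ := mul_le_mul_of_nonneg_right (by linarith) (Real.exp_pos _).le
  refine ⟨g, sol_cont hk hρ hg hsol, hg, hsol, he, hl, fun s hs => (psi_bd hk hρ hg hQb hs).1, ?_, ?_, ?_⟩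
  · intro s hs
    have h1 := left_bd hk hρ hg hgT he hQb hB hs
    have := abs_sub_le (g s * Real.exp (psi a κ ρ L g s)) C 1
    linarith
  · intro s hs
    have h1 := right_bd ha hρ hgT (HN ρ hρ hρ1 4 4 g g hg hg) hs
    set X := Real.exp (-ρ*(s-L))
    have hX : 0 < X := Real.exp_pos _
    have h2 := abs_sub_le (g s) (D*X) X
    have h3 : |D*X - X| ≤ 1/10*X := by
      rw [show D*X - X = (D-1)*X by ring, abs_mul, abs_of_pos hX]
      exact mul_le_mul_of_nonneg_right (by linarith) hX.le
    have h4 : (4*kU a L + ρ*CN)*4*4*X ≤ 1/10*X := mul_le_mul_of_nonneg_right (by linarith) hX.le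
    linarith
  · obtain ⟨k, hk1, hk2⟩ := Hd ρ L D 4 g hρ hρ1 hL0.le hu hg hsol hl (fun s hs => (sol_right hk hρ hρ1 hL0.le hg hgT hl hs).2) (by linarith)
    refine ⟨k, ?_, hk2⟩
    have := abs_sub_le k D 1
    linarith
end

theorem ker_of_hyp {K : ℝ → ℝ → ℝ} {γ a K0 δ : ℝ} (hK : KernelHyp K γ a K0 δ) :
    Ker a K0 δ (fun t => Real.exp (a*t) * K (Real.exp t) 1) := by
  obtain ⟨h1, h2, hc, hn, hs, hh, hK0, hδ, hnear⟩ := hK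
  have ha : 0 < a := by linarith
  refine ⟨ha, hK0, hδ.1, hδ.2.trans_le (min_le_left _ _), hδ.2.trans_le (min_le_right _ _), ?_, ?_, ?_, ?_⟩
  · have : Continuous (fun t : ℝ => K (Real.exp t) 1) := by
      have hf : Continuous (fun t : ℝ => ((Real.exp t, 1) : ℝ × ℝ)) := by fun_prop
      exact hc.comp_continuous hf (fun t => ⟨Real.exp_pos t, show (0:ℝ) < 1 from one_pos⟩)
    exact (by fun_prop : Continuous fun t : ℝ => Real.exp (a*t)).mul this
  · intro t
    exact mul_nonneg (Real.exp_pos _).le (hn _ _ (Real.exp_pos _) one_pos)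
  · intro t
    have e1 : K (Real.exp t) 1 = Real.exp (γ*t) * K (Real.exp (-t)) 1 := by
      have := hh (Real.exp (-t)) 1 (Real.exp t) (Real.exp_pos _) one_pos (Real.exp_pos _)
      rw [← Real.exp_add, add_neg_cancel, Real.exp_zero, mul_one, ← Real.exp_mul] at this
      rw [hs _ _ (Real.exp_pos _) one_pos, this, mul_comm γ]
    show Real.exp (a*t) * K (Real.exp t) 1 = Real.exp ((1+a)*t) * (Real.exp (a * -t) * K (Real.exp (-t)) 1)
    rw [e1, ← mul_assoc, ← mul_assoc, ← Real.exp_add, ← Real.exp_add]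
    congr 2
    rw [h2]; ring
  · intro t ht
    have hx : Real.exp t ∈ Ioo (0:ℝ) 2 := ⟨Real.exp_pos t, by rw [← Real.lt_log_iff_exp_lt (by norm_num)]; exact ht⟩
    have := hnear _ hx
    rw [← Real.exp_mul, ← Real.exp_mul, mul_comm t, mul_comm t] at this
    exact this

theorem resc {ρ : ℝ} (hρ : 0 < ρ) (f : ℝ → ℝ) : ∫ y, f (y/ρ) = ρ * ∫ y, f y := by
  rw [Measure.integral_comp_div, abs_of_pos hρ, smul_eq_mul]

theorem resc_set {ρ : ℝ} (hρ : 0 < ρ) {S T : Set ℝ} (hS : MeasurableSet S) (hT : MeasurableSet T)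
    (hST : ∀ y, y ∈ S ↔ y/ρ ∈ T) (f : ℝ → ℝ) : ∫ y in S, f (y/ρ) = ρ * ∫ y in T, f y := by
  rw [← integral_indicator hS, ← integral_indicator hT, ← resc hρ]
  congr 1; ext y
  by_cases h : y ∈ S
  · rw [indicator_of_mem h, indicator_of_mem ((hST y).1 h)]
  · rw [indicator_of_notMem h, indicator_of_notMem (fun h' => h ((hST y).2 h'))]

section
variable {K : ℝ → ℝ → ℝ} {a K0 δ ρ L : ℝ} {κ g : ℝ → ℝ}

theorem resc_Q (hρ : 0 < ρ) (hκ : κ = fun t => Real.exp (a*t) * K (Real.exp t) 1) (y : ℝ) :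
    Qfun K a ρ (fun x => g (x/ρ)) y = Qf κ ρ g (y/ρ) := by
  unfold Qfun Qf
  rw [← resc hρ]
  congr 1; ext z
  rw [hκ]
  simp only
  rw [show y/ρ - z/ρ = (y-z)/ρ by ring, show a*((y-z)/ρ) = a/ρ*(y-z) by ring]

theorem resc_psi (hρ : 0 < ρ) (hκ : κ = fun t => Real.exp (a*t) * K (Real.exp t) 1) {x : ℝ} (hx : x ≤ L*ρ) :
    psiFn K a L ρ (fun x => g (x/ρ)) x = psi a κ ρ L g (x/ρ) := by
  unfold psiFn psi
  rw [intervalIntegral.integral_of_le (by rwa [div_le_iff₀ hρ]), integral_Ioc_eq_integral_Ioo]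
  have := resc_set hρ (S := Ioo x (L*ρ)) (T := Ioo (x/ρ) L) measurableSet_Ioo measurableSet_Ioo
    (fun y => by simp only [mem_Ioo]; rw [div_lt_div_iff_of_pos_right hρ, div_lt_iff₀ hρ]) (fun y => Real.exp (-a*y) * Qf κ ρ g y)
  have e : ∀ y, Real.exp (-(a/ρ)*y) * Qfun K a ρ (fun x => g (x/ρ)) y = Real.exp (-a*(y/ρ)) * Qf κ ρ g (y/ρ) := by
    intro y
    rw [resc_Q hρ hκ]; congr 2; ring
  simp only [e]
  rw [this]
  field_simp

theorem resc_E (hk : Ker a K0 δ κ) (hρ : 0 < ρ) (hκ : κ = fun t => Real.exp (a*t) * K (Real.exp t) 1) {c : ℝ}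
    (hg : Cls a ρ L c g) (h : ∀ s, g s = ρ * bil a κ (AF s) g g) : solvesE K a ρ (fun x => g (x/ρ)) := by
  intro x
  simp only
  rw [h (x/ρ), bil_F_iter hk hρ hg hg]
  have in1 : ∀ y, (∫ z in Ioi (x + ρ * Real.log (1 - Real.exp ((y-x)/ρ))),
      Real.exp (-(a/ρ)*z) * K (Real.exp ((y-z)/ρ)) 1 * g (y/ρ) * g (z/ρ)) =
      ρ * ∫ z in Ioi (x/ρ + Real.log (1 - Real.exp (y/ρ-x/ρ))), kk a κ (y/ρ, z) * g (y/ρ) * g z := by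
    intro y
    rw [← resc_set hρ (S := Ioi (x + ρ * Real.log (1 - Real.exp ((y-x)/ρ)))) measurableSet_Ioi measurableSet_Ioi]
    · congr 1; ext z
      congr 2
      unfold kk
      simp only [hκ]
      rw [← mul_assoc, ← Real.exp_add, show y/ρ - z/ρ = (y-z)/ρ by ring]
      congr 2
      ring
    · intro z
      simp only [mem_Ioi]
      rw [lt_div_iff₀ hρ, show y/ρ - x/ρ = (y-x)/ρ by ring, add_mul, div_mul_cancel₀ _ hρ.ne', mul_comm ρ]
  simp only [in1]
  rw [integral_const_mul]
  have := resc_set hρ (S := Iio x) (T := Iio (x/ρ)) measurableSet_Iio measurableSet_Iio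
    (fun y => by simp only [mem_Iio]; rw [div_lt_div_iff_of_pos_right hρ])
    (fun y => ∫ z in Ioi (x/ρ + Real.log (1 - Real.exp (y-x/ρ))), kk a κ (y, z) * g y * g z)
  rw [this]
  field_simp
end

theorem psi_low {a m L s P : ℝ} (ha : 0 < a) (hm : 1 < m) (hL : 0 ≤ L) (hmL : 4*m ≤ Real.exp (a*L)) (hs : s ≤ -L)
    (hP : 7/8*(kU a s - kU a L) ≤ P) : -P ≤ m*(s+L) := by
  have h1 : kU a L ≤ 1/a := by
    unfold kU
    have : Real.exp (-a*L) ≤ 1 := Real.exp_le_one_iff.2 (by nlinarith)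
    gcongr
  have h2 : 4*m/a + 4*m*(-s-L) ≤ kU a s := by
    unfold kU
    have e : Real.exp (-a*s) = Real.exp (a*L) * Real.exp (a*(-s-L)) := by rw [← Real.exp_add]; congr 1; ring
    have h3 := Real.add_one_le_exp (a*(-s-L))
    have h4 : 0 ≤ a*(-s-L) := mul_nonneg ha.le (by linarith)
    have h5 : 4*m*(a*(-s-L)+1) ≤ Real.exp (-a*s) := by
      rw [e]; exact mul_le_mul hmL h3 (by linarith) (Real.exp_pos _).le
    rw [le_div_iff₀ ha]
    have : (4*m/a + 4*m*(-s-L))*a = 4*m*(a*(-s-L)+1) := by field_simp; ring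
    linarith
  have h6 : 1/a ≤ 4*m/a := by gcongr; linarith
  have h7 : 0 ≤ m*(-s-L) := mul_nonneg (by linarith) (by linarith)
  nlinarith

set_option maxHeartbeats 1000000 in
theorem fin_aux {K : ℝ → ℝ → ℝ} {a m L ρ K0 δ τ ε k : ℝ} {κ g : ℝ → ℝ} (hk : Ker a K0 δ κ) (hρ : 0 < ρ) (hκ : κ = fun t => Real.exp (a*t) * K (Real.exp t) 1)
    (hm : 1 < m) (hL : 0 ≤ L) (hmL : 4*m ≤ Real.exp (a*L)) (hτ0 : 0 < τ) (hτ : τ ≤ 1/1000) (hτε : 100*τ ≤ ε) (hρL : ρ * L ≤ τ)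
    (hc : Continuous g) (hg : Cls a ρ L 4 g) (hs : ∀ s, g s = ρ * bil a κ (AF s) g g) (he : e1 ρ g = 1) (hl : l2 a g = 1/(1+ρ))
    (hps : ∀ s ≤ L, 7/8*(kU a s - kU a L) ≤ psi a κ ρ L g s)
    (hleft : ∀ s < L, |g s * Real.exp (psi a κ ρ L g s) - 1| ≤ 1/2)
    (hright : ∀ s, L ≤ s → |g s - Real.exp (-ρ*(s-L))| ≤ 1/2 * Real.exp (-ρ*(s-L)))
    (hk1 : |k - 1| ≤ 35*τ) (hk2 : Tendsto (fun s => EE ρ L s * g s) atTop (nhds k)) :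
    ∃ h : ℝ → ℝ, memX a m L ρ h ∧ Continuous h ∧ solvesE K a ρ h ∧
          (∀ x : ℝ, x < L*ρ →
            (1/4) * Real.exp (-psiFn K a L ρ h x) ≤ h x ∧
            h x ≤ 2 * Real.exp (-psiFn K a L ρ h x)) ∧
          (∀ x : ℝ, L*ρ ≤ x →
            (1/4) * Real.exp (-(x - L*ρ)) ≤ h x ∧ h x ≤ 2 * Real.exp (-(x - L*ρ))) ∧
          ∃ k : ℝ, 0 < k ∧ |k - 1| < ε ∧
            Tendsto (fun x : ℝ => Real.exp x * h x) atTop (nhds k) := by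
  have ha := hk.ha
  have hh : Continuous (fun x => g (x/ρ)) := by fun_prop
  have L1 : ∀ x, x < L*ρ → (1/4) * Real.exp (-psi a κ ρ L g (x/ρ)) ≤ g (x/ρ) ∧ g (x/ρ) ≤ 2 * Real.exp (-psi a κ ρ L g (x/ρ)) := by
    intro x hx
    have hx' : x/ρ < L := by rwa [div_lt_iff₀ hρ]
    have h1 := abs_le.1 (hleft _ hx')
    rw [Real.exp_neg, ← div_eq_mul_inv, ← div_eq_mul_inv, div_le_iff₀ (Real.exp_pos _), le_div_iff₀ (Real.exp_pos _)]
    constructor <;> linarith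
  have R1 : ∀ x, L*ρ ≤ x → (1/4) * Real.exp (-(x - L*ρ)) ≤ g (x/ρ) ∧ g (x/ρ) ≤ 2 * Real.exp (-(x - L*ρ)) := by
    intro x hx
    have hx' : L ≤ x/ρ := by rwa [le_div_iff₀ hρ]
    have h1 := abs_le.1 (hright _ hx')
    rw [show -ρ*(x/ρ-L) = -(x-L*ρ) by field_simp] at h1
    have := Real.exp_pos (-(x-L*ρ))
    constructor <;> linarith
  refine ⟨fun x => g (x/ρ), ⟨hh.continuousOn, ?_, ?_, ?_⟩, hh, resc_E hk hρ hκ hg hs, ?_, R1, ?_⟩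
  · rw [resc hρ]; exact he
  · rw [← hl]
    have := resc hρ (fun s => Real.exp (-a*s) * g s)
    unfold l2
    have e : ∀ x, Real.exp (-(a/ρ)*x) * g (x/ρ) = Real.exp (-a*(x/ρ)) * g (x/ρ) := fun x => by congr 2; ring
    simp only [e]
    rw [this]; field_simp
  · intro x
    simp only
    have hpos : 0 ≤ g (x/ρ) := by
      rcases lt_or_ge x (L*ρ) with h | h
      · exact le_trans (by positivity) (L1 x h).1
      · exact le_trans (by positivity) (R1 x h).1
    rw [abs_of_nonneg hpos]
    unfold omegaFn
    split_ifs with h1 h2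
    · have hxL : x < L*ρ ∨ x = L*ρ := lt_or_eq_of_le (h1.trans (by have := mul_nonneg hL hρ.le; linarith))
      rcases hxL with hxL | hxL
      · refine (L1 x hxL).2.trans ?_
        have hx' : x/ρ ≤ -L := by rw [div_le_iff₀ hρ]; linarith
        have := psi_low ha hm hL hmL hx' (hps _ (by linarith))
        rw [show m*(x/ρ+L) = m/ρ*(x+L*ρ) by field_simp] at this
        gcongr
      · have h0 : L*ρ = 0 := le_antisymm (by linarith) (mul_nonneg hL hρ.le)
        have := (R1 x hxL.ge).2
        rw [hxL, h0] at this
        rw [hxL, h0]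
        simpa using this
    · refine (L1 x h2).2.trans ?_
      have hx' : x/ρ ≤ L := by rw [div_le_iff₀ hρ]; exact h2.le
      have h3 := hps _ hx'
      have h4 := kU_anti ha hx'
      gcongr
      linarith
    · refine (R1 x (not_lt.1 h2)).2.trans ?_
      gcongr
      linarith
  · intro x hx
    rw [resc_psi hρ hκ hx.le]
    exact L1 x hx
  · have hk' := abs_le.1 hk1
    have hx0 : 0 ≤ ρ*L := by positivity
    have b1 : Real.exp (ρ*L) - 1 ≤ 2*τ := by
      have := Real.abs_exp_sub_one_le (x := ρ*L) (by rw [abs_of_nonneg hx0]; linarith)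
      rw [abs_of_nonneg hx0] at this
      have := le_abs_self (Real.exp (ρ*L) - 1)
      linarith
    have b2 : 1 ≤ Real.exp (ρ*L) := Real.one_le_exp hx0
    refine ⟨Real.exp (ρ*L) * k, mul_pos (Real.exp_pos _) (by linarith), ?_, ?_⟩
    · rw [show Real.exp (ρ*L)*k - 1 = Real.exp (ρ*L)*(k-1) + (Real.exp (ρ*L) - 1) by ring]
      refine (abs_add_le _ _).trans_lt ?_
      rw [abs_mul, Real.abs_exp, abs_of_nonneg (sub_nonneg.2 b2)]
      have : Real.exp (ρ*L) * |k-1| ≤ 2 * (35*τ) := mul_le_mul (by linarith) hk1 (abs_nonneg _) (by norm_num)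
      linarith
    · have t := (hk2.comp (tendsto_id.atTop_div_const hρ)).const_mul (Real.exp (ρ*L))
      refine t.congr fun x => ?_
      simp only [Function.comp, EE, id]
      rw [← mul_assoc, ← Real.exp_add]
      congr 2
      field_simp
      ring

/-- existence of a solution with sharp decay at both ends
(Theorems 3.1, 5.1 and 6.3 of the paper combined). -/
theorem solution_with_sharp_decay
    (K : ℝ → ℝ → ℝ) (γ a K0 δ m L0 ρ0 : ℝ)
    (hK : KernelHyp K γ a K0 δ) (hP : ParamHyp a m L0 ρ0) :
    ∀ ε : ℝ, 0 < ε → ∃ L2 : ℝ, L0 ≤ L2 ∧ ∃ ρ2 : ℝ → ℝ,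
      (∀ L : ℝ, L2 < L → ρ2 L ∈ Ioo 0 ρ0) ∧
      ∀ L : ℝ, L2 < L → ∀ ρ ∈ Ioo 0 (ρ2 L),
        ∃ h : ℝ → ℝ, memX a m L ρ h ∧ Continuous h ∧ solvesE K a ρ h ∧
          (∀ x : ℝ, x < L*ρ →
            (1/4) * Real.exp (-psiFn K a L ρ h x) ≤ h x ∧
            h x ≤ 2 * Real.exp (-psiFn K a L ρ h x)) ∧
          (∀ x : ℝ, L*ρ ≤ x →
            (1/4) * Real.exp (-(x - L*ρ)) ≤ h x ∧ h x ≤ 2 * Real.exp (-(x - L*ρ))) ∧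
          ∃ k : ℝ, 0 < k ∧ |k - 1| < ε ∧
            Tendsto (fun x : ℝ => Real.exp x * h x) atTop (nhds k) := by
  intro ε hε
  have hk := ker_of_hyp hK
  have ha := hk.ha
  obtain ⟨hm, hL0, hρ0⟩ := hP
  have hm1 : 1 < m := by have := (le_max_left _ _).trans_lt hm; linarith
  have hτ0 : 0 < min (1/1000) (ε/100) := by positivity
  obtain ⟨L1, hL1, H⟩ := core hk hτ0 (min_le_left _ _)
  choose! r hr0 hr using H
  refine ⟨max L0 L1, le_max_left _ _, fun L => min (r L) (ρ0/2), ?_, ?_⟩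
  · intro L hL
    have := hr0 L ((le_max_right _ _).trans_lt hL)
    have h0 := hρ0.1
    exact ⟨lt_min this (by linarith), (min_le_right _ _).trans_lt (by linarith)⟩
  · intro L hL ρ hρ
    have hLL1 := (le_max_right _ _).trans_lt hL
    have hLL0 := (le_max_left _ _).trans_lt hL
    obtain ⟨hρL, g, hc, hg, hs, he, hl, hps, h1, h2, k, hk1, hk2⟩ := hr L hLL1 ρ hρ.1 (hρ.2.trans_le (min_le_left _ _))
    refine fin_aux hk hρ.1 rfl hm1 (by linarith) ?_ hτ0 (min_le_left _ _) ?_ hρL hc hg hs he hl hps h1 h2 hk1 hk2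
    · rw [← Real.log_le_iff_le_exp (by linarith)]
      have h3 := hL0.trans hLL0
      rw [one_div, inv_mul_lt_iff₀ ha] at h3
      exact h3.le
    · have := min_le_right (1/1000) (ε/100)
      linarith
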